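/- Let (v,p) be a suitable weak solution of the Navier–Stokes equations in Q_T = Ω×(0,T), and let z₀ ∈ Q_T and r > 0 be such that the closure of Q_{z₀,r} is contained in Q_T. If there exist γ ∈ (3/2,∞] and α ∈ [2,∞) with 3/γ + 2/α ≤ 2 such that the weak spatial gradient satisfies ∇v ∈ L^{γ,α}_{x,t}(Q_{z₀,r}), then z₀ is a regular point of v. -/

import Mathlib

open MeasureTheory Set Filter ENNReal

noncomputable section

/-- Euclidean 3-space. -/
abbrev E3 := EuclideanSpace ℝ (Fin 3)

/-- The parabolic cylinder `Q_{z,r} = B_{x,r} × (t - r², t)`. -/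
def pcyl (z : E3 × ℝ) (r : ℝ) : Set (E3 × ℝ) :=
  (Metric.ball z.1 r) ×ˢ (Ioo (z.2 - r ^ 2) z.2)

/-- The mixed space-time norm `‖f‖_{L^{γ,α}_{x,t}(B × (a,b))}`,
with the essential-supremum modification when an exponent is `∞`. -/
def mixedNorm {F : Type*} [NormedAddCommGroup F]
    (f : E3 × ℝ → F) (B : Set E3) (a b : ℝ) (γ α : ℝ≥0∞) : ℝ≥0∞ :=
  if α = ∞ then
    essSup (fun t => eLpNorm (fun x => f (x, t)) γ (volume.restrict B))
      (volume.restrict (Ioo a b))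
  else
    (∫⁻ t in Ioo a b,
      (eLpNorm (fun x => f (x, t)) γ (volume.restrict B)) ^ α.toReal) ^ (1 / α.toReal)

/-- `f ∈ L^{γ,α}_{x,t}(B × (a,b))`. -/
def MemMixed {F : Type*} [NormedAddCommGroup F]
    (f : E3 × ℝ → F) (B : Set E3) (a b : ℝ) (γ α : ℝ≥0∞) : Prop :=
  mixedNorm f B a b γ α < ∞

/-- Vector in `ℝ³` from coordinates. -/
def vec3 (a b c : ℝ) : E3 := (WithLp.equiv 2 (Fin 3 → ℝ)).symm ![a, b, c]

/-- Cross product in `ℝ³`. -/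
def cross3 (u w : E3) : E3 :=
  vec3 (u 1 * w 2 - u 2 * w 1) (u 2 * w 0 - u 0 * w 2) (u 0 * w 1 - u 1 * w 0)

/-- The unit direction `w/|w|`, interpreted as `0` when `w = 0`. -/
def unitd (w : E3) : E3 := ‖w‖⁻¹ • w

/-- Spatial partial derivative (in direction `i`) of a function on space-time. -/
def sdz {F : Type*} [NormedAddCommGroup F] [NormedSpace ℝ F]
    (φ : E3 × ℝ → F) (i : Fin 3) (z : E3 × ℝ) : F :=
  fderiv ℝ φ z (EuclideanSpace.single i 1, 0)

/-- Time derivative of a function on space-time. -/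
def tdz {F : Type*} [NormedAddCommGroup F] [NormedSpace ℝ F]
    (φ : E3 × ℝ → F) (z : E3 × ℝ) : F :=
  fderiv ℝ φ z (0, 1)

/-- The vorticity `ω = curl v` built from the (weak) velocity gradient
`Dv`, where `Dv z j i` represents `∂_j v_i (z)`. -/
def curlOf (Dv : E3 × ℝ → Fin 3 → Fin 3 → ℝ) (z : E3 × ℝ) : E3 :=
  vec3 (Dv z 1 2 - Dv z 2 1) (Dv z 2 0 - Dv z 0 2) (Dv z 0 1 - Dv z 1 0)

/-- A `3×3` matrix regarded as a Euclidean vector (so that its norm is the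
Frobenius norm). -/
def frob (M : Fin 3 → Fin 3 → ℝ) : EuclideanSpace ℝ (Fin 3 × Fin 3) :=
  (WithLp.equiv 2 (Fin 3 × Fin 3 → ℝ)).symm fun q => M q.1 q.2

/-- `(v, p)` is a suitable weak solution of the Navier–Stokes equations on
`Q_T = Ω × (0,T)`, with weak spatial gradient `Dv` (`Dv z j i = ∂_j v_i (z)`)
and initial data `v₀`. -/
structure IsSuitableWeakSolution (Ω : Set E3) (T : ℝ) (v : E3 × ℝ → E3)
    (Dv : E3 × ℝ → Fin 3 → Fin 3 → ℝ) (p : E3 × ℝ → ℝ) (v₀ : E3 → E3) : Prop where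
  meas_v : Measurable v
  meas_Dv : Measurable Dv
  meas_p : Measurable p
  /-- `Dv` is the weak spatial gradient of `v`. -/
  weak_grad : ∀ ψ : E3 → ℝ, ContDiff ℝ (⊤ : ℕ∞) ψ → HasCompactSupport ψ → tsupport ψ ⊆ Ω →
    ∀ᵐ t ∂(volume.restrict (Ioo 0 T)), ∀ i j : Fin 3,
      ∫ x in Ω, v (x, t) j * fderiv ℝ ψ x (EuclideanSpace.single i 1) =
        - ∫ x in Ω, Dv (x, t) i j * ψ x
  /-- `v ∈ L^∞(0,T;L²(Ω))`. -/
  v_linf_l2 : MemMixed v Ω 0 T 2 ∞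
  /-- `v ∈ L²(0,T;W^{1,2}(Ω))`. -/
  v_l2_w12 : IntegrableOn (fun z => ‖v z‖ ^ 2 + ∑ i, ∑ j, (Dv z i j) ^ 2) (Ω ×ˢ Ioo 0 T)
  /-- `p ∈ L^{3/2}(Q_T)`. -/
  p_l32 : IntegrableOn (fun z => |p z| ^ (3 / 2 : ℝ)) (Ω ×ˢ Ioo 0 T)
  /-- The weak form of the Navier–Stokes equations. -/
  weak_nse : ∀ φ : E3 × ℝ → E3, ContDiff ℝ (⊤ : ℕ∞) φ → HasCompactSupport φ →
    tsupport φ ⊆ Ω ×ˢ Iio T →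
    ∫ z in Ω ×ˢ Ioo 0 T,
        (-(∑ i, v z i * tdz φ z i) + (∑ i, ∑ j, v z j * Dv z j i * φ z i)
          + (∑ i, ∑ j, Dv z j i * sdz φ j z i) - p z * ∑ i, sdz φ i z i)
      = ∫ x in Ω, ∑ i, v₀ x i * φ (x, 0) i
  /-- `div v = 0` weakly. -/
  div_free : ∀ ψ : E3 × ℝ → ℝ, ContDiff ℝ (⊤ : ℕ∞) ψ → HasCompactSupport ψ →
    tsupport ψ ⊆ Ω ×ˢ Ioo 0 T →
    ∫ z in Ω ×ˢ Ioo 0 T, ∑ i, v z i * sdz ψ i z = 0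
  /-- The local energy inequality. -/
  local_energy : ∀ᵐ t ∂(volume.restrict (Ioo 0 T)), ∀ φ : E3 × ℝ → ℝ,
    ContDiff ℝ (⊤ : ℕ∞) φ → HasCompactSupport φ → tsupport φ ⊆ Ω ×ˢ Ioo 0 T → (∀ z, 0 ≤ φ z) →
    (∫ x in Ω, ‖v (x, t)‖ ^ 2 * φ (x, t))
        + 2 * ∫ z in Ω ×ˢ Ioo 0 t, (∑ i, ∑ j, (Dv z i j) ^ 2) * φ z
      ≤ ∫ z in Ω ×ˢ Ioo 0 t,
          (‖v z‖ ^ 2 * (tdz φ z + ∑ i, sdz (fun w => sdz φ i w) i z)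
            + (‖v z‖ ^ 2 + 2 * p z) * ∑ i, v z i * sdz φ i z)

/-- `z` is a regular point of `v`: `v` is essentially bounded on some parabolic
cylinder `Q_{z,r} ⊆ Q_T`. -/
def RegularPoint (Ω : Set E3) (T : ℝ) (v : E3 × ℝ → E3) (z : E3 × ℝ) : Prop :=
  ∃ r > 0, pcyl z r ⊆ Ω ×ˢ Ioo 0 T ∧
    ∃ M : ℝ, ∀ᵐ w ∂(volume.restrict (pcyl z r)), ‖v w‖ ≤ M

/-- `z` is a singular point of `v` in `Q_T`. -/
def SingularPoint (Ω : Set E3) (T : ℝ) (v : E3 × ℝ → E3) (z : E3 × ℝ) : Prop :=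
  z ∈ Ω ×ˢ Ioo 0 T ∧ ¬ RegularPoint Ω T v z



section
open scoped ContDiff Convolution Topology

abbrev Sm {F G : Type*} [NormedAddCommGroup F] [NormedSpace ℝ F] [NormedAddCommGroup G] [NormedSpace ℝ G]
  (f : F → G) : Prop := ContDiff ℝ (⊤ : ℕ∞) f
abbrev bs (i : Fin 3) : E3 := EuclideanSpace.single i 1
def lapz (f : E3 × ℝ → ℝ) (z : E3 × ℝ) : ℝ := ∑ i, sdz (sdz f i) i z

lemma Sm.df {f : E3 × ℝ → ℝ} (h : Sm f) : Differentiable ℝ f := h.differentiable (by simp)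
lemma Sm.dd {F : Type*} [NormedAddCommGroup F] [NormedSpace ℝ F] {f : F → ℝ} (h : Sm f) (w : F) :
    Sm (fun z => fderiv ℝ f z w) :=
  (h.fderiv_right (m := (⊤ : ℕ∞)) (by simp)).clm_apply contDiff_const
lemma Sm.sdz {f : E3 × ℝ → ℝ} (h : Sm f) (i) : Sm (sdz f i) := h.dd _
lemma Sm.tdz {f : E3 × ℝ → ℝ} (h : Sm f) : Sm (tdz f) := h.dd _
lemma Sm.lapz {f : E3 × ℝ → ℝ} (h : Sm f) : Sm (lapz f) := ContDiff.sum fun i _ => (h.sdz i).sdz i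
lemma cs_dd {F : Type*} [NormedAddCommGroup F] [NormedSpace ℝ F] {f : F → ℝ}
    (h : HasCompactSupport f) (w : F) : HasCompactSupport (fun z => fderiv ℝ f z w) :=
  (h.fderiv (𝕜 := ℝ)).comp_left (g := fun L : F →L[ℝ] ℝ => L w) rfl
lemma ts_dd {F : Type*} [NormedAddCommGroup F] [NormedSpace ℝ F] (f : F → ℝ) (w : F) :
    tsupport (fun z => fderiv ℝ f z w) ⊆ tsupport f :=
  (closure_mono fun x (hx : _ ≠ _) => by
    contrapose! hx; simp only [Function.mem_support, not_not] at hx; simp [hx]).trans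
    (tsupport_fderiv_subset ℝ)
lemma cs_sdz {f : E3 × ℝ → ℝ} (h : HasCompactSupport f) (i) : HasCompactSupport (sdz f i) := cs_dd h _
lemma ts_sdz (f : E3 × ℝ → ℝ) (i) : tsupport (sdz f i) ⊆ tsupport f := ts_dd f _
lemma cs_tdz {f : E3 × ℝ → ℝ} (h : HasCompactSupport f) : HasCompactSupport (tdz f) := cs_dd h _
lemma ts_tdz (f : E3 × ℝ → ℝ) : tsupport (tdz f) ⊆ tsupport f := ts_dd f _
lemma dd_mul {F : Type*} [NormedAddCommGroup F] [NormedSpace ℝ F] {f g : F → ℝ}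
    (hf : Sm f) (hg : Sm g) (z w : F) :
    fderiv ℝ (fun z => f z * g z) z w = fderiv ℝ f z w * g z + f z * fderiv ℝ g z w := by
  rw [fderiv_fun_mul (hf.differentiable (by simp) z) (hg.differentiable (by simp) z)]
  simp; ring
lemma sdz_mul {f g : E3 × ℝ → ℝ} (hf : Sm f) (hg : Sm g) (i) :
    sdz (fun z => f z * g z) i = fun z => sdz f i z * g z + f z * sdz g i z := by
  funext z; exact dd_mul hf hg z _
lemma tdz_mul {f g : E3 × ℝ → ℝ} (hf : Sm f) (hg : Sm g) :
    tdz (fun z => f z * g z) = fun z => tdz f z * g z + f z * tdz g z := by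
  funext z; exact dd_mul hf hg z _
lemma sdz_add {f g : E3 × ℝ → ℝ} (hf : Sm f) (hg : Sm g) (i) :
    sdz (fun z => f z + g z) i = fun z => sdz f i z + sdz g i z := by
  funext z; simp only [_root_.sdz]; rw [fderiv_fun_add (hf.df z) (hg.df z)]; rfl
lemma lapz_mul {f g : E3 × ℝ → ℝ} (hf : Sm f) (hg : Sm g) (z) :
    lapz (fun z => f z * g z) z = lapz f z * g z + f z * lapz g z + 2 * ∑ i, sdz f i z * sdz g i z := by
  simp only [_root_.lapz, sdz_mul hf hg, Finset.mul_sum, Finset.sum_mul, ← Finset.sum_add_distrib]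
  refine Finset.sum_congr rfl fun i _ => ?_
  rw [sdz_add ((hf.sdz i).mul hg) (hf.mul (hg.sdz i)), sdz_mul (hf.sdz i) hg, sdz_mul hf (hg.sdz i)]
  ring
lemma dd_comm {F : Type*} [NormedAddCommGroup F] [NormedSpace ℝ F] {f : F → ℝ} (h : Sm f) (u w z : F) :
    fderiv ℝ (fun z => fderiv ℝ f z u) z w = fderiv ℝ (fun z => fderiv ℝ f z w) z u := by
  have hd : DifferentiableAt ℝ (fderiv ℝ f) z :=
    (h.fderiv_right (m := (⊤ : ℕ∞)) (by simp)).differentiable (by simp) z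
  have hs : IsSymmSndFDerivAt ℝ f z := (h.contDiffAt).isSymmSndFDerivAt (by simp; exact WithTop.coe_le_coe.2 (le_top : (2 : ℕ∞) ≤ ⊤))
  rw [fderiv_clm_apply hd (by fun_prop), fderiv_clm_apply hd (by fun_prop)]
  simpa using (hs w u)
lemma sdz_comm {f : E3 × ℝ → ℝ} (h : Sm f) (i j z) : sdz (sdz f i) j z = sdz (sdz f j) i z :=
  dd_comm h _ _ z
lemma tdz_sdz {f : E3 × ℝ → ℝ} (h : Sm f) (i z) : tdz (sdz f i) z = sdz (tdz f) i z :=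
  dd_comm h _ _ z

lemma slice_fderiv {f : E3 × ℝ → ℝ} (h : Sm f) (t x) (i : Fin 3) :
    fderiv ℝ (fun x => f (x, t)) x (bs i) = sdz f i (x, t) := by
  have h1 : HasFDerivAt (fun x : E3 => (x, t)) (ContinuousLinearMap.inl ℝ E3 ℝ) x := hasFDerivAt_prodMk_left x t
  have := ((h.df (x, t)).hasFDerivAt.comp x h1).fderiv
  simp only [Function.comp_def] at this
  rw [this]; simp [sdz]
lemma slice_deriv {f : E3 × ℝ → ℝ} (h : Sm f) (t x) :
    HasDerivAt (fun t => f (x, t)) (tdz f (x, t)) t := by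
  have h1 : HasFDerivAt (fun t : ℝ => (x, t)) (ContinuousLinearMap.inr ℝ E3 ℝ) t := hasFDerivAt_prodMk_right x t
  have := ((h.df (x, t)).hasFDerivAt.comp t h1).hasDerivAt
  simpa [tdz, Function.comp_def] using this
lemma sm_slice {f : E3 × ℝ → ℝ} (h : Sm f) (t : ℝ) : Sm (fun x => f (x, t)) :=
  h.comp (contDiff_id.prodMk contDiff_const)

lemma sdz_fst {χ : E3 → ℝ} (h : Sm χ) (i z) : sdz (fun z => χ z.1) i z = fderiv ℝ χ z.1 (bs i) := by
  have := ((h.differentiable (by simp) z.1).hasFDerivAt.comp z (hasFDerivAt_fst)).fderiv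
  simp only [Function.comp_def] at this
  simp [sdz, this]
lemma tdz_fst {χ : E3 → ℝ} (h : Sm χ) (z) : tdz (fun z => χ z.1) z = 0 := by
  have := ((h.differentiable (by simp) z.1).hasFDerivAt.comp z (hasFDerivAt_fst)).fderiv
  simp only [Function.comp_def] at this
  simp [tdz, this]
lemma sdz_snd {η : ℝ → ℝ} (h : Sm η) (i z) : sdz (fun z => η z.2) i z = 0 := by
  have := ((h.differentiable (by simp) z.2).hasFDerivAt.comp z (hasFDerivAt_snd)).fderiv
  simp only [Function.comp_def] at this
  simp [sdz, this]
lemma tdz_snd {η : ℝ → ℝ} (h : Sm η) (z) : tdz (fun z => η z.2) z = deriv η z.2 := by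
  have := ((h.differentiable (by simp) z.2).hasFDerivAt.comp z (hasFDerivAt_snd)).fderiv
  simp only [Function.comp_def] at this
  simp [tdz, this]

/-- averaging operator -/
def avg (M : Measure (E3 × ℝ)) (g : E3 × ℝ → ℝ) (z : E3 × ℝ) : ℝ := ∫ w, g (z - w) ∂M

lemma avg_conv (M : Measure (E3 × ℝ)) (g : E3 × ℝ → ℝ) :
    avg M g = ((fun _ => (1 : ℝ)) ⋆[ContinuousLinearMap.mul ℝ ℝ, M] g) := by
  funext z; simp [avg, convolution]
lemma avg_sm {M : Measure (E3 × ℝ)} [IsFiniteMeasure M] {g : E3 × ℝ → ℝ} (hg : Sm g)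
    (hc : HasCompactSupport g) : Sm (avg M g) := by
  rw [avg_conv]
  exact hc.contDiff_convolution_right _ (locallyIntegrable_const _) hg
instance : (volume : Measure (E3 × ℝ)).IsAddHaarMeasure :=
  inferInstanceAs ((volume : Measure E3).prod (volume : Measure ℝ)).IsAddHaarMeasure
lemma avg_dd {M : Measure (E3 × ℝ)} [IsFiniteMeasure M] {g : E3 × ℝ → ℝ} (hg : Sm g)
    (hc : HasCompactSupport g) (w z : E3 × ℝ) :
    fderiv ℝ (avg M g) z w = avg M (fun z => fderiv ℝ g z w) z := by
  have hcf := hg.continuous_fderiv (by simp)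
  have hcont : Continuous (fun w => fderiv ℝ g (z - w)) := hcf.comp (by fun_prop)
  obtain ⟨C, hC⟩ := hcf.bounded_above_of_compact_support (hc.fderiv (𝕜 := ℝ))
  obtain ⟨C', hC'⟩ := hg.continuous.bounded_above_of_compact_support hc
  have hgc := hg.continuous
  have h1 := hasFDerivAt_integral_of_dominated_of_fderiv_le (μ := M) (F := fun z w => g (z - w))
    (F' := fun z w => fderiv ℝ g (z - w)) (x₀ := z) (bound := fun _ => C) univ_mem
    (Eventually.of_forall fun x => (by fun_prop : Continuous fun w => g (x - w)).aestronglyMeasurable)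
    (Integrable.of_bound (by fun_prop : Continuous fun w => g (z - w)).aestronglyMeasurable C' (ae_of_all _ fun w => hC' _))
    hcont.aestronglyMeasurable (ae_of_all _ fun w x _ => hC _) (integrable_const _)
    (ae_of_all _ fun w x _ => by
      simpa using! (hg.df _).hasFDerivAt.comp x ((hasFDerivAt_id x).sub (hasFDerivAt_const w x)))
  have h2 := h1.fderiv
  change fderiv ℝ (avg M g) z = _ at h2
  rw [h2, ContinuousLinearMap.integral_apply]
  · rfl
  · exact Integrable.of_bound hcont.aestronglyMeasurable C (ae_of_all _ fun w => hC _)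
lemma avg_sdz {M : Measure (E3 × ℝ)} [IsFiniteMeasure M] {g : E3 × ℝ → ℝ} (hg : Sm g)
    (hc : HasCompactSupport g) (i) : sdz (avg M g) i = avg M (sdz g i) := by
  funext z; exact avg_dd hg hc _ z
lemma avg_tdz {M : Measure (E3 × ℝ)} [IsFiniteMeasure M] {g : E3 × ℝ → ℝ} (hg : Sm g)
    (hc : HasCompactSupport g) : tdz (avg M g) = avg M (tdz g) := by
  funext z; exact avg_dd hg hc _ z
lemma avg_int {M : Measure (E3 × ℝ)} [IsFiniteMeasure M] {g : E3 × ℝ → ℝ} (hg : Continuous g)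
    (hc : HasCompactSupport g) (z) : Integrable (fun w => g (z - w)) M := by
  obtain ⟨C, hC⟩ := hg.bounded_above_of_compact_support hc
  exact Integrable.of_bound (by fun_prop) C (ae_of_all _ fun w => hC _)
lemma avg_bdd {M : Measure (E3 × ℝ)} [IsFiniteMeasure M] {g : E3 × ℝ → ℝ} (hg : Continuous g)
    (hc : HasCompactSupport g) : ∃ C, ∀ z, |avg M g z| ≤ C := by
  obtain ⟨C, hC⟩ := hg.bounded_above_of_compact_support hc
  exact ⟨C * M.real univ, fun z => norm_integral_le_of_norm_le_const (ae_of_all _ fun w => hC _)⟩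
lemma avg_integrable {M : Measure (E3 × ℝ)} [IsFiniteMeasure M] {g : E3 × ℝ → ℝ} (hg : Continuous g)
    (hc : HasCompactSupport g) : Integrable (avg M g) := by
  have hi := hg.integrable_of_hasCompactSupport (μ := volume) hc
  have hcont : Continuous fun p : (E3 × ℝ) × (E3 × ℝ) => g (p.1 - p.2) := by fun_prop
  have : Integrable (fun p : (E3 × ℝ) × (E3 × ℝ) => g (p.1 - p.2)) (volume.prod M) := by
    refine (integrable_prod_iff' hcont.aestronglyMeasurable).2 ⟨ae_of_all _ fun w => hi.comp_sub_right w, ?_⟩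
    simp_rw [fun w => integral_sub_right_eq_self (μ := (volume : Measure (E3 × ℝ))) (fun z => ‖g z‖) w]
    exact integrable_const _
  exact this.integral_prod_left
lemma cs_slice {g : E3 × ℝ → ℝ} (hc : HasCompactSupport g) (t : ℝ) : HasCompactSupport fun x => g (x, t) := by
  refine HasCompactSupport.of_support_subset_isCompact (hc.image continuous_fst) fun x hx => ?_
  exact ⟨(x, t), subset_tsupport _ hx, rfl⟩
lemma avg_slice_integrable {M : Measure (E3 × ℝ)} [IsFiniteMeasure M] {g : E3 × ℝ → ℝ} (hg : Sm g)
    (hc : HasCompactSupport g) (t : ℝ) : Integrable (fun x => avg M g (x, t)) := by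
  obtain ⟨C, hC⟩ := hg.continuous.bounded_above_of_compact_support hc
  have hK := (hc.image continuous_fst)
  set K := Prod.fst '' tsupport g
  have h1 : Integrable (fun p : E3 × (E3 × ℝ) => g ((p.1, t) - p.2)) (volume.prod M) := by
    have hcont : Continuous fun p : E3 × (E3 × ℝ) => g ((p.1, t) - p.2) := by fun_prop
    refine (integrable_prod_iff' hcont.aestronglyMeasurable).2 ⟨ae_of_all _ fun w => ?_, ?_⟩
    · exact (((cs_slice hc (t - w.2)).comp_homeomorph (Homeomorph.subRight w.1)) |>
        (Continuous.integrable_of_hasCompactSupport (f := fun x => g ((x,t) - w)) (by fun_prop)))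
    · refine Integrable.of_bound (C := C * volume.real K) ?_ (ae_of_all _ fun w => ?_)
      · exact hcont.norm.aestronglyMeasurable.prod_swap.integral_prod_right'
      · have h2 : ∫ x, ‖g ((x, t) - w)‖ = ∫ x, ‖g (x, t - w.2)‖ :=
          integral_sub_right_eq_self (fun x => ‖g (x, t - w.2)‖) w.1
        have h3 : ∫ x, ‖g (x, t - w.2)‖ = ∫ x in K, ‖g (x, t - w.2)‖ := by
          refine (setIntegral_eq_integral_of_forall_compl_eq_zero fun x hx => ?_).symm
          rw [norm_eq_zero]; by_contra h; exact hx ⟨_, subset_tsupport _ h, rfl⟩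
        rw [Real.norm_of_nonneg (integral_nonneg fun _ => norm_nonneg _)]
        simp only [h2, h3]
        have := norm_setIntegral_le_of_norm_le_const (μ := volume) (f := fun x => ‖g (x, t - w.2)‖) (s := K) (C := C)
          hK.measure_lt_top (fun x _ => by simpa using hC _)
        exact (le_abs_self _).trans this
  exact h1.integral_prod_left

end

section
lemma gexp_int {b : ℝ} (hb : 0 < b) : Integrable (fun y : E3 => Real.exp (-b * ‖y‖ ^ 2)) := by
  by_contra h
  have h1 := GaussianFourier.integral_rexp_neg_mul_sq_norm (V := E3) hb
  rw [integral_undef h] at h1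
  exact (Real.rpow_pos_of_pos (by positivity) _).ne h1
def gc : ℝ := (∫ y : E3, Real.exp (-(1/4) * ‖y‖ ^ 2))⁻¹
def gd (y : E3) : ℝ := gc * Real.exp (-(1/4) * ‖y‖ ^ 2)
lemma gc_pos : 0 < gc := by
  rw [gc, GaussianFourier.integral_rexp_neg_mul_sq_norm (by norm_num)]; positivity
lemma gd_pos (y) : 0 < gd y := mul_pos gc_pos (Real.exp_pos _)
lemma gd_sm : Sm gd := contDiff_const.mul (Real.contDiff_exp.comp (contDiff_const.mul (contDiff_norm_sq ℝ)))
lemma gd_int : Integrable gd := (gexp_int (by norm_num)).const_mul _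
lemma gd_one : ∫ y, gd y = 1 := by
  unfold gd; rw [integral_const_mul]; exact inv_mul_cancel₀ fun h => gc_pos.ne' (by unfold gc; rw [h]; simp)
def gν : Measure E3 := volume.withDensity fun y => ENNReal.ofReal (gd y)
instance : IsProbabilityMeasure gν := ⟨by
  rw [gν, withDensity_apply _ MeasurableSet.univ, Measure.restrict_univ,
    ← ofReal_integral_eq_lintegral_ofReal gd_int (ae_of_all _ fun y => (gd_pos y).le), gd_one]; simp⟩
lemma gmeas : Measurable fun y => ENNReal.ofReal (gd y) := gd_sm.continuous.measurable.ennreal_ofReal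
lemma gν_int (f : E3 → ℝ) : ∫ y, f y ∂gν = ∫ y, gd y * f y := by
  rw [gν, integral_withDensity_eq_integral_toReal_smul gmeas (ae_of_all _ fun _ => ENNReal.ofReal_lt_top)]
  simp [ENNReal.toReal_ofReal (gd_pos _).le]
lemma gν_integrable {f : E3 → ℝ} (h : Integrable fun y => gd y * f y) : Integrable f gν := by
  rw [gν, integrable_withDensity_iff_integrable_smul' gmeas (ae_of_all _ fun _ => ENNReal.ofReal_lt_top)]
  simpa [ENNReal.toReal_ofReal (gd_pos _).le] using h
lemma gd_fd (y : E3) (i : Fin 3) : fderiv ℝ gd y (bs i) = - (y i / 2) * gd y := by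
  have h := ((hasStrictFDerivAt_norm_sq (F := E3) y).hasFDerivAt.const_mul (-(1/4 : ℝ))).exp.const_mul gc
  have h2 : fderiv ℝ gd y = _ := h.fderiv
  rw [h2]
  simp [gd, EuclideanSpace.inner_single_right]; ring
lemma pow_exp_le {k X : ℝ} (hk : 0 < k) (hX : 0 ≤ X) : X ^ k * Real.exp (-X / 4) ≤ (4 * k) ^ k := by
  have h1 : X / (4 * k) ≤ Real.exp (X / (4 * k)) := by linarith [Real.add_one_le_exp (X / (4 * k))]
  have h2 := Real.rpow_le_rpow (by positivity) h1 hk.le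
  rw [← Real.exp_mul, Real.div_rpow hX (by positivity), show X / (4 * k) * k = X / 4 by field_simp,
    div_le_iff₀ (by positivity)] at h2
  rw [neg_div, Real.exp_neg, ← div_eq_mul_inv, div_le_iff₀ (Real.exp_pos _)]
  linarith
lemma gd_mom : Integrable (fun y => ‖y‖) gν := by
  refine gν_integrable (((gexp_int (b := 1/8) (by norm_num)).const_mul (gc * 2)).mono'
    (by have := gd_sm.continuous; fun_prop) (ae_of_all _ fun y => ?_))
  rw [Real.norm_of_nonneg (mul_nonneg (gd_pos y).le (norm_nonneg _)), gd]
  have h1 : ‖y‖ ≤ 2 * Real.exp (1/8 * ‖y‖^2) := by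
    nlinarith [Real.add_one_le_exp (1/8 * ‖y‖^2), sq_nonneg (‖y‖ - 2)]
  have h2 : Real.exp (-(1/8) * ‖y‖^2) = Real.exp (-(1/4) * ‖y‖^2) * Real.exp (1/8 * ‖y‖^2) := by
    rw [← Real.exp_add]; ring_nf
  rw [h2]
  nlinarith [mul_le_mul_of_nonneg_left h1 (mul_pos gc_pos (Real.exp_pos (-(1/4) * ‖y‖^2))).le]
lemma gν_ibp {H : E3 → ℝ} (hH : Sm H) (hc : HasCompactSupport H) (i) :
    ∫ y, fderiv ℝ H y (bs i) ∂gν = ∫ y, y i / 2 * H y ∂gν := by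
  have hcd := gd_sm.continuous
  have hy : Continuous fun y : E3 => y i := by fun_prop
  rw [gν_int, gν_int, integral_mul_fderiv_eq_neg_fderiv_mul_of_integrable, ← integral_neg]
  · congr 1; funext y; rw [gd_fd]; ring
  · refine Continuous.integrable_of_hasCompactSupport ?_ hc.mul_left
    exact ((gd_sm.dd _).continuous).mul hH.continuous
  · exact Continuous.integrable_of_hasCompactSupport (hcd.mul (hH.dd _).continuous) (cs_dd hc _).mul_left
  · exact Continuous.integrable_of_hasCompactSupport (hcd.mul hH.continuous) hc.mul_left
  · exact fun x _ => gd_sm.differentiable (by simp) x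
  · exact fun x _ => hH.differentiable (by simp) x

/-- shift -/
def sg (l : ℝ) (q : ℝ × E3) : E3 × ℝ := (√q.1 • q.2, -(l * q.1))
lemma sg_cont (l) : Continuous (sg l) := by unfold sg; fun_prop
def gM (l S : ℝ) : Measure (E3 × ℝ) := ((volume.restrict (Ioo 0 S)).prod gν).map (sg l)
instance (l S : ℝ) : IsFiniteMeasure (gM l S) := by unfold gM; infer_instance
/-- heat potential -/
abbrev pot (l S : ℝ) (g : E3 × ℝ → ℝ) : E3 × ℝ → ℝ := avg (gM l S) g
lemma pot_eq {l S : ℝ} {g : E3 × ℝ → ℝ} (hg : Continuous g) (hc : HasCompactSupport g) (z) :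
    pot l S g z = ∫ s in Ioo 0 S, ∫ y, g (z - sg l (s, y)) ∂gν := by
  have := sg_cont l
  have h := avg_int (M := gM l S) hg hc z
  rw [pot, avg, gM, integral_map this.measurable.aemeasurable (by fun_prop), integral_prod]
  exact (integrable_map_measure (by fun_prop) this.measurable.aemeasurable).1 h
lemma cs_aff {G : E3 × ℝ → ℝ} (hc : HasCompactSupport G) (l : ℝ) {s : ℝ} (hs : 0 < s) (z) :
    HasCompactSupport fun y => G (z - sg l (s, y)) := by
  have h := cs_slice hc (z.2 - (-(l * s)))
  have h2 := h.comp_homeomorph ((Homeomorph.smulOfNeZero (√s) (Real.sqrt_pos.2 hs).ne').trans (Homeomorph.subLeft z.1))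
  exact h2
lemma sm_aff {G : E3 × ℝ → ℝ} (hG : Sm G) (l s : ℝ) (z) : Sm fun y => G (z - sg l (s, y)) := by
  exact hG.comp (contDiff_const.sub ((contDiff_id.const_smul (√s)).prodMk (contDiff_const (c := -(l * s)))))
lemma fd_aff {G : E3 × ℝ → ℝ} (hG : Sm G) (l s : ℝ) (z) (y) (i) :
    fderiv ℝ (fun y => G (z - sg l (s, y))) y (bs i) = - √s * sdz G i (z - sg l (s, y)) := by
  have h0 : HasFDerivAt (fun y : E3 => √s • y) (√s • ContinuousLinearMap.id ℝ E3) y := 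
    (hasFDerivAt_id (𝕜 := ℝ) y).const_smul (√s)
  have h1 : HasFDerivAt (fun y => z - sg l (s, y)) (-((√s • ContinuousLinearMap.id ℝ E3).prod (0 : E3 →L[ℝ] ℝ))) y :=
    (h0.prodMk (hasFDerivAt_const (-(l * s)) y)).const_sub z
  have h2 := ((hG.df _).hasFDerivAt.comp y h1).fderiv
  simp only [Function.comp_def] at h2
  rw [h2]
  simp only [ContinuousLinearMap.comp_apply, neg_apply, map_neg, sdz]
  rw [show ((√s • ContinuousLinearMap.id ℝ E3).prod (0 : E3 →L[ℝ] ℝ)) (bs i) = √s • ((bs i, 0) : E3 × ℝ) by simp]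
  rw [map_smul]; simp
lemma ibp_aff {G : E3 × ℝ → ℝ} (hG : Sm G) (hc : HasCompactSupport G) (l : ℝ) {s : ℝ} (hs : 0 < s) (z i) :
    ∫ y, sdz G i (z - sg l (s, y)) ∂gν = ∫ y, -(y i / (2 * √s)) * G (z - sg l (s, y)) ∂gν := by
  have h := gν_ibp (sm_aff hG l s z) (cs_aff hc l hs z) i
  simp_rw [fd_aff hG] at h
  have hs' : √s ≠ 0 := (Real.sqrt_pos.2 hs).ne'
  have h2 : ∀ y : E3, -(y i / (2 * √s)) * G (z - sg l (s, y)) = -(√s)⁻¹ * (y i / 2 * G (z - sg l (s, y))) := by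
    intro y; field_simp
  simp_rw [h2]
  rw [integral_const_mul, ← h, integral_const_mul]; field_simp

lemma sum_bs (L : E3 × ℝ →L[ℝ] ℝ) (y : E3) : L (y, 0) = ∑ i, y i * L (bs i, 0) := by
  have h : (y, (0:ℝ)) = ∑ i, y i • ((bs i, 0) : E3 × ℝ) := by
    refine Prod.ext ?_ (by simp [Prod.snd_sum])
    simp only [Prod.fst_sum, Prod.smul_fst]
    ext j; fin_cases j <;> simp [Fin.sum_univ_three]
  rw [h, map_sum]; simp_rw [map_smul, smul_eq_mul]
lemma heat_deriv {G : E3 × ℝ → ℝ} (hG : Sm G) (hc : HasCompactSupport G) (l : ℝ) {s : ℝ} (hs : 0 < s) (z) :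
    HasDerivAt (fun s => ∫ y, G (z - sg l (s, y)) ∂gν)
      (∫ y, (lapz G (z - sg l (s, y)) + l * tdz G (z - sg l (s, y))) ∂gν) s := by
  have hGc := hG.continuous
  have hsg : ∀ s, Continuous fun y => sg l (s, y) := fun s => (sg_cont l).comp (by fun_prop)
  have cG : ∀ {f : E3 × ℝ → ℝ}, Continuous f → ∀ s, Continuous fun y => f (z - sg l (s, y)) :=
    fun hf s => hf.comp (continuous_const.sub (hsg s))
  obtain ⟨C, hC⟩ := (hG.continuous_fderiv (by simp)).bounded_above_of_compact_support (hc.fderiv (𝕜 := ℝ))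
  obtain ⟨C', hC'⟩ := hG.continuous.bounded_above_of_compact_support hc
  have hC0 : 0 ≤ C := (norm_nonneg _).trans (hC 0)
  let F' : ℝ → E3 → ℝ := fun s y => fderiv ℝ G (z - sg l (s, y)) (-((1 / (2 * √s)) • y, -l))
  have h := hasDerivAt_integral_of_dominated_loc_of_deriv_le (μ := gν) (F := fun s y => G (z - sg l (s, y)))
    (F' := F') (x₀ := s) (s := Ioi (s / 4)) (bound := fun y => C * ((√s)⁻¹ * ‖y‖ + |l|)) (Ioi_mem_nhds (by linarith))
    (Eventually.of_forall fun x => (cG hGc x).aestronglyMeasurable)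
    (Integrable.of_bound (cG hGc s).aestronglyMeasurable C' (ae_of_all _ fun w => hC' _)) ?_ ?_ ?_ ?_
  · refine h.2.congr_deriv ?_
    symm
    have e : ∀ y, F' s y = ∑ i, (-(y i / (2 * √s))) * sdz G i (z - sg l (s, y)) + l * tdz G (z - sg l (s, y)) := by
      intro y
      simp only [F', sdz, tdz]
      rw [show (-((1 / (2 * √s)) • y, -l) : E3 × ℝ) = -((1 / (2 * √s)) • (y, 0)) + l • (0, 1) by
        ext <;> simp, map_add, map_neg, map_smul, map_smul, sum_bs]
      simp only [smul_eq_mul, Finset.mul_sum, ← Finset.sum_neg_distrib]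
      congr 1; refine Finset.sum_congr rfl fun i _ => ?_
      ring
    rw [show (∫ y, F' s y ∂gν) = _ from integral_congr_ae (ae_of_all _ e)]
    have i1 : ∀ i, Integrable (fun y : E3 => -(y i / (2 * √s)) * sdz G i (z - sg l (s, y))) gν := by
      intro i
      obtain ⟨C2, hC2⟩ := (hG.sdz i).continuous.bounded_above_of_compact_support (cs_sdz hc i)
      refine (gd_mom.const_mul ((2 * √s)⁻¹ * C2)).mono' ?_ (ae_of_all _ fun y => ?_)
      · exact ((by fun_prop : Continuous fun y : E3 => -(y i / (2 * √s))).mul (cG (hG.sdz i).continuous s)).aestronglyMeasurable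
      · rw [norm_mul, norm_neg, norm_div, Real.norm_of_nonneg (by positivity : 0 ≤ 2 * √s)]
        have := PiLp.norm_apply_le y i
        calc _ ≤ ‖y‖ / (2 * √s) * C2 := by gcongr; exact hC2 _
          _ = _ := by ring
    have ib : ∀ {f : E3 × ℝ → ℝ}, Continuous f → HasCompactSupport f → Integrable (fun y => f (z - sg l (s, y))) gν := by
      intro f hf hfc
      obtain ⟨C2, hC2⟩ := hf.bounded_above_of_compact_support hfc
      exact Integrable.of_bound (cG hf s).aestronglyMeasurable C2 (ae_of_all _ fun y => hC2 _)
    rw [integral_add, integral_add, integral_finsetSum _ fun i _ => i1 i]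
    · congr 1
      simp only [lapz]
      rw [integral_finsetSum _ fun i _ => ib ((hG.sdz i).sdz i).continuous (cs_sdz (cs_sdz hc i) i)]
      exact Finset.sum_congr rfl fun i _ => ibp_aff (hG.sdz i) (cs_sdz hc i) l hs z i
    · exact integrable_finsetSum _ fun i _ => i1 i
    · exact (ib hG.tdz.continuous (cs_tdz hc)).const_mul _
    · exact integrable_finsetSum _ fun i _ => ib ((hG.sdz i).sdz i).continuous (cs_sdz (cs_sdz hc i) i)
    · exact (ib hG.tdz.continuous (cs_tdz hc)).const_mul _
  · have h1 : Continuous fun y => fderiv ℝ G (z - sg l (s, y)) :=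
      (hG.continuous_fderiv (by simp)).comp (continuous_const.sub (hsg s))
    exact (h1.clm_apply (by fun_prop)).aestronglyMeasurable
  · refine ae_of_all _ fun y x (hx : s / 4 < x) => ?_
    refine (ContinuousLinearMap.le_opNorm _ _).trans (mul_le_mul (hC _) ?_ (norm_nonneg _) hC0)
    rw [norm_neg, Prod.norm_mk, norm_smul, norm_neg]
    have h2 : √s / 2 ≤ √x := by
      refine Real.le_sqrt_of_sq_le ?_
      rw [div_pow, Real.sq_sqrt hs.le]; linarith
    have h3 : 0 < √s := Real.sqrt_pos.2 hs
    have h4 : ‖1 / (2 * √x)‖ ≤ (√s)⁻¹ := by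
      rw [Real.norm_of_nonneg (by positivity), one_div]
      exact inv_anti₀ h3 (by linarith)
    refine max_le ?_ ?_
    · nlinarith [norm_nonneg y, abs_nonneg l, mul_le_mul_of_nonneg_right h4 (norm_nonneg y)]
    · rw [Real.norm_eq_abs]; nlinarith [norm_nonneg y, inv_pos.2 h3, mul_nonneg (inv_pos.2 h3).le (norm_nonneg y)]
  · exact ((gd_mom.const_mul _).add (integrable_const _)).const_mul _
  · refine ae_of_all _ fun y x (hx : s / 4 < x) => ?_
    have hx0 : 0 < x := by linarith
    have h1 : HasDerivAt (fun x => sg l (x, y)) ((1 / (2 * √x)) • y, -l) x :=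
      ((Real.hasDerivAt_sqrt hx0.ne').smul_const y).prodMk (by simpa using! ((hasDerivAt_id x).const_mul l).neg)
    exact (hG.df _).hasFDerivAt.comp_hasDerivAt x (h1.const_sub z)

lemma pot_heat {l S : ℝ} (hS : 0 < S) {g : E3 × ℝ → ℝ} (hg : Sm g) (hc : HasCompactSupport g) (z) :
    lapz (pot l S g) z + l * tdz (pot l S g) z = ∫ y, g (z - sg l (S, y)) ∂gν - g z := by
  have hsgc := sg_cont l
  have e1 : lapz (pot l S g) z + l * tdz (pot l S g) z = pot l S (fun z => lapz g z + l * tdz g z) z := by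
    have hi : ∀ i, Integrable (fun w => sdz (sdz g i) i (z - w)) (gM l S) := fun i =>
      avg_int ((hg.sdz i).sdz i).continuous (cs_sdz (cs_sdz hc i) i) z
    have h2 : Integrable (fun w => l * tdz g (z - w)) (gM l S) := (avg_int hg.tdz.continuous (cs_tdz hc) z).const_mul _
    simp only [pot]
    rw [avg_tdz hg hc, avg, avg, ← integral_const_mul, integral_add _ h2]
    · congr 1
      simp only [lapz]
      rw [integral_finsetSum _ fun i _ => hi i]
      refine Finset.sum_congr rfl fun i _ => ?_
      rw [avg_sdz hg hc, avg_sdz (hg.sdz i) (cs_sdz hc i), avg]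
    · exact integrable_finsetSum _ fun i _ => hi i
  have hL : Continuous (fun z => lapz g z + l * tdz g z) := hg.lapz.continuous.add (hg.tdz.continuous.const_smul l)
  have hLc : HasCompactSupport (fun z => lapz g z + l * tdz g z) := by
    refine HasCompactSupport.add (f := lapz g) ?_ ((cs_tdz hc).mul_left)
    have : lapz g = fun z => sdz (sdz g 0) 0 z + sdz (sdz g 1) 1 z + sdz (sdz g 2) 2 z := by
      funext z; simp [lapz, Fin.sum_univ_three]
    rw [this]
    exact ((cs_sdz (cs_sdz hc 0) 0).add (cs_sdz (cs_sdz hc 1) 1)).add (cs_sdz (cs_sdz hc 2) 2)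
  obtain ⟨C, hC⟩ := hL.bounded_above_of_compact_support hLc
  obtain ⟨C', hC'⟩ := hg.continuous.bounded_above_of_compact_support hc
  have hgc := hg.continuous
  have cont : ∀ {f : E3 × ℝ → ℝ} {C : ℝ}, Continuous f → (∀ z, ‖f z‖ ≤ C) → Continuous fun s => ∫ y, f (z - sg l (s, y)) ∂gν :=
    fun {f C} hf hb => continuous_of_dominated (bound := fun _ => C)
      (fun s => (by fun_prop : Continuous fun y => f (z - sg l (s, y))).aestronglyMeasurable)
      (fun s => ae_of_all _ fun y => hb _) (integrable_const _) (ae_of_all _ fun y => by fun_prop)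
  have key := intervalIntegral.integral_eq_sub_of_hasDerivAt_of_le (f := fun s => ∫ y, g (z - sg l (s, y)) ∂gν) hS.le
    (cont hgc hC').continuousOn (fun s hs => heat_deriv hg hc l hs.1 z) ((cont hL hC).intervalIntegrable 0 S)
  rw [e1, pot_eq hL hLc, ← integral_Ioc_eq_integral_Ioo, ← intervalIntegral.integral_of_le hS.le, key]
  simp [sg, show ((0 : E3), (0:ℝ)) = 0 from rfl]

end

section
def kap (w : E3) : ℝ≥0∞ := ‖w‖ₑ ^ (-(21/10) : ℝ)
lemma kap_meas : Measurable kap := by unfold kap; fun_prop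
def KP (l S : ℝ) (G : E3 × ℝ → ℝ≥0∞) (z : E3 × ℝ) : ℝ≥0∞ :=
  ∫⁻ s in Ioo 0 S, ENNReal.ofReal (s ^ (-(19/20) : ℝ)) * ∫⁻ w, kap w * G (z.1 - w, z.2 + l * s)
lemma kap_smul {c : ℝ} (hc : 0 < c) (w : E3) : kap (c • w) = ENNReal.ofReal (c ^ (-(21/10) : ℝ)) * kap w := by
  unfold kap
  rw [enorm_smul, Real.enorm_of_nonneg hc.le, ← ENNReal.ofReal_rpow_of_pos hc]
  rcases eq_or_ne w 0 with rfl | hw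
  · have : (0:ℝ≥0∞) ^ (-(21/10) : ℝ) = ∞ := ENNReal.zero_rpow_of_neg (by norm_num)
    simp only [enorm_zero, mul_zero, this]
    rw [ENNReal.mul_top]; simp [ENNReal.rpow_eq_zero_iff, hc]
  · exact ENNReal.mul_rpow_of_ne_zero (by simpa using hc) (by simpa using hw) _
lemma kap_scal {s : ℝ} (hs : 0 < s) {f : E3 → ℝ≥0∞} (hf : Measurable f) :
    ∫⁻ y, kap y * f (√s • y) = ENNReal.ofReal (s ^ (-(9/20) : ℝ)) * ∫⁻ w, kap w * f w := by
  have hs' : 0 < √s := Real.sqrt_pos.2 hs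
  have hm := kap_meas
  have h1 : ∀ y, kap y * f (√s • y) = (fun w => ENNReal.ofReal ((√s)⁻¹ ^ (-(21/10) : ℝ)) * (kap w * f w)) (√s • y) := by
    intro y
    simp only
    rw [← mul_assoc, ← kap_smul (inv_pos.2 hs'), smul_smul, inv_mul_cancel₀ hs'.ne', one_smul]
  rw [lintegral_congr h1, ← lintegral_map (μ := volume) (g := fun y : E3 => √s • y)
    (f := fun w => ENNReal.ofReal ((√s)⁻¹ ^ (-(21/10) : ℝ)) * (kap w * f w)) (by fun_prop) (by fun_prop),
    Measure.map_addHaar_smul _ hs'.ne', lintegral_smul_measure, lintegral_const_mul _ (by fun_prop), smul_eq_mul,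
    ← mul_assoc, ← ENNReal.ofReal_mul (abs_nonneg _)]
  congr 2
  rw [finrank_euclideanSpace_fin, abs_of_pos (by positivity), Real.inv_rpow hs'.le, ← Real.rpow_natCast, ← Real.rpow_neg hs'.le,
    ← Real.rpow_neg hs'.le, ← Real.rpow_add hs', Real.sqrt_eq_rpow, ← Real.rpow_mul hs.le]
  norm_num
lemma gd_kap {k : ℝ} (hk : 0 ≤ k) : ∃ C : ℝ, 0 < C ∧ ∀ y : E3, ENNReal.ofReal (‖y‖ ^ k * gd y) ≤ ENNReal.ofReal C * kap y := by
  refine ⟨gc * (4 * ((k + 21/10) / 2)) ^ ((k + 21/10) / 2), mul_pos gc_pos (by positivity), fun y => ?_⟩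
  rcases eq_or_ne y 0 with rfl | hy
  · have : kap 0 = ∞ := by unfold kap; simp
    rw [this, ENNReal.mul_top]; exact le_top
    exact (ENNReal.ofReal_pos.2 (mul_pos gc_pos (by positivity))).ne'
  · have hy' : 0 < ‖y‖ := norm_pos_iff.2 hy
    have : kap y = ENNReal.ofReal (‖y‖ ^ (-(21/10) : ℝ)) := by
      unfold kap; rw [← ofReal_norm, ENNReal.ofReal_rpow_of_pos hy']
    rw [this, ← ENNReal.ofReal_mul (mul_pos gc_pos (by positivity)).le]
    refine ENNReal.ofReal_le_ofReal ?_
    have h := pow_exp_le (k := (k + 21/10)/2) (X := ‖y‖^2) (by positivity) (by positivity)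
    rw [← Real.rpow_natCast, ← Real.rpow_mul hy'.le] at h
    have e : ((2:ℕ):ℝ) * ((k + 21/10)/2) = k + 21/10 := by push_cast; ring
    rw [e, Real.rpow_natCast, Real.rpow_add hy'] at h
    rw [gd, Real.rpow_neg hy'.le, ← div_eq_mul_inv, le_div_iff₀ (by positivity)]
    calc _ = gc * (‖y‖ ^ k * ‖y‖ ^ (21/10 : ℝ) * Real.exp (-‖y‖^2/4)) := by
          rw [show -(1/4) * ‖y‖^2 = -‖y‖^2/4 by ring]; ring
      _ ≤ _ := mul_le_mul_of_nonneg_left h gc_pos.le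
lemma gν_lint {f : E3 → ℝ≥0∞} (hf : Measurable f) : ∫⁻ y, f y ∂gν = ∫⁻ y, ENNReal.ofReal (gd y) * f y :=
  lintegral_withDensity_eq_lintegral_mul _ gmeas hf
lemma pot_bound {l S : ℝ} (hS : 0 < S) : ∃ C : ℝ, 0 < C ∧ ∀ {g : E3 × ℝ → ℝ}, Sm g → HasCompactSupport g → ∀ z,
    ‖pot l S g z‖ₑ ≤ ENNReal.ofReal C * KP l S (fun z => ‖g z‖ₑ) z ∧
    ∀ i, ‖sdz (pot l S g) i z‖ₑ ≤ ENNReal.ofReal C * KP l S (fun z => ‖g z‖ₑ) z := by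
  obtain ⟨C0, hC0, h0⟩ := gd_kap (k := 0) le_rfl
  obtain ⟨C1, hC1, h1⟩ := gd_kap (k := 1) (by norm_num)
  refine ⟨C0 * √S + C1, by positivity, fun {g} hg hc z => ?_⟩
  have hgc := hg.continuous
  have hgme := hgc.measurable
  have hsg := sg_cont l
  have hkm := kap_meas
  have hgm := gmeas
  have key : ∀ s, 0 < s → ∫⁻ y, kap y * ‖g (z - sg l (s, y))‖ₑ = ENNReal.ofReal (s ^ (-(9/20) : ℝ)) *
      ∫⁻ w, kap w * ‖g (z.1 - w, z.2 + l * s)‖ₑ := by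
    intro s hs
    rw [← kap_scal hs (f := fun w => ‖g (z.1 - w, z.2 + l * s)‖ₑ) (by fun_prop)]
    refine lintegral_congr fun y => ?_
    simp only [sg, Prod.sub_def, sub_neg_eq_add]
  have main : ∀ (F : ℝ → E3 → ℝ) (c : ℝ), 0 ≤ c → (∀ s, 0 < s → Measurable (F s)) → c ≤ C0 * √S + C1 →
      (∀ s, 0 < s → s < S → ∀ y, ENNReal.ofReal (gd y) * ‖F s y‖ₑ ≤ ENNReal.ofReal (c * s ^ (-(1/2) : ℝ)) * (kap y * ‖g (z - sg l (s, y))‖ₑ)) →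
      ‖∫ s in Ioo 0 S, ∫ y, F s y ∂gν‖ₑ ≤ ENNReal.ofReal (C0 * √S + C1) * KP l S (fun z => ‖g z‖ₑ) z := by
    intro F c hc0 hF hcC hb
    refine (enorm_integral_le_lintegral_enorm _).trans ?_
    rw [KP, ← lintegral_const_mul' _ _ ENNReal.ofReal_ne_top]
    refine setLIntegral_mono' measurableSet_Ioo fun s hs => ?_
    refine (enorm_integral_le_lintegral_enorm _).trans ?_
    rw [gν_lint (hF s hs.1).enorm]
    refine (lintegral_mono (hb s hs.1 hs.2)).trans ?_
    rw [lintegral_const_mul' _ _ ENNReal.ofReal_ne_top, key s hs.1, ← mul_assoc, ← mul_assoc, ← ENNReal.ofReal_mul (by have := hs.1; positivity),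
      ← ENNReal.ofReal_mul (by positivity)]
    refine mul_le_mul_left (ENNReal.ofReal_le_ofReal ?_) _
    rw [mul_assoc, ← Real.rpow_add hs.1]
    have := Real.rpow_nonneg hs.1.le (-(19/20) : ℝ)
    norm_num at this ⊢
    gcongr
  constructor
  · rw [pot_eq hgc hc]
    refine main _ (C0 * √S) (by positivity) (fun s _ => by fun_prop) (by linarith) fun s hs hsS y => ?_
    rw [← mul_assoc]
    gcongr
    have := h0 y
    rw [Real.rpow_zero, one_mul] at this
    refine this.trans ?_
    gcongr
    rw [Real.rpow_neg hs.le, ← Real.sqrt_eq_rpow, mul_assoc, ← div_eq_mul_inv]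
    exact le_mul_of_one_le_right hC0.le ((one_le_div (Real.sqrt_pos.2 hs)).2 (Real.sqrt_le_sqrt hsS.le))
  · intro i
    simp only [pot]
    rw [avg_sdz hg hc]
    change ‖pot l S _ z‖ₑ ≤ _
    rw [pot_eq (hg.sdz i).continuous (cs_sdz hc i), setIntegral_congr_fun measurableSet_Ioo
      (fun s hs => ibp_aff hg hc l hs.1 z i)]
    refine main _ C1 hC1.le (fun s _ => by fun_prop) (le_add_of_nonneg_left (by positivity)) fun s hs hsS y => ?_
    rw [enorm_mul, ← mul_assoc, ← mul_assoc]
    refine mul_le_mul_left ?_ _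
    have := h1 y
    rw [Real.rpow_one] at this
    rw [ENNReal.ofReal_mul hC1.le, mul_right_comm]
    refine le_trans ?_ (mul_le_mul_left this _)
    rw [enorm_neg, ← ofReal_norm, ← ENNReal.ofReal_mul (gd_pos y).le, ← ENNReal.ofReal_mul (by have := gd_pos y; positivity)]
    refine ENNReal.ofReal_le_ofReal ?_
    have h5 := PiLp.norm_apply_le y i
    have h6 := Real.sqrt_pos.2 hs
    rw [Real.rpow_neg hs.le, ← Real.sqrt_eq_rpow, norm_div, Real.norm_of_nonneg (by positivity : 0 ≤ 2 * √s), mul_comm ‖y‖, mul_assoc]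
    gcongr ?_ * ?_
    · exact (gd_pos y).le
    · rw [← div_eq_mul_inv]; gcongr
      linarith

end

section
def IsP (M : Measure (E3 × ℝ)) (f : E3 × ℝ → ℝ) : Prop := ∃ g, Sm g ∧ HasCompactSupport g ∧ f = avg M g
section
variable {M : Measure (E3 × ℝ)} [IsFiniteMeasure M] {f h : E3 × ℝ → ℝ}
lemma IsP.sdz (H : IsP M f) (i) : IsP M (sdz f i) := by
  obtain ⟨g, h1, h2, rfl⟩ := H; exact ⟨_, h1.sdz i, cs_sdz h2 i, avg_sdz h1 h2 i⟩
lemma IsP.tdz (H : IsP M f) : IsP M (tdz f) := by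
  obtain ⟨g, h1, h2, rfl⟩ := H; exact ⟨_, h1.tdz, cs_tdz h2, avg_tdz h1 h2⟩
lemma IsP.sm (H : IsP M f) : Sm f := by obtain ⟨g, h1, h2, rfl⟩ := H; exact avg_sm h1 h2
lemma IsP.bdd (H : IsP M f) : ∃ C, ∀ z, ‖f z‖ ≤ C := by
  obtain ⟨g, h1, h2, rfl⟩ := H; exact avg_bdd h1.continuous h2
lemma IsP.mul_int (H : IsP M f) (K : IsP M h) : Integrable fun z => f z * h z := by
  obtain ⟨C, hC⟩ := H.bdd
  have hf := H.sm.continuous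
  obtain ⟨g, h1, h2, rfl⟩ := K
  exact (avg_integrable h1.continuous h2).bdd_mul hf.aestronglyMeasurable (ae_of_all _ hC)
lemma IsP.mul_sl (H : IsP M f) (K : IsP M h) (t : ℝ) : Integrable fun x => f (x, t) * h (x, t) := by
  obtain ⟨C, hC⟩ := H.bdd
  have hf := H.sm.continuous
  obtain ⟨g, h1, h2, rfl⟩ := K
  exact (avg_slice_integrable h1 h2 t).bdd_mul (c := C) (by fun_prop : Continuous fun x => f (x, t)).aestronglyMeasurable (ae_of_all _ fun x => hC _)
lemma IsP.ibp (H : IsP M f) (K : IsP M h) (i) (t : ℝ) :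
    ∫ x, f (x, t) * _root_.sdz h i (x, t) = - ∫ x, _root_.sdz f i (x, t) * h (x, t) := by
  have := integral_mul_fderiv_eq_neg_fderiv_mul_of_integrable (μ := volume) (f := fun x => f (x, t)) (g := fun x => h (x, t)) (v := bs i)
    (by simp_rw [slice_fderiv H.sm]; exact (H.sdz i).mul_sl K t)
    (by simp_rw [slice_fderiv K.sm]; exact H.mul_sl (K.sdz i) t) (H.mul_sl K t)
    (fun x _ => (sm_slice H.sm t).differentiable (by simp) x) (fun x _ => (sm_slice K.sm t).differentiable (by simp) x)
  simpa only [slice_fderiv H.sm, slice_fderiv K.sm] using this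
lemma lapz_mul_sum (a b : Fin 3 → ℝ) : (∑ i, a i) * (∑ l, b l) = ∑ i, ∑ l, a i * b l := by
  rw [Finset.sum_mul_sum]
lemma IsP.hess (H : IsP M f) (t : ℝ) :
    ∫ x, ∑ i, ∑ l, (_root_.sdz (_root_.sdz f i) l (x, t)) ^ 2 = ∫ x, (lapz f (x, t)) ^ 2 := by
  simp only [lapz, pow_two, lapz_mul_sum]
  rw [integral_finsetSum _ fun i _ => integrable_finsetSum _ fun l _ => ((H.sdz i).sdz l).mul_sl ((H.sdz i).sdz l) t,
    integral_finsetSum _ fun i _ => integrable_finsetSum _ fun l _ => ((H.sdz i).sdz i).mul_sl ((H.sdz l).sdz l) t]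
  refine Finset.sum_congr rfl fun i _ => ?_
  rw [integral_finsetSum _ fun l _ => ((H.sdz i).sdz l).mul_sl ((H.sdz i).sdz l) t,
    integral_finsetSum _ fun l _ => ((H.sdz i).sdz i).mul_sl ((H.sdz l).sdz l) t]
  refine Finset.sum_congr rfl fun l _ => ?_
  rw [((H.sdz i).sdz l).ibp (H.sdz i)]
  have e : ∀ x, _root_.sdz (_root_.sdz (_root_.sdz f i) l) l (x, t) * _root_.sdz f i (x, t) =
    _root_.sdz f i (x, t) * _root_.sdz (_root_.sdz (_root_.sdz f l) l) i (x, t) := by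
    intro x
    rw [mul_comm, show _root_.sdz (_root_.sdz f i) l = _root_.sdz (_root_.sdz f l) i from funext fun z => sdz_comm H.sm i l z,
      sdz_comm (H.sm.sdz l)]
  simp_rw [e]
  rw [(H.sdz i).ibp ((H.sdz l).sdz l), neg_neg]
lemma IsP.energy (H : IsP M f) {t' t1 : ℝ} (ht : t' ≤ t1) (h0 : ∀ x i, _root_.sdz f i (x, t1) = 0) {g : E3 × ℝ → ℝ}
    (hg : Sm g) (hc : HasCompactSupport g) (heq : ∀ x, ∀ t ∈ Ioc t' t1, lapz f (x, t) + _root_.tdz f (x, t) = - g (x, t)) :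
    (∫ x, ∑ i, (_root_.sdz f i (x, t')) ^ 2) + ∫ t in Ioc t' t1, ∫ x, ∑ i, ∑ l, (_root_.sdz (_root_.sdz f i) l (x, t)) ^ 2
      ≤ ∫ t in Ioc t' t1, ∫ x, (g (x, t)) ^ 2 := by
  have hpr : ∀ {F : E3 × ℝ → ℝ}, Integrable F → Integrable F (volume.prod (volume.restrict (Ioc t' t1))) := by
    intro F hF
    rw [← Measure.restrict_univ (μ := (volume : Measure E3)), Measure.prod_restrict]
    exact hF.integrableOn
  have hA : Integrable fun z => ∑ i, 2 * (_root_.sdz f i z * _root_.tdz (_root_.sdz f i) z) :=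
    integrable_finsetSum _ fun i _ => ((H.sdz i).mul_int (H.sdz i).tdz).const_mul 2
  have hgc := hg.continuous
  have hlt : Integrable fun z => lapz f z * _root_.tdz f z := by
    simp only [lapz, Finset.sum_mul]
    exact integrable_finsetSum _ fun i _ => ((H.sdz i).sdz i).mul_int H.tdz
  have hll : Integrable fun z => lapz f z ^ 2 := by
    simp only [lapz, pow_two, lapz_mul_sum]
    exact integrable_finsetSum _ fun i _ => integrable_finsetSum _ fun l _ => ((H.sdz i).sdz i).mul_int ((H.sdz l).sdz l)
  have hg2 : Integrable fun z => g z ^ 2 :=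
    Continuous.integrable_of_hasCompactSupport (by fun_prop) (hc.comp_left (g := fun u : ℝ => u ^ 2) (by simp))
  have s1 : (∫ x, ∑ i, (_root_.sdz f i (x, t')) ^ 2) =
      - ∫ t in Ioc t' t1, ∫ x, ∑ i, 2 * (_root_.sdz f i (x, t) * _root_.tdz (_root_.sdz f i) (x, t)) := by
    rw [← integral_integral_swap (f := fun x t => ∑ i, 2 * (_root_.sdz f i (x, t) * _root_.tdz (_root_.sdz f i) (x, t))) (hpr hA), ← integral_neg]
    refine integral_congr_ae (ae_of_all _ fun x => ?_)
    simp only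
    have hsm := fun i => H.sm.sdz i
    have hc1 := fun i => (hsm i).continuous
    have hc2 := fun i => (hsm i).tdz.continuous
    rw [← intervalIntegral.integral_of_le ht, intervalIntegral.integral_eq_sub_of_hasDerivAt (f := fun t => ∑ i, (_root_.sdz f i (x, t)) ^ 2)]
    · simp [h0]
    · intro t _
      refine HasDerivAt.fun_sum fun i _ => ?_
      have := (slice_deriv (hsm i) t x).fun_pow 2
      refine this.congr_deriv ?_; norm_num; ring
    · exact Continuous.intervalIntegrable (by fun_prop) _ _
  have s2 : ∀ t, ∫ x, ∑ i, 2 * (_root_.sdz f i (x, t) * _root_.tdz (_root_.sdz f i) (x, t)) =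
      - ∫ x, 2 * (lapz f (x, t) * _root_.tdz f (x, t)) := by
    intro t
    simp only [lapz, Finset.sum_mul, Finset.mul_sum]
    rw [integral_finsetSum _ fun i _ => ((H.sdz i).mul_sl (H.sdz i).tdz t).const_mul 2,
      integral_finsetSum _ fun i _ => (((H.sdz i).sdz i).mul_sl H.tdz t).const_mul 2, ← Finset.sum_neg_distrib]
    refine Finset.sum_congr rfl fun i _ => ?_
    rw [integral_const_mul, integral_const_mul]
    simp_rw [tdz_sdz H.sm]
    rw [(H.sdz i).ibp H.tdz]; ring
  simp_rw [s2, integral_neg, neg_neg] at s1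
  rw [s1, setIntegral_congr_fun measurableSet_Ioc (fun t _ => H.hess t)]
  rw [← integral_add]
  · refine setIntegral_mono_on ?_ ?_ measurableSet_Ioc fun t htm => ?_
    · exact ((hpr hlt).const_mul 2).integral_prod_right.add (hpr hll).integral_prod_right
    · exact (hpr hg2).integral_prod_right
    · have i1 : Integrable fun x => lapz f (x, t) * _root_.tdz f (x, t) := by
        simp only [lapz, Finset.sum_mul]
        exact integrable_finsetSum _ fun i _ => ((H.sdz i).sdz i).mul_sl H.tdz t
      have i2 : Integrable fun x => lapz f (x, t) ^ 2 := by
        simp only [lapz, pow_two, lapz_mul_sum]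
        exact integrable_finsetSum _ fun i _ => integrable_finsetSum _ fun l _ => ((H.sdz i).sdz i).mul_sl ((H.sdz l).sdz l) t
      rw [← integral_add (i1.const_mul 2) i2]
      refine integral_mono ((i1.const_mul 2).add i2) ?_ fun x => ?_
      · exact Continuous.integrable_of_hasCompactSupport (by fun_prop) (by
          have := cs_slice hc t; exact this.comp_left (g := fun u : ℝ => u ^ 2) (by simp))
      · have := heq x t htm
        have e : g (x, t) = -(lapz f (x, t) + _root_.tdz f (x, t)) := by linarith
        simp only [e]
        nlinarith [sq_nonneg (_root_.tdz f (x, t))]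
  · exact ((hpr hlt).const_mul 2).integral_prod_right
  · exact (hpr hll).integral_prod_right
end
lemma cs_lint {α : Type*} [MeasurableSpace α] {μ : Measure α} {f g : α → ℝ≥0∞} (hf : AEMeasurable f μ) (hg : AEMeasurable g μ) :
    (∫⁻ a, f a * g a ∂μ) ^ 2 ≤ (∫⁻ a, f a ^ 2 ∂μ) * ∫⁻ a, g a ^ 2 ∂μ := by
  have h := ENNReal.lintegral_mul_le_Lp_mul_Lq μ (p := 2) (q := 2) ⟨by norm_num, by norm_num, by norm_num⟩ hf hg
  simp only [Pi.mul_apply, ENNReal.rpow_two] at h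
  calc _ ≤ ((∫⁻ a, f a ^ 2 ∂μ) ^ (1/2 : ℝ) * (∫⁻ a, g a ^ 2 ∂μ) ^ (1/2 : ℝ)) ^ 2 := by gcongr
    _ = _ := by rw [mul_pow, ← ENNReal.rpow_natCast, ← ENNReal.rpow_natCast, ← ENNReal.rpow_mul, ← ENNReal.rpow_mul]; norm_num
lemma pot_l2 {S a L : ℝ} (hL : 0 ≤ L) {g : E3 × ℝ → ℝ} (hg : Sm g) (h0 : ∀ z, z.2 ∉ Ioo a (a + L) → g z = 0) (t : ℝ) :
    ∫⁻ x, ‖pot 1 S g (x, t)‖ₑ ^ 2 ≤ ENNReal.ofReal L * ∫⁻ z, ‖g z‖ₑ ^ 2 := by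
  have hgm := hg.continuous.measurable
  have hsg := (sg_cont 1).measurable
  let J : Set (E3 × ℝ) := {w | t - w.2 ∈ Ioo a (a + L)}
  have hJ : MeasurableSet J := by
    have : Measurable fun w : E3 × ℝ => t - w.2 := by fun_prop
    exact this measurableSet_Ioo
  have hMJ : gM 1 S J ≤ ENNReal.ofReal L := by
    rw [gM, Measure.map_apply hsg hJ]
    have : sg 1 ⁻¹' J ⊆ (Ioo (a - t) (a + L - t)) ×ˢ univ := by
      rintro ⟨s, y⟩ h
      simp only [J, sg, mem_preimage, Set.mem_ofPred_eq, mem_Ioo] at h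
      simp only [mem_prod, mem_Ioo, mem_univ, and_true]; constructor <;> linarith [h.1, h.2]
    refine (measure_mono this).trans ?_
    rw [Measure.prod_prod, measure_univ, mul_one]
    refine (Measure.restrict_apply_le _ _).trans ?_
    rw [Real.volume_Ioo]; ring_nf; rfl
  have h1 : ∀ x, ‖pot 1 S g (x, t)‖ₑ ^ 2 ≤ ENNReal.ofReal L * ∫⁻ w, ‖g ((x, t) - w)‖ₑ ^ 2 ∂(gM 1 S) := by
    intro x
    have e : ∫⁻ w, ‖g ((x, t) - w)‖ₑ ∂(gM 1 S) = ∫⁻ w, J.indicator 1 w * ‖g ((x, t) - w)‖ₑ ∂(gM 1 S) := by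
      refine lintegral_congr fun w => ?_
      by_cases hw : w ∈ J
      · simp [hw]
      · simp [hw, h0 ((x, t) - w) hw]
    calc _ ≤ (∫⁻ w, ‖g ((x, t) - w)‖ₑ ∂(gM 1 S)) ^ 2 := by gcongr; exact enorm_integral_le_lintegral_enorm _
      _ ≤ _ := by
        rw [e]
        refine (cs_lint (measurable_one.indicator hJ).aemeasurable (by fun_prop)).trans ?_
        gcongr
        have : ∀ w, (J.indicator 1 w : ℝ≥0∞) ^ 2 = J.indicator 1 w := by
          intro w; by_cases hw : w ∈ J <;> simp [hw]
        simp_rw [this]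
        rw [lintegral_indicator_one hJ]; exact hMJ
  refine (lintegral_mono h1).trans ?_
  rw [lintegral_const_mul' _ _ ENNReal.ofReal_ne_top, lintegral_lintegral_swap (by fun_prop)]
  gcongr ENNReal.ofReal L * ?_
  have h2 : ∀ w : E3 × ℝ, ∫⁻ x, ‖g ((x, t) - w)‖ₑ ^ 2 = ∫⁻ x, ‖g (x, t - w.2)‖ₑ ^ 2 := fun w =>
    lintegral_sub_right_eq_self (fun x => ‖g (x, t - w.2)‖ₑ ^ 2) w.1
  rw [lintegral_congr h2]
  have hmm : Measurable fun τ : ℝ => ∫⁻ x, ‖g (x, τ)‖ₑ ^ 2 :=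
    Measurable.lintegral_prod_left' (f := fun z : E3 × ℝ => ‖g z‖ₑ ^ 2) (by fun_prop)
  rw [gM, lintegral_map (f := fun w : E3 × ℝ => ∫⁻ x, ‖g (x, t - w.2)‖ₑ ^ 2) (by fun_prop) hsg, lintegral_prod _ (by simp only [sg]; fun_prop)]
  simp only [sg, lintegral_const, measure_univ, mul_one, one_mul, sub_neg_eq_add]
  refine (setLIntegral_le_lintegral _ _).trans ?_
  rw [lintegral_add_left_eq_self (fun τ : ℝ => ∫⁻ x, ‖g (x, τ)‖ₑ ^ 2) t, Measure.volume_eq_prod, lintegral_prod_symm _ (by fun_prop)]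

end

section
lemma L4 {P : Type*} [TopologicalSpace P] [TopologicalSpace.SeparableSpace P] [FirstCountableTopology P] {u : E3 × ℝ → E3}
    {D : E3 × ℝ → Fin 3 → Fin 3 → ℝ} {U : Set E3}
    (hu : ∀ᵐ t, Integrable fun x => u (x, t)) (hD : ∀ᵐ t, Integrable fun x => D (x, t))
    (wg : ∀ ψ : E3 → ℝ, Sm ψ → HasCompactSupport ψ → tsupport ψ ⊆ U → ∀ᵐ t : ℝ, ∀ i j : Fin 3,
      ∫ x, u (x, t) j * fderiv ℝ ψ x (bs i) = - ∫ x, D (x, t) i j * ψ x)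
    {ψ : P → E3 → ℝ} (h1 : ∀ q, Sm (ψ q)) (h2 : ∀ q, HasCompactSupport (ψ q)) (h3 : ∀ q, tsupport (ψ q) ⊆ U) (i j : Fin 3)
    (c0 : ∀ x, Continuous fun q => ψ q x) (c1 : ∀ x, Continuous fun q => fderiv ℝ (ψ q) x (bs i))
    {C : ℝ} (b0 : ∀ q x, |ψ q x| ≤ C) (b1 : ∀ q x, |fderiv ℝ (ψ q) x (bs i)| ≤ C) :
    ∀ᵐ t, ∀ q, ∫ x, u (x, t) j * fderiv ℝ (ψ q) x (bs i) = - ∫ x, D (x, t) i j * ψ q x := by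
  obtain ⟨s, hs, hd⟩ := TopologicalSpace.exists_countable_dense P
  have := (ae_ball_iff hs (p := fun t q _ => ∀ i j : Fin 3,
      ∫ x, u (x, t) j * fderiv ℝ (ψ q) x (bs i) = - ∫ x, D (x, t) i j * ψ q x)).2 fun q _ => wg _ (h1 q) (h2 q) (h3 q)
  filter_upwards [this, hu, hD] with t ht hut hDt
  have iu : Integrable fun x => u (x, t) j := (EuclideanSpace.proj (𝕜 := ℝ) j).integrable_comp hut
  have iD : Integrable fun x => D (x, t) i j := (hDt.eval i).eval j
  have k1 : Continuous fun q => ∫ x, u (x, t) j * fderiv ℝ (ψ q) x (bs i) := by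
    refine continuous_of_dominated (bound := fun x => ‖u (x, t) j‖ * C) (fun q => ?_) (fun q => ae_of_all _ fun x => ?_) (iu.norm.mul_const _)
      (ae_of_all _ fun x => (c1 x).const_mul _)
    · exact iu.aestronglyMeasurable.mul ((h1 q).dd (bs i)).continuous.aestronglyMeasurable
    · rw [norm_mul]; gcongr; exact b1 q x
  have k2 : Continuous fun q => -∫ x, D (x, t) i j * ψ q x := by
    refine (continuous_of_dominated (bound := fun x => ‖D (x, t) i j‖ * C) (fun q => ?_) (fun q => ae_of_all _ fun x => ?_) (iD.norm.mul_const _)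
      (ae_of_all _ fun x => (c0 x).const_mul _)).neg
    · exact iD.aestronglyMeasurable.mul (h1 q).continuous.aestronglyMeasurable
    · rw [norm_mul]; gcongr; exact b0 q x
  exact congrFun (Continuous.ext_on hd k1 k2 fun q hq => ht q hq i j)
lemma ts_slice {g : E3 × ℝ → ℝ} {U : Set E3} {J : Set ℝ} (h : tsupport g ⊆ U ×ˢ J) (t : ℝ) : tsupport (fun x => g (x, t)) ⊆ U := by
  intro x hx
  have : (x, t) ∈ tsupport g :=
    tsupport_comp_subset_preimage g (f := fun x => (x, t)) (by fun_prop) hx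
  exact (h this).1
lemma cs_bdd {F : Type*} [TopologicalSpace F] {g : F → ℝ} (hg : Continuous g) (hc : HasCompactSupport g) : ∃ C, ∀ z, |g z| ≤ C :=
  hc.exists_bound_of_continuous hg
lemma wg_st {u : E3 × ℝ → E3} {D : E3 × ℝ → Fin 3 → Fin 3 → ℝ} {U : Set E3} (hu : Integrable u) (hD : Integrable D)
    (wg : ∀ ψ : E3 → ℝ, Sm ψ → HasCompactSupport ψ → tsupport ψ ⊆ U → ∀ᵐ t : ℝ, ∀ i j : Fin 3,
      ∫ x, u (x, t) j * fderiv ℝ ψ x (bs i) = - ∫ x, D (x, t) i j * ψ x)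
    {ψ : E3 × ℝ → ℝ} (h1 : Sm ψ) (h2 : HasCompactSupport ψ) {J : Set ℝ} (h3 : tsupport ψ ⊆ U ×ˢ J) (i j : Fin 3) :
    ∫ z, u z j * sdz ψ i z = - ∫ z, D z i j * ψ z := by
  have iu : Integrable fun z => u z j := (EuclideanSpace.proj (𝕜 := ℝ) j).integrable_comp hu
  have iD : Integrable fun z => D z i j := (hD.eval i).eval j
  obtain ⟨C0, hC0⟩ := cs_bdd h1.continuous h2
  obtain ⟨C1, hC1⟩ := cs_bdd (h1.sdz i).continuous (cs_sdz h2 i)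
  have p1 := h1.continuous
  have p2 := (h1.sdz i).continuous
  have i1 : Integrable fun z => u z j * sdz ψ i z :=
    iu.mul_bdd (c := C1) p2.aestronglyMeasurable (ae_of_all _ hC1)
  have i2 : Integrable fun z => D z i j * ψ z :=
    iD.mul_bdd (c := C0) p1.aestronglyMeasurable (ae_of_all _ hC0)
  have := L4 (P := ℝ) (u := u) (D := D) (U := U) (ψ := fun t x => ψ (x, t)) (C := max C0 C1) hu.prod_left_ae hD.prod_left_ae wg
    (sm_slice h1) (cs_slice h2) (ts_slice h3) i j (fun x => by fun_prop) (fun x => by simp_rw [slice_fderiv h1]; fun_prop)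
    (fun q x => (hC0 _).trans (le_max_left _ _)) (fun q x => by rw [slice_fderiv h1]; exact (hC1 _).trans (le_max_right _ _))
  rw [Measure.volume_eq_prod] at i1 i2 ⊢
  rw [integral_prod_symm _ i1, integral_prod_symm _ i2, ← integral_neg]
  refine integral_congr_ae ?_
  filter_upwards [this] with t ht
  have := ht t
  simp_rw [slice_fderiv h1] at this
  exact this
def om (D : E3 × ℝ → Fin 3 → Fin 3 → ℝ) (j k : Fin 3) (z : E3 × ℝ) : ℝ := D z j k - D z k j
structure Loc (x0 : E3) (t0 r : ℝ) (v : E3 × ℝ → E3) (D : E3 × ℝ → Fin 3 → Fin 3 → ℝ) : Prop where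
  hr : 0 < r
  mv : Measurable v
  mD : Measurable D
  v0 : ∀ z, z ∉ pcyl (x0, t0) r → v z = 0
  D0 : ∀ z, z ∉ pcyl (x0, t0) r → D z = 0
  vM : ∃ M : ℝ, 0 ≤ M ∧ ∀ᵐ t : ℝ, ∫⁻ x, ‖v (x, t)‖ₑ ^ 2 ≤ ENNReal.ofReal M
  D2 : ∫⁻ z, ‖D z‖ₑ ^ 2 < ∞
  iv : Integrable v
  iD : Integrable D
  ivD : Integrable fun z => ‖v z‖ * ‖D z‖
  wg : ∀ ψ : E3 → ℝ, Sm ψ → HasCompactSupport ψ → tsupport ψ ⊆ Metric.ball x0 r → ∀ᵐ t : ℝ, ∀ i j : Fin 3,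
      ∫ x, v (x, t) j * fderiv ℝ ψ x (bs i) = - ∫ x, D (x, t) i j * ψ x
  tr : ∀ᵐ z, ∑ i, D z i i = 0
  H2 : ∀ Ψ : E3 × ℝ → ℝ, Sm Ψ → HasCompactSupport Ψ → tsupport Ψ ⊆ pcyl (x0, t0) r → ∀ j k,
    ∫ z, (om D j k z * (tdz Ψ z + lapz Ψ z) + ∑ l, v z l * (D z l k * sdz Ψ j z - D z l j * sdz Ψ k z)) = 0
  H3 : ∀ Ψ : E3 × ℝ → ℝ, Sm Ψ → HasCompactSupport Ψ → tsupport Ψ ⊆ pcyl (x0, t0) r → ∀ i,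
    ∫ z, (v z i * lapz Ψ z + ∑ j, om D j i z * sdz Ψ j z) = 0

end

section
lemma out_s {Ψ : E3 × ℝ → ℝ} {z} (hz : z ∉ tsupport Ψ) (i) : sdz Ψ i z = 0 := image_eq_zero_of_notMem_tsupport fun h => hz (ts_sdz _ _ h)
lemma out_t {Ψ : E3 × ℝ → ℝ} {z} (hz : z ∉ tsupport Ψ) : tdz Ψ z = 0 := image_eq_zero_of_notMem_tsupport fun h => hz (ts_tdz _ h)
lemma out_l {Ψ : E3 × ℝ → ℝ} {z} (hz : z ∉ tsupport Ψ) : lapz Ψ z = 0 :=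
  Finset.sum_eq_zero fun i _ => out_s (fun h => hz (ts_sdz _ _ h)) i
lemma pcyl_meas (z r) : MeasurableSet (pcyl z r) := Metric.isOpen_ball.measurableSet.prod measurableSet_Ioo
lemma pcyl_open (z r) : IsOpen (pcyl z r) := Metric.isOpen_ball.prod isOpen_Ioo
lemma pcyl_fin (z r) : volume (pcyl z r) < ∞ := by
  rw [pcyl, Measure.volume_eq_prod, Measure.prod_prod]
  exact ENNReal.mul_lt_top measure_ball_lt_top (by simp)
lemma D_le (M : Fin 3 → Fin 3 → ℝ) (i j) : |M i j| ≤ ‖M‖ := (norm_le_pi_norm (M i) j).trans (norm_le_pi_norm M i)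
lemma D_le_sum (M : Fin 3 → Fin 3 → ℝ) : ‖M‖ ^ 2 ≤ ∑ i, ∑ j, (M i j) ^ 2 := by
  have h : ∀ i j, |M i j| ≤ √(∑ i, ∑ j, (M i j) ^ 2) := fun i j => by
    refine Real.abs_le_sqrt ?_
    refine le_trans ?_ (Finset.single_le_sum (f := fun i => ∑ j, (M i j) ^ 2) (fun i _ => Finset.sum_nonneg fun j _ => sq_nonneg _) (Finset.mem_univ i))
    exact Finset.single_le_sum (f := fun j => (M i j) ^ 2) (fun j _ => sq_nonneg _) (Finset.mem_univ j)
  have h2 : ‖M‖ ≤ √(∑ i, ∑ j, (M i j) ^ 2) := (pi_norm_le_iff_of_nonneg (Real.sqrt_nonneg _)).2 fun i =>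
    (pi_norm_le_iff_of_nonneg (Real.sqrt_nonneg _)).2 fun j => h i j
  calc _ ≤ (√(∑ i, ∑ j, (M i j) ^ 2)) ^ 2 := by gcongr
    _ = _ := Real.sq_sqrt (Finset.sum_nonneg fun i _ => Finset.sum_nonneg fun j _ => sq_nonneg _)
lemma l2_int {α F : Type*} [MeasurableSpace α] [NormedAddCommGroup F] {μ : Measure α} {Q : Set α} (hQ : μ Q < ∞) {f : α → F}
    (hf : AEStronglyMeasurable f μ) (h0 : ∀ z, z ∉ Q → f z = 0) (h2 : ∫⁻ z, ‖f z‖ₑ ^ 2 ∂μ < ∞) : Integrable f μ := by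
  have : IntegrableOn f Q μ := by
    have : IsFiniteMeasure (μ.restrict Q) := ⟨by simpa using hQ⟩
    have hm : MemLp f 2 μ := ⟨hf, by
      rw [eLpNorm_lt_top_iff_lintegral_rpow_enorm_lt_top (by simp) (by simp)]; simpa using h2⟩
    exact (hm.restrict Q).integrable (by simp)
  exact (integrableOn_iff_integrable_of_support_subset fun z hz => by_contra fun h => hz (h0 z h)).1 this
lemma l2_mul {α : Type*} [MeasurableSpace α] {μ : Measure α} {F G : Type*} [NormedAddCommGroup F] [NormedAddCommGroup G] {f : α → F} {g : α → G}
    (hf : AEStronglyMeasurable f μ) (hg : AEStronglyMeasurable g μ) (h1 : ∫⁻ z, ‖f z‖ₑ ^ 2 ∂μ < ∞) (h2 : ∫⁻ z, ‖g z‖ₑ ^ 2 ∂μ < ∞) :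
    Integrable (fun z => ‖f z‖ * ‖g z‖) μ := by
  refine ⟨hf.norm.mul hg.norm, ?_⟩
  simp only [HasFiniteIntegral, enorm_mul, enorm_norm]
  have h := cs_lint hf.enorm hg.enorm
  by_contra hh
  rw [not_lt, top_le_iff] at hh
  rw [hh] at h
  exact absurd (h.trans_lt (ENNReal.mul_lt_top h1 h2)) (by simp)
lemma sl_l2 {F : Type*} [NormedAddCommGroup F] [MeasurableSpace F] [OpensMeasurableSpace F] {v : E3 × ℝ → F} {z₀ : E3 × ℝ} {r : ℝ} (mv : Measurable v)
    (v0 : ∀ z, z ∉ pcyl z₀ r → v z = 0) {M : ℝ}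
    (h : ∀ᵐ t : ℝ, ∫⁻ x, ‖v (x, t)‖ₑ ^ 2 ≤ ENNReal.ofReal M) : ∫⁻ z, ‖v z‖ₑ ^ 2 < ∞ := by
  have hm : Measurable fun z => ‖v z‖ₑ ^ 2 := by fun_prop
  rw [Measure.volume_eq_prod, lintegral_prod_symm _ hm.aemeasurable]
  calc _ ≤ ∫⁻ t, (Ioo (z₀.2 - r ^ 2) z₀.2).indicator (fun _ => ENNReal.ofReal M) t := by
        refine lintegral_mono_ae ?_
        filter_upwards [h] with t ht
        by_cases hm : t ∈ Ioo (z₀.2 - r ^ 2) z₀.2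
        · simpa [hm] using ht
        · have : ∀ x, v (x, t) = 0 := fun x => v0 _ fun hx => hm hx.2
          simp [this]
    _ < ∞ := by
        rw [lintegral_indicator measurableSet_Ioo]; simp [ENNReal.mul_lt_top]
lemma ind_sl (Q : Set (E3 × ℝ)) {F : Type*} [NormedAddCommGroup F] (v : E3 × ℝ → F) (z) : ‖Q.indicator v z‖ₑ ≤ ‖v z‖ₑ := by
  by_cases h : z ∈ Q <;> simp [h]
lemma Loc.mono {x0 t0 r r' v D} (L : Loc x0 t0 r v D) (h0 : 0 < r') (hr' : r' ≤ r) :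
    Loc x0 t0 r' ((pcyl (x0, t0) r').indicator v) ((pcyl (x0, t0) r').indicator D) := by
  set Q := pcyl (x0, t0) r' with hQ
  have hsub : Q ⊆ pcyl (x0, t0) r := by
    refine Set.prod_mono (Metric.ball_subset_ball hr') (Ioo_subset_Ioo_left ?_)
    have : r' ^ 2 ≤ r ^ 2 := by gcongr
    simp only; linarith
  have mQ : MeasurableSet Q := pcyl_meas _ _
  refine ⟨h0, L.mv.indicator mQ, L.mD.indicator mQ, fun z hz => indicator_of_notMem hz _, fun z hz => indicator_of_notMem hz _, ?_, ?_, L.iv.indicator mQ,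
    L.iD.indicator mQ, ?_, ?_, ?_, ?_, ?_⟩
  · obtain ⟨M, hM, h⟩ := L.vM
    refine ⟨M, hM, ?_⟩
    filter_upwards [h] with t ht
    refine (lintegral_mono fun x => ?_).trans ht
    gcongr; exact ind_sl _ _ _
  · refine (lintegral_mono fun x => ?_).trans_lt L.D2
    gcongr; exact ind_sl _ _ _
  · refine (L.ivD.indicator mQ).congr (ae_of_all _ fun z => ?_)
    by_cases h : z ∈ Q <;> simp [h]
  · intro ψ h1 h2 h3
    filter_upwards [L.wg ψ h1 h2 (h3.trans (Metric.ball_subset_ball hr'))] with t ht i j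
    by_cases hm : t ∈ Ioo (t0 - r' ^ 2) t0
    · rw [show ∫ x, Q.indicator v (x, t) j * fderiv ℝ ψ x (bs i) = ∫ x, v (x, t) j * fderiv ℝ ψ x (bs i) from ?_,
        show ∫ x, Q.indicator D (x, t) i j * ψ x = ∫ x, D (x, t) i j * ψ x from ?_, ht i j]
      · congr 1; ext x
        by_cases hx : x ∈ Metric.ball x0 r'
        · rw [indicator_of_mem (show (x, t) ∈ Q from ⟨hx, hm⟩)]
        · rw [image_eq_zero_of_notMem_tsupport (f := ψ) fun h => hx (h3 h)]; simp
      · congr 1; ext x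
        by_cases hx : x ∈ Metric.ball x0 r'
        · rw [indicator_of_mem (show (x, t) ∈ Q from ⟨hx, hm⟩)]
        · have := image_eq_zero_of_notMem_tsupport (f := fun x => fderiv ℝ ψ x (bs i)) fun h => hx (h3 (ts_dd _ _ h)); simp only [this, mul_zero]
    · have : ∀ x, (x, t) ∉ Q := fun x h => hm h.2
      simp [this]
  · filter_upwards [L.tr] with z hz
    by_cases h : z ∈ Q
    · simpa [h] using hz
    · simp [h]
  · intro Ψ h1 h2 h3 j k
    rw [← L.H2 Ψ h1 h2 (h3.trans hsub) j k]
    congr 1; ext z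
    by_cases h : z ∈ Q
    · simp [h, om]
    · have h' : z ∉ tsupport Ψ := fun hh => h (h3 hh)
      simp [h, out_s h', out_t h', out_l h']
  · intro Ψ h1 h2 h3 i
    rw [← L.H3 Ψ h1 h2 (h3.trans hsub) i]
    congr 1; ext z
    by_cases h : z ∈ Q
    · simp [h, om]
    · have h' : z ∉ tsupport Ψ := fun hh => h (h3 hh)
      simp [h, out_s h', out_l h']
lemma L_exp {v : E3 × ℝ → E3} {D : E3 × ℝ → Fin 3 → Fin 3 → ℝ} {U : Set E3} {J : Set ℝ} (iv : Integrable v) (iD : Integrable D)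
    (wg : ∀ ψ : E3 → ℝ, Sm ψ → HasCompactSupport ψ → tsupport ψ ⊆ U → ∀ᵐ t : ℝ, ∀ i j : Fin 3,
      ∫ x, v (x, t) j * fderiv ℝ ψ x (bs i) = - ∫ x, D (x, t) i j * ψ x) {Ψ : E3 × ℝ → ℝ} (h1 : Sm Ψ) (h2 : HasCompactSupport Ψ)
    (h3 : tsupport Ψ ⊆ U ×ˢ J) (j k : Fin 3) :
    ∫ z, (-(v z k * tdz (sdz Ψ j) z) + ∑ l, D z l k * sdz (sdz Ψ j) l z) = ∫ z, D z j k * (tdz Ψ z + lapz Ψ z) := by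
  have bd : ∀ {f g : E3 × ℝ → ℝ}, Integrable f → Sm g → HasCompactSupport g → Integrable fun z => f z * g z := by
    intro f g hf hg hc
    obtain ⟨C, hC⟩ := cs_bdd hg.continuous hc
    exact hf.mul_bdd (c := C) hg.continuous.aestronglyMeasurable (ae_of_all _ hC)
  have iv' : ∀ k, Integrable fun z => v z k := fun k => (EuclideanSpace.proj (𝕜 := ℝ) k).integrable_comp iv
  have iD' : ∀ i j, Integrable fun z => D z i j := fun i j => (iD.eval i).eval j
  have g := fun (φ : E3 × ℝ → ℝ) (a : Sm φ) (b : HasCompactSupport φ) (c : tsupport φ ⊆ tsupport Ψ) i j =>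
    wg_st iv iD wg a b (c.trans h3) i j
  have i0 : Integrable fun z => -(v z k * tdz (sdz Ψ j) z) := (bd (iv' k) (h1.sdz j).tdz (cs_tdz (cs_sdz h2 j))).neg
  rw [integral_add i0 (integrable_finsetSum _ fun l _ => bd (iD' l k) ((h1.sdz j).sdz l) (cs_sdz (cs_sdz h2 j) l)),
    integral_finsetSum _ fun l _ => bd (iD' l k) ((h1.sdz j).sdz l) (cs_sdz (cs_sdz h2 j) l)]
  have e1 : ∫ z, -(v z k * tdz (sdz Ψ j) z) = ∫ z, D z j k * tdz Ψ z := by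
    simp_rw [tdz_sdz h1]
    rw [integral_neg, g _ h1.tdz (cs_tdz h2) (ts_tdz _), neg_neg]
  have e2 : ∀ l, ∫ z, D z l k * sdz (sdz Ψ j) l z = ∫ z, D z j k * sdz (sdz Ψ l) l z := by
    intro l
    have a := g _ ((h1.sdz j).sdz l) (cs_sdz (cs_sdz h2 j) l) ((ts_sdz _ _).trans (ts_sdz _ _)) l k
    have b := g _ ((h1.sdz l).sdz l) (cs_sdz (cs_sdz h2 l) l) ((ts_sdz _ _).trans (ts_sdz _ _)) j k
    have c : sdz (sdz (sdz Ψ j) l) l = sdz (sdz (sdz Ψ l) l) j := by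
      funext z
      rw [show sdz (sdz Ψ j) l = sdz (sdz Ψ l) j from funext fun z => sdz_comm h1 j l z, sdz_comm (h1.sdz l)]
    rw [c] at a
    linarith
  simp_rw [e1, e2, mul_add]
  rw [integral_add (bd (iD' j k) h1.tdz (cs_tdz h2)) (bd (iD' j k) h1.lapz (HasCompactSupport.intro h2 fun z hz => out_l hz))]
  congr 1
  rw [← integral_finsetSum _ fun l _ => bd (iD' j k) ((h1.sdz l).sdz l) (cs_sdz (cs_sdz h2 l) l)]
  simp [lapz, Finset.mul_sum]
lemma nse_alg (V : E3) (M : Fin 3 → Fin 3 → ℝ) (P a b a' b' : ℝ) (A B : Fin 3 → ℝ) (j k : Fin 3) (h : A k = B j) :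
    -(∑ i, V i * (a • bs k - b • bs j) i) + (∑ i, ∑ l, V l * M l i * (a' • bs k - b' • bs j) i)
      + (∑ i, ∑ l, M l i * (A l • bs k - B l • bs j) i) - P * ∑ i, (A i • bs k - B i • bs j) i =
    (-(V k * a) + ∑ l, M l k * A l) - (-(V j * b) + ∑ l, M l j * B l) + ∑ l, V l * (M l k * a' - M l j * b') := by
  have e : ∀ (c d : ℝ) i, (c • bs k - d • bs j) i = c * (if i = k then 1 else 0) - d * (if i = j then 1 else 0) := by
    intro c d i; simp
  have q : ∀ (f : Fin 3 → ℝ) (k : Fin 3), ∑ i, f i * (if i = k then 1 else 0) = f k := by intro f k; simp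
  have q1 := fun c d (f : Fin 3 → ℝ) => show ∑ i, f i * (c * (if i = k then 1 else 0) - d * (if i = j then 1 else 0)) = f k * c - f j * d by
    simp only [mul_sub, Finset.sum_sub_distrib, ← mul_assoc, q (fun i => f i * c), q (fun i => f i * d)]
  rw [Finset.sum_comm (f := fun i l => V l * M l i * (a' • bs k - b' • bs j) i), Finset.sum_comm (f := fun i l => M l i * (A l • bs k - B l • bs j) i)]
  simp only [e, q1 _ _ (fun i => V i), fun l => q1 a' b' (fun i => V l * M l i), fun l => q1 (A l) (B l) (fun i => M l i)]
  rw [Finset.sum_sub_distrib (f := fun i => A i * _), q A, q B, h]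
  simp only [Finset.sum_sub_distrib, mul_sub, mul_assoc]; ring
set_option maxHeartbeats 2000000 in
lemma mkLoc {Ω : Set E3} {T : ℝ} {v : E3 × ℝ → E3} {Dv : E3 × ℝ → Fin 3 → Fin 3 → ℝ} {p : E3 × ℝ → ℝ} {v₀ : E3 → E3} {x0 : E3} {t0 r : ℝ}
    (hΩ : IsOpen Ω) (hs : IsSuitableWeakSolution Ω T v Dv p v₀) (hr : 0 < r) (hQ : pcyl (x0, t0) r ⊆ Ω ×ˢ Ioo 0 T) :
    Loc x0 t0 r ((pcyl (x0, t0) r).indicator v) ((pcyl (x0, t0) r).indicator Dv) := by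
  have hQ' := hQ
  rw [pcyl, Set.prod_subset_prod_iff] at hQ'
  have hne : (Metric.ball x0 r).Nonempty := ⟨x0, Metric.mem_ball_self hr⟩
  have hne2 : (Ioo (t0 - r ^ 2) t0).Nonempty := nonempty_Ioo.2 (by nlinarith [sq_nonneg r, pow_pos hr 2])
  obtain ⟨hB, hI⟩ : Metric.ball x0 r ⊆ Ω ∧ Ioo (t0 - r ^ 2) t0 ⊆ Ioo 0 T := by
    rcases hQ' with h | h | h
    · exact h
    · exact absurd h hne.ne_empty
    · exact absurd h hne2.ne_empty
  set Q := pcyl (x0, t0) r with hQd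
  have mQ : MeasurableSet Q := pcyl_meas _ _
  have mO : MeasurableSet (Ω ×ˢ Ioo 0 T) := hΩ.measurableSet.prod measurableSet_Ioo
  have vM : ∃ M : ℝ, 0 ≤ M ∧ ∀ᵐ t : ℝ, ∫⁻ x, ‖Q.indicator v (x, t)‖ₑ ^ 2 ≤ ENNReal.ofReal M := by
    have h := hs.v_linf_l2
    rw [MemMixed, mixedNorm, if_pos rfl] at h
    set K := essSup (fun t => eLpNorm (fun x => v (x, t)) 2 (volume.restrict Ω)) (volume.restrict (Ioo 0 T))
    refine ⟨(K ^ 2).toReal, ENNReal.toReal_nonneg, ?_⟩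
    rw [ENNReal.ofReal_toReal (by finiteness)]
    have := _root_.ae_le_essSup (f := fun t => eLpNorm (fun x => v (x, t)) 2 (volume.restrict Ω)) (μ := volume.restrict (Ioo 0 T))
    rw [ae_restrict_iff' measurableSet_Ioo] at this
    filter_upwards [this] with t ht
    by_cases hm : t ∈ Ioo (t0 - r ^ 2) t0
    · have h3 := ht (hI hm)
      calc _ ≤ ∫⁻ x in Ω, ‖v (x, t)‖ₑ ^ 2 := by
            rw [← lintegral_indicator hΩ.measurableSet]
            refine lintegral_mono fun x => ?_
            by_cases hx : (x, t) ∈ Q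
            · rw [indicator_of_mem hx, indicator_of_mem (hQ hx).1]
            · rw [indicator_of_notMem hx]; simp
        _ = (eLpNorm (fun x => v (x, t)) 2 (volume.restrict Ω)) ^ 2 := by
            rw [eLpNorm_eq_lintegral_rpow_enorm_toReal (by simp) (by simp), ← ENNReal.rpow_natCast, ← ENNReal.rpow_mul]; simp
        _ ≤ _ := by gcongr
    · have : ∀ x, (x, t) ∉ Q := fun x h => hm h.2
      simp [this]
  have D2 : ∫⁻ z, ‖Q.indicator Dv z‖ₑ ^ 2 < ∞ := by
    refine lt_of_le_of_lt ?_ hs.v_l2_w12.2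
    rw [← lintegral_indicator mO]
    refine lintegral_mono fun z => ?_
    by_cases hz : z ∈ Q
    · rw [indicator_of_mem hz, indicator_of_mem (hQ hz), ← ofReal_norm, ← ofReal_norm, ← ENNReal.ofReal_pow (norm_nonneg _)]
      refine ENNReal.ofReal_le_ofReal (le_trans ?_ (le_abs_self _))
      nlinarith [D_le_sum (Dv z), sq_nonneg ‖v z‖]
    · rw [indicator_of_notMem hz]; simp
  have mv := hs.meas_v.indicator mQ
  have mD := hs.meas_Dv.indicator mQ
  have v0 : ∀ z, z ∉ Q → Q.indicator v z = 0 := fun z hz => indicator_of_notMem hz _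
  have D0 : ∀ z, z ∉ Q → Q.indicator Dv z = 0 := fun z hz => indicator_of_notMem hz _
  have v2 : ∫⁻ z, ‖Q.indicator v z‖ₑ ^ 2 < ∞ := by
    obtain ⟨M, -, h⟩ := vM; exact sl_l2 mv v0 h
  have iv := l2_int (pcyl_fin (x0, t0) r) mv.aestronglyMeasurable v0 v2
  have iD := l2_int (pcyl_fin (x0, t0) r) mD.aestronglyMeasurable D0 D2
  have ivD := l2_mul mv.aestronglyMeasurable mD.aestronglyMeasurable v2 D2
  have wg : ∀ ψ : E3 → ℝ, Sm ψ → HasCompactSupport ψ → tsupport ψ ⊆ Metric.ball x0 r → ∀ᵐ t : ℝ, ∀ i j : Fin 3,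
      ∫ x, Q.indicator v (x, t) j * fderiv ℝ ψ x (bs i) = - ∫ x, Q.indicator Dv (x, t) i j * ψ x := by
    intro ψ h1 h2 h3
    have := hs.weak_grad ψ h1 h2 (h3.trans hB)
    rw [ae_restrict_iff' measurableSet_Ioo] at this
    filter_upwards [this] with t ht i j
    by_cases hm : t ∈ Ioo (t0 - r ^ 2) t0
    · have ht := ht (hI hm) i j
      rw [← setIntegral_eq_integral_of_forall_compl_eq_zero (s := Ω), ← setIntegral_eq_integral_of_forall_compl_eq_zero (s := Ω)
        (f := fun x => Q.indicator Dv (x, t) i j * ψ x),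
        show ∫ x in Ω, Q.indicator v (x, t) j * fderiv ℝ ψ x (bs i) = ∫ x in Ω, v (x, t) j * fderiv ℝ ψ x (bs i) from ?_,
        show ∫ x in Ω, Q.indicator Dv (x, t) i j * ψ x = ∫ x in Ω, Dv (x, t) i j * ψ x from ?_, ht]
      · congr 1; ext x
        by_cases hx : x ∈ Metric.ball x0 r
        · rw [indicator_of_mem (show (x, t) ∈ Q from ⟨hx, hm⟩)]
        · rw [image_eq_zero_of_notMem_tsupport (f := ψ) fun h => hx (h3 h)]; simp
      · congr 1; ext x
        by_cases hx : x ∈ Metric.ball x0 r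
        · rw [indicator_of_mem (show (x, t) ∈ Q from ⟨hx, hm⟩)]
        · have := image_eq_zero_of_notMem_tsupport (f := fun x => fderiv ℝ ψ x (bs i)) fun h => hx (h3 (ts_dd _ _ h)); simp only [this, mul_zero]
      · intro x hx; have h : (x, t) ∉ Q := fun h => hx (hB h.1)
        simp [h]
      · intro x hx; have h : (x, t) ∉ Q := fun h => hx (hB h.1)
        simp [h]
    · have : ∀ x, (x, t) ∉ Q := fun x h => hm h.2
      simp [this]
  have bd : ∀ {f g : E3 × ℝ → ℝ}, Integrable f → Sm g → HasCompactSupport g → Integrable fun z => f z * g z := by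
    intro f g hf hg hc
    obtain ⟨C, hC⟩ := cs_bdd hg.continuous hc
    exact hf.mul_bdd (c := C) hg.continuous.aestronglyMeasurable (ae_of_all _ hC)
  have iv' : ∀ k, Integrable fun z => Q.indicator v z k := fun k => (EuclideanSpace.proj (𝕜 := ℝ) k).integrable_comp iv
  have iD' : ∀ i j, Integrable fun z => Q.indicator Dv z i j := fun i j => (iD.eval i).eval j
  have hdiv : ∀ ψ : E3 × ℝ → ℝ, Sm ψ → HasCompactSupport ψ → tsupport ψ ⊆ Q → ∫ z, ∑ i, Q.indicator v z i * sdz ψ i z = 0 := by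
    intro ψ h1 h2 h3
    rw [← hs.div_free ψ h1 h2 (h3.trans hQ), ← setIntegral_eq_integral_of_forall_compl_eq_zero (s := Ω ×ˢ Ioo 0 T)]
    · congr 1; ext z
      by_cases h : z ∈ Q
      · simp [h]
      · have h' : z ∉ tsupport ψ := fun hh => h (h3 hh)
        simp [out_s h']
    · intro z hz; have h : z ∉ Q := fun h => hz (hQ h)
      simp [h]
  have hdiv' : ∀ ψ : E3 × ℝ → ℝ, Sm ψ → HasCompactSupport ψ → tsupport ψ ⊆ Q → ∑ i, ∫ z, Q.indicator v z i * sdz ψ i z = 0 := by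
    intro ψ h1 h2 h3
    rw [← integral_finsetSum _ fun i _ => bd (iv' i) (h1.sdz i) (cs_sdz h2 i)]; exact hdiv ψ h1 h2 h3
  refine ⟨hr, mv, mD, v0, D0, vM, D2, iv, iD, ivD, wg, ?_, ?_, ?_⟩
  · have hi : Integrable fun z => ∑ i, Q.indicator Dv z i i := integrable_finsetSum _ fun i _ => iD' i i
    have := (pcyl_open (x0, t0) r).ae_eq_zero_of_integral_contDiff_smul_eq_zero (μ := volume) (f := fun z => ∑ i, Q.indicator Dv z i i)
      (hi.locallyIntegrable.locallyIntegrableOn _) (fun ψ h1 h2 h3 => by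
        have h := hdiv' ψ h1 h2 h3
        simp_rw [wg_st iv iD wg h1 h2 (J := Ioo (t0 - r ^ 2) t0) h3] at h
        rw [Finset.sum_neg_distrib, neg_eq_zero] at h
        rw [← integral_finsetSum _ fun i _ => bd (iD' i i) h1 h2] at h
        rw [← h]; congr 1; ext z; rw [smul_eq_mul, Finset.mul_sum]; simp_rw [mul_comm])
    filter_upwards [this] with z hz
    by_cases h : z ∈ Q
    · exact hz h
    · simp [h]
  · intro Ψ h1 h2 h3 j k
    have e := hs.weak_nse (fun z => sdz Ψ j z • bs k - sdz Ψ k z • bs j)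
      (((h1.sdz j).smul contDiff_const).sub ((h1.sdz k).smul contDiff_const))
      (HasCompactSupport.intro h2 fun z hz => by simp [out_s hz]) ?_
    · have z0 : ∀ x, (x, (0:ℝ)) ∉ tsupport Ψ := fun x h => by have := (hQ (h3 h)).2; simp at this
      simp only [out_s (z0 _), zero_smul, sub_zero, PiLp.zero_apply, mul_zero, Finset.sum_const_zero, integral_zero] at e
      have hd : ∀ w : E3 × ℝ, ∀ z, fderiv ℝ (fun z => sdz Ψ j z • bs k - sdz Ψ k z • bs j) z w =
          fderiv ℝ (sdz Ψ j) z w • bs k - fderiv ℝ (sdz Ψ k) z w • bs j := by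
        intro w z
        have a := ((h1.sdz j).df z).hasFDerivAt.smul_const (bs k)
        have b := ((h1.sdz k).df z).hasFDerivAt.smul_const (bs j)
        rw [(a.fun_sub b).fderiv]; simp
      have hds : ∀ i z, sdz (fun z => sdz Ψ j z • bs k - sdz Ψ k z • bs j) i z = sdz (sdz Ψ j) i z • bs k - sdz (sdz Ψ k) i z • bs j := fun i z => hd _ z
      have hdt : ∀ z, tdz (fun z => sdz Ψ j z • bs k - sdz Ψ k z • bs j) z = tdz (sdz Ψ j) z • bs k - tdz (sdz Ψ k) z • bs j := fun z => hd _ z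
      simp only [hds, hdt] at e
      have e2 : ∫ z, ((-(Q.indicator v z k * tdz (sdz Ψ j) z) + ∑ l, Q.indicator Dv z l k * sdz (sdz Ψ j) l z)
        - (-(Q.indicator v z j * tdz (sdz Ψ k) z) + ∑ l, Q.indicator Dv z l j * sdz (sdz Ψ k) l z)
        + ∑ l, Q.indicator v z l * (Q.indicator Dv z l k * sdz Ψ j z - Q.indicator Dv z l j * sdz Ψ k z)) = 0 := by
        rw [← e, ← setIntegral_eq_integral_of_forall_compl_eq_zero (s := Ω ×ˢ Ioo 0 T)]
        · congr 1; ext z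
          by_cases h : z ∈ Q
          · have c := sdz_comm h1 j k z
            simp only [h, indicator_of_mem]
            exact (nse_alg (v z) (Dv z) (p z) _ _ _ _ _ _ j k c).symm
          · have h' : z ∉ tsupport Ψ := fun hh => h (h3 hh)
            have h'' : ∀ i, z ∉ tsupport (sdz Ψ i) := fun i hh => h' (ts_sdz _ _ hh)
            simp [out_s h', out_t (h'' _), out_s (h'' _)]
        · intro z hz; have h : z ∉ Q := fun h => hz (hQ h)
          simp [h]
      have hvd : ∀ l j k, Integrable fun z => Q.indicator v z l * Q.indicator Dv z l k * sdz Ψ j z := fun l j k =>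
        bd (ivD.mono' (((iv' l).aestronglyMeasurable).mul (iD' l k).aestronglyMeasurable) (ae_of_all _ fun z => by
          rw [norm_mul]; exact mul_le_mul (PiLp.norm_apply_le _ _) (D_le _ _ _) (norm_nonneg _) (norm_nonneg _))) (h1.sdz j) (cs_sdz h2 j)
      have hN : Integrable fun z => ∑ l, Q.indicator v z l * (Q.indicator Dv z l k * sdz Ψ j z - Q.indicator Dv z l j * sdz Ψ k z) :=
        integrable_finsetSum _ fun l _ => by simpa only [mul_sub, ← mul_assoc] using! (hvd l j k).sub (hvd l k j)
      have hI : ∀ j k, Integrable fun z => -(Q.indicator v z k * tdz (sdz Ψ j) z) + ∑ l, Q.indicator Dv z l k * sdz (sdz Ψ j) l z := fun j k =>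
        (bd (iv' k) (h1.sdz j).tdz (cs_tdz (cs_sdz h2 j))).neg.add
          (integrable_finsetSum _ fun l _ => bd (iD' l k) ((h1.sdz j).sdz l) (cs_sdz (cs_sdz h2 j) l))
      have hE := fun j k => L_exp iv iD wg h1 h2 (J := Ioo (t0 - r ^ 2) t0) h3 j k
      have hl : HasCompactSupport (lapz Ψ) := HasCompactSupport.intro h2 fun z hz => out_l hz
      have hA : ∀ j k, Integrable fun z => Q.indicator Dv z j k * (tdz Ψ z + lapz Ψ z) := fun j k => bd (iD' j k) (h1.tdz.add h1.lapz) ((cs_tdz h2).add hl)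
      have i1 : Integrable fun z => om (Q.indicator Dv) j k z * (tdz Ψ z + lapz Ψ z) := by
        simpa only [om, sub_mul] using! (hA j k).sub (hA k j)
      erw [integral_add ((hI j k).sub (hI k j)) hN, integral_sub (hI j k) (hI k j), hE, hE, ← integral_sub (hA j k) (hA k j)] at e2
      rw [integral_add i1 hN, ← e2]
      simp only [om, sub_mul]
    · intro z hz
      have : tsupport (fun z => sdz Ψ j z • bs k - sdz Ψ k z • bs j) ⊆ tsupport Ψ :=
        closure_minimal (fun z hz => by_contra fun h => hz (by simp [out_s h])) (isClosed_tsupport _)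
      have := hQ (h3 (this hz))
      exact ⟨this.1, this.2.2⟩
  · intro Ψ h1 h2 h3 i
    have c2 : ∀ j, HasCompactSupport (sdz Ψ j) := cs_sdz h2
    have hl : HasCompactSupport (lapz Ψ) := HasCompactSupport.intro h2 fun z hz => out_l hz
    have hω : ∀ j, Integrable fun z => om (Q.indicator Dv) j i z * sdz Ψ j z := fun j =>
      bd ((iD' j i).sub (iD' i j)) (h1.sdz j) (c2 j)
    rw [integral_add (bd (iv' i) h1.lapz hl) (integrable_finsetSum _ fun j _ => hω j), integral_finsetSum _ fun j _ => hω j]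
    have g := fun (φ : E3 × ℝ → ℝ) (a : Sm φ) (b : HasCompactSupport φ) (c : tsupport φ ⊆ tsupport Ψ) i j =>
      wg_st iv iD wg a b (J := Ioo (t0 - r ^ 2) t0) (c.trans h3) i j
    have e1 : ∀ j, ∫ z, om (Q.indicator Dv) j i z * sdz Ψ j z = -(∫ z, Q.indicator v z i * sdz (sdz Ψ j) j z) + ∫ z, Q.indicator v z j * sdz (sdz Ψ i) j z := by
      intro j
      rw [g _ (h1.sdz j) (c2 j) (ts_sdz _ _) j i]
      simp_rw [sdz_comm h1 i j]
      rw [g _ (h1.sdz j) (c2 j) (ts_sdz _ _) i j, neg_neg, ← sub_eq_add_neg, ← integral_sub (bd (iD' j i) (h1.sdz j) (c2 j)) (bd (iD' i j) (h1.sdz j) (c2 j))]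
      simp only [om, sub_mul]
    simp_rw [e1, Finset.sum_add_distrib, Finset.sum_neg_distrib]
    rw [hdiv' _ (h1.sdz i) (c2 i) ((ts_sdz _ _).trans h3), ← integral_finsetSum _ fun j _ => bd (iv' i) ((h1.sdz j).sdz j) (cs_sdz (c2 j) j)]
    simp [lapz, Finset.mul_sum]

end

section
open scoped Convolution Topology ContDiff
lemma fd_le (L : E3 →L[ℝ] ℝ) : ‖L‖ₑ ^ 2 ≤ ∑ i, ‖L (bs i)‖ₑ ^ 2 := by
  obtain ⟨w, hw⟩ : ∃ w : E3, ∀ x, L x = inner ℝ w x :=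
    ⟨(InnerProductSpace.toDual ℝ E3).symm L, fun x => by simp⟩
  have hn : ‖L‖ ≤ ‖w‖ := L.opNorm_le_bound (norm_nonneg _) fun x => by rw [hw]; exact norm_inner_le_norm _ _
  have h2 : ‖w‖ ^ 2 = ∑ i, ‖L (bs i)‖ ^ 2 := by
    rw [EuclideanSpace.norm_sq_eq]; refine Finset.sum_congr rfl fun i _ => ?_
    rw [hw]; simp [bs, EuclideanSpace.inner_single_right]
  have : ‖L‖ ^ 2 ≤ ∑ i, ‖L (bs i)‖ ^ 2 := by rw [← h2]; gcongr
  have h3 := ENNReal.ofReal_le_ofReal this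
  rw [ENNReal.ofReal_sum_of_nonneg (fun _ _ => sq_nonneg _)] at h3
  simp only [ENNReal.ofReal_pow (norm_nonneg _), ofReal_norm] at h3
  exact h3
lemma gns : ∃ C : ℝ, 0 ≤ C ∧ ∀ f : E3 → ℝ, Sm f → HasCompactSupport f →
    (∫⁻ x, ‖f x‖ₑ ^ 6) ^ (1/3 : ℝ) ≤ ENNReal.ofReal C * ∑ i, ∫⁻ x, ‖fderiv ℝ f x (bs i)‖ₑ ^ 2 := by
  refine ⟨(eLpNormLESNormFDerivOfEqInnerConst (volume : Measure E3) 2 : ℝ) ^ 2, by positivity, fun f hf hc => ?_⟩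
  have h := eLpNorm_le_eLpNorm_fderiv_of_eq_inner (volume : Measure E3) (u := f) (hf.of_le (by simp)) hc (p := 2) (p' := 6)
    (by norm_num) (by simp) (by simp; norm_num)
  rw [eLpNorm_eq_lintegral_rpow_enorm_toReal (by simp) (by simp), eLpNorm_eq_lintegral_rpow_enorm_toReal (by simp) (by simp)] at h
  simp only [ENNReal.coe_ofNat, ENNReal.toReal_ofNat] at h
  have h6 : ∀ a : ℝ≥0∞, a ^ (6:ℝ) = a ^ 6 := fun a => by rw [← ENNReal.rpow_natCast]; norm_num
  simp only [h6, ENNReal.rpow_two] at h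
  have h' := pow_le_pow_left' h 2
  rw [mul_pow, ← ENNReal.rpow_natCast, ← ENNReal.rpow_mul, ← ENNReal.rpow_natCast (_ ^ (1/2 : ℝ)), ← ENNReal.rpow_mul] at h'
  norm_num at h'
  refine (by norm_num; exact h' : _ ≤ _).trans ?_
  rw [ENNReal.ofReal_pow (by positivity), ENNReal.ofReal_coe_nnreal]
  gcongr
  rw [← lintegral_finsetSum]
  · exact lintegral_mono fun x => fd_le _
  · intro i _
    exact (hf.dd (bs i)).continuous.measurable.enorm.pow_const 2
lemma li_sq {F : Type*} [TopologicalSpace F] [MeasurableSpace F] [OpensMeasurableSpace F] {μ : Measure F} [IsFiniteMeasureOnCompacts μ] {f : F → ℝ}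
    (hf : Continuous f) (hc : HasCompactSupport f) : ∫⁻ x, ‖f x‖ₑ ^ 2 ∂μ = ENNReal.ofReal (∫ x, f x ^ 2 ∂μ) := by
  have hc2 : HasCompactSupport fun x => f x ^ 2 := hc.comp_left (g := fun u : ℝ => u ^ 2) (by simp)
  have hi : Integrable (fun x => f x ^ 2) μ := (hf.pow 2).integrable_of_hasCompactSupport hc2
  rw [ofReal_integral_eq_lintegral_ofReal hi (ae_of_all _ fun _ => sq_nonneg _)]
  refine lintegral_congr fun x => ?_
  rw [← ofReal_norm, ← ENNReal.ofReal_pow (norm_nonneg _), Real.norm_eq_abs, sq_abs]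
lemma ibpx {f g : E3 → ℝ} (hf : Sm f) (hcf : HasCompactSupport f) (hg : Sm g) (w : E3) :
    ∫ x, f x * fderiv ℝ g x w = - ∫ x, fderiv ℝ f x w * g x := by
  refine integral_mul_fderiv_eq_neg_fderiv_mul_of_integrable ?_ ?_ ?_ (fun x _ => hf.differentiable (by simp) x) (fun x _ => hg.differentiable (by simp) x)
  · exact ((hf.dd w).continuous.mul hg.continuous).integrable_of_hasCompactSupport ((cs_dd hcf w).mul_right)
  · exact (hf.continuous.mul (hg.dd w).continuous).integrable_of_hasCompactSupport (hcf.mul_right)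
  · exact (hf.continuous.mul hg.continuous).integrable_of_hasCompactSupport (hcf.mul_right)
lemma dcid {V : Fin 3 → E3 → ℝ} (h : ∀ j, Sm (V j)) (hc : ∀ j, HasCompactSupport (V j)) (i j : Fin 3) :
    ∫⁻ x, ‖fderiv ℝ (V j) x (bs i)‖ₑ ^ 2 ≤
      (∑ i, ∑ j, ∫⁻ x, ‖fderiv ℝ (V j) x (bs i) - fderiv ℝ (V i) x (bs j)‖ₑ ^ 2) + ∫⁻ x, ‖∑ i, fderiv ℝ (V i) x (bs i)‖ₑ ^ 2 := by
  have sW : ∀ i j, Sm fun x => fderiv ℝ (V j) x (bs i) := fun i j => (h j).dd _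
  have cW : ∀ i j, HasCompactSupport fun x => fderiv ℝ (V j) x (bs i) := fun i j => cs_dd (hc j) _
  set W : Fin 3 → Fin 3 → E3 → ℝ := fun i j x => fderiv ℝ (V j) x (bs i) with hW
  have sum3 : ∀ f : Fin 3 → E3 → ℝ, (∀ i, HasCompactSupport (f i)) → HasCompactSupport fun x => ∑ i, f i x := by
    intro f hf; simp only [Fin.sum_univ_three]; exact ((hf 0).add (hf 1)).add (hf 2)
  have e1 : ∀ i j, ∫ x, W i j x * W j i x = ∫ x, W i i x * W j j x := by
    intro i j
    have a := ibpx (sW i j) (cW i j) (h i) (bs j)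
    have b := ibpx (sW j j) (cW j j) (h i) (bs i)
    have c : ∀ x, fderiv ℝ (fun x => fderiv ℝ (V j) x (bs i)) x (bs j) = fderiv ℝ (fun x => fderiv ℝ (V j) x (bs j)) x (bs i) :=
      fun x => dd_comm (h j) _ _ x
    simp only [c] at a
    rw [← b] at a
    simp only [hW]; rw [a]; exact integral_congr_ae (ae_of_all _ fun x => mul_comm _ _)
  have ii : ∀ i j k l, Integrable fun x => W i j x * W k l x := fun i j k l =>
    ((sW i j).continuous.mul (sW k l).continuous).integrable_of_hasCompactSupport ((cW i j).mul_right)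
  have key : ∑ i, ∑ j, ∫ x, W i j x ^ 2 ≤ (∑ i, ∑ j, ∫ x, (W i j x - W j i x) ^ 2) + ∫ x, (∑ i, W i i x) ^ 2 := by
    have i2 : ∀ i j, Integrable fun x => W i j x ^ 2 := fun i j => by simpa only [sq] using ii i j i j
    have k1 : ∀ i j, ∫ x, (W i j x - W j i x) ^ 2 = (∫ x, W i j x ^ 2) + (∫ x, W j i x ^ 2) - 2 * ∫ x, W i i x * W j j x := by
      intro i j
      have i3 : Integrable fun x => W i j x ^ 2 + W j i x ^ 2 := (i2 i j).add (i2 j i)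
      rw [← e1, ← integral_const_mul, ← integral_add (i2 _ _) (i2 _ _), ← integral_sub i3 ((ii _ _ _ _).const_mul _)]
      congr 1; funext x; ring
    have k2 : ∫ x, (∑ i, W i i x) ^ 2 = ∑ i, ∑ j, ∫ x, W i i x * W j j x := by
      rw [Finset.sum_congr rfl fun i _ => (integral_finsetSum Finset.univ fun j _ => ii i i j j).symm,
        ← integral_finsetSum _ fun i _ => integrable_finsetSum _ fun j _ => ii i i j j]
      congr 1; funext x
      rw [sq, Finset.sum_mul_sum]
    rw [k2]
    simp only [k1]
    have nn : 0 ≤ ∑ i, ∑ j, ∫ x, (W i j x - W j i x) ^ 2 := Finset.sum_nonneg fun i _ => Finset.sum_nonneg fun j _ => integral_nonneg fun x => sq_nonneg _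
    simp only [k1] at nn
    simp only [Fin.sum_univ_three] at nn ⊢
    linarith
  have c1 : ∀ i j, Continuous (W i j) := fun i j => (sW i j).continuous
  change ∫⁻ x, ‖W i j x‖ₑ ^ 2 ≤ (∑ i, ∑ j, ∫⁻ x, ‖W i j x - W j i x‖ₑ ^ 2) + ∫⁻ x, ‖∑ i, W i i x‖ₑ ^ 2
  rw [li_sq (c1 i j) (cW i j), li_sq (continuous_finsetSum _ fun i _ => c1 i i) (sum3 _ fun i => cW i i)]
  have q : ∀ i j, ∫⁻ x, ‖W i j x - W j i x‖ₑ ^ 2 = ENNReal.ofReal (∫ x, (W i j x - W j i x) ^ 2) := fun i j =>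
    li_sq ((c1 i j).sub (c1 j i)) ((cW i j).sub (cW j i))
  simp_rw [q]
  have n1 : ∀ f : E3 → ℝ, 0 ≤ ∫ x, f x ^ 2 := fun f => integral_nonneg fun x => sq_nonneg _
  simp_rw [← ENNReal.ofReal_sum_of_nonneg fun (j : Fin 3) (_ : j ∈ Finset.univ) => n1 fun x => W _ j x - W j _ x]
  rw [← ENNReal.ofReal_sum_of_nonneg fun i _ => Finset.sum_nonneg fun j _ => n1 _, ← ENNReal.ofReal_add
    (Finset.sum_nonneg fun i _ => Finset.sum_nonneg fun j _ => n1 _) (n1 _)]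
  refine ENNReal.ofReal_le_ofReal (le_trans ?_ key)
  refine le_trans ?_ (Finset.single_le_sum (f := fun i => ∑ j, ∫ x, (W i j x) ^ 2) (fun i _ => Finset.sum_nonneg fun j _ => n1 _) (Finset.mem_univ i))
  exact Finset.single_le_sum (f := fun j => ∫ x, (W i j x) ^ 2) (fun j _ => n1 _) (Finset.mem_univ j)
lemma moll (F : Type*) [NormedAddCommGroup F] [NormedSpace ℝ F] [HasContDiffBump F] [MeasurableSpace F] [BorelSpace F] [FiniteDimensional ℝ F]
    (μ : Measure F) [μ.IsAddHaarMeasure] :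
    ∃ η : ℕ → F → ℝ, (∀ n, Sm (η n)) ∧ (∀ n, HasCompactSupport (η n)) ∧ (∀ n x, 0 ≤ η n x) ∧ (∀ n, ∫ x, η n x ∂μ = 1) ∧
      (∀ (n : ℕ) x, 1 / ((n:ℝ) + 1) ≤ ‖x‖ → η n x = 0) ∧
      ∀ f : F → ℝ, Integrable f μ → ∀ᵐ x ∂μ, Tendsto (fun n => ∫ y, η n (x - y) * f y ∂μ) atTop (𝓝 (f x)) := by
  let φ : ℕ → ContDiffBump (0 : F) := fun n => ⟨1 / (2 * ((n:ℝ) + 1)), 1 / ((n:ℝ) + 1), by positivity, by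
    apply one_div_lt_one_div_of_lt <;> linarith [(Nat.cast_nonneg n : (0:ℝ) ≤ n)]⟩
  refine ⟨fun n => (φ n).normed μ, fun n => (φ n).contDiff_normed, fun n => (φ n).hasCompactSupport_normed, fun n x => (φ n).nonneg_normed x,
    fun n => (φ n).integral_normed, fun n x hx => ?_, fun f hf => ?_⟩
  · have : x ∉ Function.support ((φ n).normed μ) := by
      rw [ContDiffBump.support_normed_eq]; have hx' : (φ n).rOut ≤ ‖x‖ := hx; simpa using hx'
    simpa using this
  · have h1 : Tendsto (fun n => (φ n).rOut) atTop (𝓝 0) := tendsto_one_div_add_atTop_nhds_zero_nat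
    have h2 : ∀ᶠ n in atTop, (φ n).rOut ≤ 2 * (φ n).rIn := Eventually.of_forall fun n => by
      change 1 / ((n:ℝ) + 1) ≤ 2 * (1 / (2 * ((n:ℝ) + 1)))
      apply le_of_eq; field_simp
    filter_upwards [ContDiffBump.ae_convolution_tendsto_right_of_locallyIntegrable h1 h2 hf.locallyIntegrable] with x hx
    refine hx.congr fun n => ?_
    rw [convolution_eq_swap]; simp
lemma cv_l2 {η f : E3 → ℝ} (hη : Continuous η) (h0 : ∀ x, 0 ≤ η x) (h1 : ∫ x, η x = 1) (hf : AEStronglyMeasurable f) :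
    ∫⁻ x, ‖∫ y, η (x - y) * f y‖ₑ ^ 2 ≤ ∫⁻ x, ‖f x‖ₑ ^ 2 := by
  obtain ⟨f', hm, he⟩ := hf
  have hm := hm.measurable
  have e0 : ∀ x, ∫ y, η (x - y) * f y = ∫ y, η (x - y) * f' y := fun x => integral_congr_ae (by filter_upwards [he] with y hy; rw [hy])
  have e1 : ∫⁻ x, ‖f x‖ₑ ^ 2 = ∫⁻ x, ‖f' x‖ₑ ^ 2 := lintegral_congr_ae (by filter_upwards [he] with y hy; rw [hy])
  simp_rw [e0, e1]
  have hηm := hη.measurable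
  have hi : Integrable η := by by_contra h; simp [integral_undef h] at h1
  have hL : ∫⁻ x, ‖η x‖ₑ = 1 := by
    have := ofReal_integral_eq_lintegral_ofReal hi (ae_of_all _ h0)
    rw [h1, ENNReal.ofReal_one] at this
    rw [this]; exact lintegral_congr fun x => Real.enorm_of_nonneg (h0 x)
  have hs : ∀ x, ∫⁻ y, ‖η (x - y)‖ₑ = 1 := fun x => by rw [lintegral_sub_left_eq_self (fun y => ‖η y‖ₑ) x, hL]
  have hs' : ∀ y, ∫⁻ x, ‖η (x - y)‖ₑ = 1 := fun x => by rw [lintegral_sub_right_eq_self (fun y => ‖η y‖ₑ) x, hL]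
  calc _ ≤ ∫⁻ x, ∫⁻ y, ‖η (x - y)‖ₑ * ‖f' y‖ₑ ^ 2 := by
        refine lintegral_mono fun x => ?_
        have a : ‖∫ y, η (x - y) * f' y‖ₑ ≤ ∫⁻ y, ‖η (x - y)‖ₑ * ‖f' y‖ₑ := (enorm_integral_le_lintegral_enorm _).trans (by simp [enorm_mul])
        have b := cs_lint (μ := volume.withDensity fun y => ‖η (x - y)‖ₑ) (f := fun _ => 1) (g := fun y => ‖f' y‖ₑ) aemeasurable_const hm.enorm.aemeasurable
        have mx : Measurable fun y => ‖η (x - y)‖ₑ := (hηm.comp (measurable_const.sub measurable_id)).enorm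
        rw [lintegral_withDensity_eq_lintegral_mul _ mx (by fun_prop), lintegral_withDensity_eq_lintegral_mul _ mx (by fun_prop),
          lintegral_withDensity_eq_lintegral_mul _ mx (hm.enorm.pow_const 2)] at b
        simp only [Pi.mul_apply, one_mul, one_pow, mul_one, hs] at b
        exact (pow_le_pow_left' a 2).trans b
    _ = ∫⁻ x, ‖f' x‖ₑ ^ 2 := by
        have mm : Measurable fun p : E3 × E3 => ‖η (p.1 - p.2)‖ₑ * ‖f' p.2‖ₑ ^ 2 :=
          (hηm.comp (measurable_fst.sub measurable_snd)).enorm.mul ((hm.comp measurable_snd).enorm.pow_const 2)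
        rw [lintegral_lintegral_swap mm.aemeasurable]
        refine lintegral_congr fun y => ?_
        have mx : Measurable fun x => ‖η (x - y)‖ₑ := (hηm.comp (measurable_id.sub_const y)).enorm
        rw [lintegral_mul_const _ mx, hs', one_mul]
lemma fatou_pow {F : Type*} [MeasurableSpace F] {μ : Measure F} {f : F → ℝ} {u : ℕ → F → ℝ} (hu : ∀ n, AEMeasurable (u n) μ)
    (h : ∀ᵐ x ∂μ, Tendsto (fun n => u n x) atTop (𝓝 (f x))) (p : ℕ) {K : ℝ≥0∞} (hK : ∀ n, ∫⁻ x, ‖u n x‖ₑ ^ p ∂μ ≤ K) :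
    ∫⁻ x, ‖f x‖ₑ ^ p ∂μ ≤ K := by
  calc _ = ∫⁻ x, liminf (fun n => ‖u n x‖ₑ ^ p) atTop ∂μ := by
        refine lintegral_congr_ae ?_
        filter_upwards [h] with x hx
        exact (((ENNReal.continuous_pow p).tendsto _).comp hx.enorm).liminf_eq.symm
    _ ≤ liminf (fun n => ∫⁻ x, ‖u n x‖ₑ ^ p ∂μ) atTop := lintegral_liminf_le' fun n => (hu n).enorm.pow_const _
    _ ≤ K := (liminf_le_liminf (Eventually.of_forall hK)).trans (by simp)
lemma statc : ∃ C : ℝ, 0 ≤ C ∧ ∀ {η : ℕ → E3 → ℝ} (_ : ∀ n, Sm (η n)) (_ : ∀ n, HasCompactSupport (η n)) (_ : ∀ n x, 0 ≤ η n x)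
    (_ : ∀ n, ∫ x, η n x = 1)
    (_ : ∀ f : E3 → ℝ, Integrable f → ∀ᵐ x, Tendsto (fun n => ∫ y, η n (x - y) * f y) atTop (𝓝 (f x)))
    {U : Fin 3 → E3 → ℝ} {E : Fin 3 → Fin 3 → E3 → ℝ} (_ : ∀ j, Integrable (U j)) (_ : ∀ j, HasCompactSupport (U j)) (_ : ∀ i j, Integrable (E i j))
    (_ : ∀ n i j x, ∫ y, U j y * fderiv ℝ (η n) (x - y) (bs i) = ∫ y, E i j y * η n (x - y)) (i j : Fin 3),
    (∫⁻ x, ‖E i j x‖ₑ ^ 2 ≤ (∑ i, ∑ j, ∫⁻ x, ‖E i j x - E j i x‖ₑ ^ 2) + ∫⁻ x, ‖∑ i, E i i x‖ₑ ^ 2) ∧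
    ((∫⁻ x, ‖U j x‖ₑ ^ 6) ^ (1/3 : ℝ) ≤ ENNReal.ofReal C * ((∑ i, ∑ j, ∫⁻ x, ‖E i j x - E j i x‖ₑ ^ 2) + ∫⁻ x, ‖∑ i, E i i x‖ₑ ^ 2)) := by
  obtain ⟨C, hC, hg⟩ := gns
  refine ⟨C * 3, by positivity, fun {η} s1 s2 s3 s4 s5 {U E} iU cU iE hyp i j => ?_⟩
  set R := (∑ i, ∑ j, ∫⁻ x, ‖E i j x - E j i x‖ₑ ^ 2) + ∫⁻ x, ‖∑ i, E i i x‖ₑ ^ 2 with hR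
  let V : ℕ → Fin 3 → E3 → ℝ := fun n j => η n ⋆[ContinuousLinearMap.lsmul ℝ ℝ, volume] U j
  have Ve : ∀ n j x, V n j x = ∫ y, η n (x - y) * U j y := fun n j x => by simp only [V]; rw [convolution_eq_swap]; simp
  have sV : ∀ n j, Sm (V n j) := fun n j => (s2 n).contDiff_convolution_left _ (s1 n) (iU j).locallyIntegrable
  have cV : ∀ n j, HasCompactSupport (V n j) := fun n j => (s2 n).convolution _ (cU j)
  have dV : ∀ n i j x, fderiv ℝ (V n j) x (bs i) = ∫ y, η n (x - y) * E i j y := by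
    intro n i j x
    rw [((s2 n).hasFDerivAt_convolution_left _ ((s1 n).of_le (by simp)) (iU j).locallyIntegrable x).fderiv]
    rw [convolution_eq_swap, ContinuousLinearMap.integral_apply]
    · simp only [ContinuousLinearMap.precompL_apply, ContinuousLinearMap.lsmul_apply, smul_eq_mul]
      rw [integral_congr_ae (ae_of_all _ fun y => mul_comm (η n (x - y)) (E i j y)), ← hyp]
      exact integral_congr_ae (ae_of_all _ fun y => mul_comm _ _)
    · have := ((s2 n).fderiv (𝕜 := ℝ)).convolutionExists_left (ContinuousLinearMap.precompL E3 (ContinuousLinearMap.lsmul ℝ ℝ)) ((s1 n).continuous_fderiv (by simp)) (iU j).locallyIntegrable x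
      exact (convolutionExistsAt_iff_integrable_swap.1 this)
  have iη : ∀ n x i j, Integrable fun y => η n (x - y) * E i j y := by
    intro n x i j
    have := ((s2 n)).convolutionExists_left (ContinuousLinearMap.lsmul ℝ ℝ) ((s1 n).continuous) (iE i j).locallyIntegrable x
    exact (convolutionExistsAt_iff_integrable_swap.1 this)
  have hVR : ∀ n i j, ∫⁻ x, ‖fderiv ℝ (V n j) x (bs i)‖ₑ ^ 2 ≤ R := by
    intro n i j
    refine (dcid (sV n) (cV n) i j).trans ?_
    simp only [dV]
    have a1 : ∀ i j x, (∫ y, η n (x - y) * E i j y) - (∫ y, η n (x - y) * E j i y) = ∫ y, η n (x - y) * (E i j y - E j i y) := by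
      intro i j x; rw [← integral_sub (iη _ _ _ _) (iη _ _ _ _)]; congr 1; funext y; ring
    have a2 : ∀ x, ∑ i, (∫ y, η n (x - y) * E i i y) = ∫ y, η n (x - y) * ∑ i, E i i y := by
      intro x; rw [← integral_finsetSum _ fun i _ => iη _ _ _ _]; congr 1; funext y; rw [Finset.mul_sum]
    simp only [a1, a2, hR]
    refine add_le_add (Finset.sum_le_sum fun i _ => Finset.sum_le_sum fun j _ => ?_) ?_
    · exact cv_l2 (s1 n).continuous (s3 n) (s4 n) ((iE i j).sub (iE j i)).aestronglyMeasurable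
    · exact cv_l2 (s1 n).continuous (s3 n) (s4 n) (integrable_finsetSum _ fun i _ => iE i i).aestronglyMeasurable
  constructor
  · refine fatou_pow (u := fun n x => fderiv ℝ (V n j) x (bs i)) (fun n => ((sV n j).dd _).continuous.measurable.aemeasurable) ?_ 2 fun n => hVR n i j
    simp only [dV]; exact s5 _ (iE i j)
  · have h6 : ∀ n, ∫⁻ x, ‖V n j x‖ₑ ^ 6 ≤ (ENNReal.ofReal (C * 3) * R) ^ 3 := by
      intro n
      have := (hg _ (sV n j) (cV n j)).trans (mul_le_mul_right (Finset.sum_le_sum fun i (_ : i ∈ Finset.univ) => hVR n i j) _)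
      simp only [Finset.sum_const, Finset.card_univ, Fintype.card_fin] at this
      have t := pow_le_pow_left' this 3
      rw [← ENNReal.rpow_natCast, ← ENNReal.rpow_mul] at t
      norm_num at t
      refine t.trans (le_of_eq ?_)
      rw [ENNReal.ofReal_mul hC, mul_assoc]; norm_num
    have := fatou_pow (fun n => (sV n j).continuous.measurable.aemeasurable) (by simp only [Ve]; exact s5 _ (iU j)) 6 h6
    calc _ ≤ ((ENNReal.ofReal (C * 3) * R) ^ 3) ^ (1/3 : ℝ) := by gcongr
      _ = _ := by rw [← ENNReal.rpow_natCast, ← ENNReal.rpow_mul]; norm_num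

end

section
lemma ae_sl {p : E3 × ℝ → Prop} (h : ∀ᵐ z : E3 × ℝ, p z) : ∀ᵐ t : ℝ, ∀ᵐ x : E3, p (x, t) := by
  have := (Measure.measurePreserving_swap (μ := (volume : Measure ℝ)) (ν := (volume : Measure E3))).quasiMeasurePreserving.ae h
  exact Measure.ae_ae_of_ae_prod this
lemma sq2 (a b : ℝ≥0∞) : (a + b) ^ 2 ≤ 2 * (a ^ 2 + b ^ 2) := by
  have := ENNReal.inner_le_Lp_mul_Lq (s := Finset.univ) (fun i : Fin 2 => if i = 0 then a else b) (fun _ => 1) (p := 2) (q := 2) ⟨by norm_num, by norm_num, by norm_num⟩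
  simp at this
  have t := pow_le_pow_left' this 2
  have e : ∀ a : ℝ≥0∞, (a ^ (2⁻¹ : ℝ)) ^ 2 = a := fun a => by rw [← ENNReal.rpow_natCast, ← ENNReal.rpow_mul]; norm_num
  rwa [mul_pow, e, e, mul_comm] at t
lemma p6 (a b c K : ℝ≥0∞) (h1 : a ≤ K) (h2 : b ≤ K) (h3 : c ≤ K) : (a + b + c) ≤ 3 * K := by
  calc _ ≤ K + K + K := by gcongr
    _ = _ := by ring
lemma v_le_sum (w : E3) : ‖w‖ₑ ≤ ‖w 0‖ₑ + ‖w 1‖ₑ + ‖w 2‖ₑ := by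
  have h : w = w 0 • bs 0 + w 1 • bs 1 + w 2 • bs 2 := by
    ext i; fin_cases i <;> simp [bs]
  have hb : ∀ i, ‖bs i‖ₑ = 1 := fun i => by rw [← ofReal_norm]; simp [bs]
  calc ‖w‖ₑ = ‖w 0 • bs 0 + w 1 • bs 1 + w 2 • bs 2‖ₑ := by rw [← h]
    _ ≤ ‖w 0 • bs 0‖ₑ + ‖w 1 • bs 1‖ₑ + ‖w 2 • bs 2‖ₑ := (enorm_add_le _ _).trans (by gcongr; exact enorm_add_le _ _)
    _ = _ := by simp only [enorm_smul, hb, mul_one]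
lemma p66 (a b c : ℝ≥0∞) : (a + b + c) ^ 6 ≤ 3 ^ 6 * (a ^ 6 + b ^ 6 + c ^ 6) := by
  have h1 : (a + b + c) ^ 6 ≤ (3 * max a (max b c)) ^ 6 := by
    gcongr; exact p6 _ _ _ _ (by simp) (by simp) (by simp)
  refine h1.trans ?_
  rw [mul_pow]; gcongr
  rcases max_choice a (max b c) with h | h <;> rw [h]
  · rw [add_assoc]; exact le_self_add
  · rcases max_choice b c with h | h <;> rw [h]
    · rw [add_assoc]; exact le_add_left le_self_add
    · exact le_add_self
lemma vc_le (w : E3) (j) : ‖w j‖ₑ ≤ ‖w‖ₑ := by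
  rw [← ofReal_norm, ← ofReal_norm]; exact ENNReal.ofReal_le_ofReal (PiLp.norm_apply_le w j)
lemma Dc_le (M : Fin 3 → Fin 3 → ℝ) (i j) : ‖M i j‖ₑ ≤ ‖M‖ₑ := by
  rw [← ofReal_norm, ← ofReal_norm]; exact ENNReal.ofReal_le_ofReal (D_le M i j)
lemma D_sumE (M : Fin 3 → Fin 3 → ℝ) : ‖M‖ₑ ^ 2 ≤ ∑ i, ∑ j, ‖M i j‖ₑ ^ 2 := by
  have h := ENNReal.ofReal_le_ofReal (D_le_sum M)
  rw [ENNReal.ofReal_sum_of_nonneg (fun i _ => Finset.sum_nonneg fun j _ => sq_nonneg _), ENNReal.ofReal_pow (norm_nonneg _), ofReal_norm] at h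
  refine h.trans (le_of_eq (Finset.sum_congr rfl fun i _ => ?_))
  rw [ENNReal.ofReal_sum_of_nonneg (fun i _ => sq_nonneg _)]
  refine Finset.sum_congr rfl fun j _ => ?_
  rw [← sq_abs, ENNReal.ofReal_pow (abs_nonneg _), ← Real.norm_eq_abs, ofReal_norm]
def OM (χ : E3 → ℝ) (D : E3 × ℝ → Fin 3 → Fin 3 → ℝ) (t : ℝ) : ℝ≥0∞ := ∑ j, ∑ k, ∫⁻ x, ‖χ x * om D j k (x, t)‖ₑ ^ 2
set_option maxHeartbeats 1000000 in
lemma Loc.H5 {x0 t0 r v D} (L : Loc x0 t0 r v D) {χ : E3 → ℝ} (h1 : Sm χ) (h2 : HasCompactSupport χ) (h3 : tsupport χ ⊆ Metric.ball x0 r) :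
    ∃ C : ℝ, 0 ≤ C ∧ ∀ᵐ t : ℝ, (∫⁻ x, (‖χ x‖ₑ * ‖v (x, t)‖ₑ) ^ 6) ^ (1/3 : ℝ) ≤ ENNReal.ofReal C * (OM χ D t + 1) ∧
      ∫⁻ x, (‖χ x‖ₑ * ‖D (x, t)‖ₑ) ^ 2 ≤ ENNReal.ofReal C * (OM χ D t + 1) := by
  obtain ⟨η, s1, s2, s3, s4, -, s5⟩ := moll E3 volume
  obtain ⟨C0, hC0, hst⟩ := statc
  obtain ⟨M, hM, hvM⟩ := L.vM
  have hb : ∃ K : ℝ, 0 ≤ K ∧ (∀ x, |χ x| ≤ K) ∧ ∀ i x, |fderiv ℝ χ x (bs i)| ≤ K := by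
    obtain ⟨K0, q0⟩ := cs_bdd h1.continuous h2
    choose K1 q1 using fun i => cs_bdd (h1.dd (bs i)).continuous (cs_dd h2 (bs i))
    have n0 := (abs_nonneg _).trans (q0 0)
    have n1 := fun i => (abs_nonneg _).trans (q1 i 0)
    refine ⟨K0 + ∑ i, K1 i, by have := Finset.sum_nonneg fun i (_ : i ∈ Finset.univ) => n1 i; linarith, fun x => (q0 x).trans ?_, fun i x => (q1 i x).trans ?_⟩
    · have := Finset.sum_nonneg fun i (_ : i ∈ Finset.univ) => n1 i
      linarith
    · have := Finset.single_le_sum (fun i _ => n1 i) (Finset.mem_univ i); linarith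
  obtain ⟨K, hK, k0, k1⟩ := hb
  have hder : ∀ n i x y, fderiv ℝ (fun y => η n (x - y) * χ y) y (bs i) = -fderiv ℝ (η n) (x - y) (bs i) * χ y + η n (x - y) * fderiv ℝ χ y (bs i) := by
    intro n i x y
    have sx : Sm fun y => η n (x - y) := (s1 n).comp (contDiff_const.sub contDiff_id)
    rw [dd_mul sx h1]
    congr 2
    have := (((s1 n).differentiable (by simp) (x - y)).hasFDerivAt.comp y ((hasFDerivAt_const x y).sub (hasFDerivAt_id y))).fderiv
    simp only [Function.comp_def] at this
    exact (congrArg (fun L : E3 →L[ℝ] ℝ => L (bs i)) this).trans (by simp)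
  have hyp0 : ∀ n i j, ∀ᵐ t : ℝ, ∀ x, ∫ y, v (y, t) j * fderiv ℝ (fun y => η n (x - y) * χ y) y (bs i) = - ∫ y, D (y, t) i j * (η n (x - y) * χ y) := by
    intro n i j
    obtain ⟨A, hA⟩ := cs_bdd (s1 n).continuous (s2 n)
    obtain ⟨B, hB⟩ := cs_bdd ((s1 n).dd (bs i)).continuous (cs_dd (s2 n) (bs i))
    have A0 := (abs_nonneg _).trans (hA 0)
    have B0 := (abs_nonneg _).trans (hB 0)
    have sx : ∀ x, Sm fun y => η n (x - y) := fun x => (s1 n).comp (contDiff_const.sub contDiff_id)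
    have c3 := ((s1 n).dd (bs i)).continuous
    have c4 := (s1 n).continuous
    refine L4 (P := E3) (u := v) (D := D) (ψ := fun x y => η n (x - y) * χ y) L.iv.prod_left_ae L.iD.prod_left_ae L.wg (fun x => (sx x).mul h1)
      (fun x => h2.mul_left) (fun x => (tsupport_mul_subset_right).trans h3) i j (fun y => ?_) (fun y => ?_) (C := B * K + A * K) (fun x y => ?_) fun x y => ?_
    · exact (c4.comp (continuous_id.sub continuous_const)).mul continuous_const
    · simp only [hder n i]
      exact (((c3.comp (continuous_id.sub continuous_const)).neg.mul continuous_const).add ((c4.comp (continuous_id.sub continuous_const)).mul continuous_const))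
    · rw [abs_mul]; exact (mul_le_mul (hA _) (k0 _) (abs_nonneg _) A0).trans (by have := mul_nonneg B0 hK; linarith)
    · rw [hder]
      refine (abs_add_le _ _).trans ?_
      rw [abs_mul, abs_mul, abs_neg]
      exact add_le_add (mul_le_mul (hB _) (k0 _) (abs_nonneg _) B0) (mul_le_mul (hA _) (k1 _ _) (abs_nonneg _) A0)
  have hyp1 : ∀ᵐ t : ℝ, ∀ n i j x, ∫ y, v (y, t) j * fderiv ℝ (fun y => η n (x - y) * χ y) y (bs i) = - ∫ y, D (y, t) i j * (η n (x - y) * χ y) := by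
    simp only [ae_all_iff]; intro n i j; exact hyp0 n i j
  refine ⟨(27 * C0 + 18) * (2 + 81 * K ^ 2 * M) + 18 * (K ^ 2 * M), by positivity, ?_⟩
  filter_upwards [hyp1, L.iv.prod_left_ae, L.iD.prod_left_ae, hvM, ae_sl L.tr] with t ht ivt iDt hMt trt
  have iv1 : ∀ j, Integrable fun y => v (y, t) j := fun j => (EuclideanSpace.proj (𝕜 := ℝ) j).integrable_comp ivt
  have iD1 : ∀ i j, Integrable fun y => D (y, t) i j := fun i j => (iDt.eval i).eval j
  have mχ := h1.continuous.measurable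
  have mdχ := fun i => (h1.dd (bs i)).continuous
  have iU : ∀ j, Integrable fun y => χ y * v (y, t) j := fun j => (iv1 j).bdd_mul (c := K) h1.continuous.aestronglyMeasurable (ae_of_all _ k0)
  have iE1 : ∀ i j, Integrable fun y => fderiv ℝ χ y (bs i) * v (y, t) j := fun i j => (iv1 j).bdd_mul (c := K) (mdχ i).aestronglyMeasurable (ae_of_all _ (k1 i))
  have iE2 : ∀ i j, Integrable fun y => χ y * D (y, t) i j := fun i j => (iD1 i j).bdd_mul (c := K) h1.continuous.aestronglyMeasurable (ae_of_all _ k0)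
  have hs := @hst η s1 s2 s3 s4 s5 (fun j y => χ y * v (y, t) j) (fun i j y => fderiv ℝ χ y (bs i) * v (y, t) j + χ y * D (y, t) i j) iU
    (fun j => h2.mul_right) (fun i j => (iE1 i j).add (iE2 i j)) (fun n i j x => by
      obtain ⟨A, hA⟩ := cs_bdd (s1 n).continuous (s2 n)
      obtain ⟨B, hB⟩ := cs_bdd ((s1 n).dd (bs i)).continuous (cs_dd (s2 n) (bs i))
      have cx : Continuous fun y => x - y := continuous_const.sub continuous_id
      have j1 : Integrable fun y => χ y * v (y, t) j * fderiv ℝ (η n) (x - y) (bs i) :=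
        (iU j).mul_bdd (c := B) (((s1 n).dd (bs i)).continuous.comp cx).aestronglyMeasurable (ae_of_all _ fun y => hB _)
      have j2 : Integrable fun y => fderiv ℝ χ y (bs i) * v (y, t) j * η n (x - y) :=
        (iE1 i j).mul_bdd (c := A) ((s1 n).continuous.comp cx).aestronglyMeasurable (ae_of_all _ fun y => hA _)
      have j3 : Integrable fun y => χ y * D (y, t) i j * η n (x - y) :=
        (iE2 i j).mul_bdd (c := A) ((s1 n).continuous.comp cx).aestronglyMeasurable (ae_of_all _ fun y => hA _)
      have hh := ht n i j x
      simp only [hder] at hh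
      have e1 : ∫ y, v (y, t) j * (-fderiv ℝ (η n) (x - y) (bs i) * χ y + η n (x - y) * fderiv ℝ χ y (bs i)) =
          (∫ y, fderiv ℝ χ y (bs i) * v (y, t) j * η n (x - y)) - ∫ y, χ y * v (y, t) j * fderiv ℝ (η n) (x - y) (bs i) := by
        rw [← integral_sub j2 j1]; congr 1; funext y; ring
      have e2 : ∫ y, D (y, t) i j * (η n (x - y) * χ y) = ∫ y, χ y * D (y, t) i j * η n (x - y) := by congr 1; funext y; ring
      have e3 : ∫ y, (fderiv ℝ χ y (bs i) * v (y, t) j + χ y * D (y, t) i j) * η n (x - y) = (∫ y, fderiv ℝ χ y (bs i) * v (y, t) j * η n (x - y)) +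
          ∫ y, χ y * D (y, t) i j * η n (x - y) := by
        rw [← integral_add j2 j3]; congr 1; funext y; ring
      rw [e1, e2] at hh
      rw [e3]; linarith)
  have mv' : Measurable fun x => v (x, t) := L.mv.comp (measurable_id.prodMk measurable_const)
  have mD' : Measurable fun x => D (x, t) := L.mD.comp (measurable_id.prodMk measurable_const)
  have mDc : ∀ i j, Measurable fun x => D (x, t) i j := fun i j => (measurable_pi_apply j).comp ((measurable_pi_apply i).comp mD')
  have mvc : ∀ j, Measurable fun x => v (x, t) j := fun j => (EuclideanSpace.proj (𝕜 := ℝ) j).continuous.measurable.comp mv'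
  set E : Fin 3 → Fin 3 → E3 → ℝ := fun i j y => fderiv ℝ χ y (bs i) * v (y, t) j + χ y * D (y, t) i j with hE
  set R := (∑ i, ∑ j, ∫⁻ x, ‖E i j x - E j i x‖ₑ ^ 2) + ∫⁻ x, ‖∑ i, E i i x‖ₑ ^ 2 with hR
  have dv : ∀ i j x, ‖fderiv ℝ χ x (bs i) * v (x, t) j‖ₑ ≤ ENNReal.ofReal K * ‖v (x, t)‖ₑ := by
    intro i j x; rw [enorm_mul]
    refine mul_le_mul' ?_ (vc_le _ _)
    rw [← ofReal_norm]; exact ENNReal.ofReal_le_ofReal (k1 i x)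
  have hv2 : ∀ c : ℝ, 0 ≤ c → ∫⁻ x, (ENNReal.ofReal c * (ENNReal.ofReal K * ‖v (x, t)‖ₑ)) ^ 2 ≤ ENNReal.ofReal (c ^ 2 * (K ^ 2 * M)) := by
    intro c hc
    simp_rw [← mul_assoc, mul_pow _ ‖_‖ₑ]
    rw [lintegral_const_mul _ (mv'.enorm.pow_const 2)]
    refine (mul_le_mul_right hMt _).trans (le_of_eq ?_)
    rw [← ENNReal.ofReal_mul hc, ← ENNReal.ofReal_pow (by positivity), ← ENNReal.ofReal_mul (by positivity)]
    ring_nf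
  have hR1 : ∀ i j, ∫⁻ x, ‖E i j x - E j i x‖ₑ ^ 2 ≤ 2 * ((∫⁻ x, ‖χ x * om D i j (x, t)‖ₑ ^ 2) + ENNReal.ofReal (4 * (K ^ 2 * M))) := by
    intro i j
    have := hv2 2 (by norm_num)
    calc _ ≤ ∫⁻ x, 2 * (‖χ x * om D i j (x, t)‖ₑ ^ 2 + (ENNReal.ofReal 2 * (ENNReal.ofReal K * ‖v (x, t)‖ₑ)) ^ 2) := by
          refine lintegral_mono fun x => (pow_le_pow_left' ?_ 2).trans (sq2 _ _)
          have e : E i j x - E j i x = χ x * om D i j (x, t) + (fderiv ℝ χ x (bs i) * v (x, t) j - fderiv ℝ χ x (bs j) * v (x, t) i) := by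
            simp only [hE, om]; ring
          rw [e]
          refine (enorm_add_le _ _).trans ?_
          gcongr
          refine (enorm_sub_le).trans ((add_le_add (dv _ _ _) (dv _ _ _)).trans (le_of_eq ?_))
          rw [← two_mul]; simp
      _ = 2 * ((∫⁻ x, ‖χ x * om D i j (x, t)‖ₑ ^ 2) + ∫⁻ x, (ENNReal.ofReal 2 * (ENNReal.ofReal K * ‖v (x, t)‖ₑ)) ^ 2) := by
          rw [lintegral_const_mul' _ _ (by simp), lintegral_add_right _ (((mv'.enorm.const_mul _).const_mul _).pow_const 2)]
      _ ≤ _ := by gcongr; exact this.trans (le_of_eq (by norm_num))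
  have hR2 : ∫⁻ x, ‖∑ i, E i i x‖ₑ ^ 2 ≤ ENNReal.ofReal (9 * (K ^ 2 * M)) := by
    refine le_trans (lintegral_mono_ae ?_) ((hv2 3 (by norm_num)).trans (le_of_eq (by norm_num)))
    filter_upwards [trt] with x hx
    have e : ∑ i, E i i x = ∑ i, fderiv ℝ χ x (bs i) * v (x, t) i := by
      simp only [hE, Finset.sum_add_distrib, ← Finset.mul_sum, hx]; ring
    rw [e, Fin.sum_univ_three]
    refine pow_le_pow_left' ((enorm_add_le _ _).trans ((add_le_add_left (enorm_add_le _ _) _).trans ?_)) 2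
    refine (p6 _ _ _ _ (dv _ _ _) (dv _ _ _) (dv _ _ _)).trans (le_of_eq (by simp))
  have hRR : R ≤ ENNReal.ofReal (2 + 81 * K ^ 2 * M) * (OM χ D t + 1) := by
    have : ∑ i : Fin 3, ∑ j : Fin 3, ∫⁻ x, ‖E i j x - E j i x‖ₑ ^ 2 ≤ 2 * OM χ D t + ENNReal.ofReal (72 * (K ^ 2 * M)) := by
      refine (Finset.sum_le_sum fun i _ => Finset.sum_le_sum fun j _ => hR1 i j).trans (le_of_eq ?_)
      simp only [← Finset.mul_sum, Finset.sum_add_distrib, Finset.sum_const, Finset.card_univ, Fintype.card_fin, mul_add, OM]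
      congr 1
      rw [ENNReal.ofReal_mul (by norm_num), ENNReal.ofReal_mul (p := 72) (by norm_num)]
      simp only [nsmul_eq_mul, ENNReal.ofReal_ofNat]; push_cast; ring
    refine (add_le_add this hR2).trans ?_
    rw [add_assoc, ← ENNReal.ofReal_add (by positivity) (by positivity), mul_add, mul_one]
    refine add_le_add ?_ (ENNReal.ofReal_le_ofReal (by linarith))
    refine mul_le_mul_left ?_ _
    rw [show (2 : ℝ≥0∞) = ENNReal.ofReal 2 by simp]
    exact ENNReal.ofReal_le_ofReal (by have : 0 ≤ 81 * K ^ 2 * M := by positivity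
                                       linarith)
  constructor
  · have q : ∀ j, ∫⁻ x, ‖χ x * v (x, t) j‖ₑ ^ 6 ≤ (ENNReal.ofReal C0 * R) ^ 3 := by
      intro j
      have t := pow_le_pow_left' (hs 0 j).2 3
      rw [← ENNReal.rpow_natCast, ← ENNReal.rpow_mul] at t
      norm_num at t
      simpa only [enorm_mul] using t
    have q2 : ∫⁻ x, (‖χ x‖ₑ * ‖v (x, t)‖ₑ) ^ 6 ≤ (27 * (ENNReal.ofReal C0 * R)) ^ 3 := by
      calc _ ≤ ∫⁻ x, 3 ^ 6 * (‖χ x * v (x, t) 0‖ₑ ^ 6 + ‖χ x * v (x, t) 1‖ₑ ^ 6 + ‖χ x * v (x, t) 2‖ₑ ^ 6) := by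
            refine lintegral_mono fun x => (pow_le_pow_left' ?_ 6).trans (p66 _ _ _)
            simp only [enorm_mul, ← mul_add]; gcongr; exact v_le_sum _
        _ = 3 ^ 6 * ((∫⁻ x, ‖χ x * v (x, t) 0‖ₑ ^ 6) + (∫⁻ x, ‖χ x * v (x, t) 1‖ₑ ^ 6) + ∫⁻ x, ‖χ x * v (x, t) 2‖ₑ ^ 6) := by
            have mm : ∀ j, Measurable fun x => ‖χ x * v (x, t) j‖ₑ ^ 6 := fun j => (mχ.mul (mvc j)).enorm.pow_const 6
            rw [lintegral_const_mul' _ _ (by simp), lintegral_add_right _ (mm 2), lintegral_add_right _ (mm 1)]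
        _ ≤ 3 ^ 6 * (3 * (ENNReal.ofReal C0 * R) ^ 3) := by gcongr; exact p6 _ _ _ _ (q 0) (q 1) (q 2)
        _ ≤ _ := by
          generalize ENNReal.ofReal C0 * R = Y; rw [mul_pow, ← mul_assoc]; gcongr; norm_num
    calc _ ≤ ((27 * (ENNReal.ofReal C0 * R)) ^ 3) ^ (1/3 : ℝ) := by gcongr
      _ = 27 * (ENNReal.ofReal C0 * R) := by rw [← ENNReal.rpow_natCast, ← ENNReal.rpow_mul]; norm_num
      _ ≤ 27 * (ENNReal.ofReal C0 * (ENNReal.ofReal (2 + 81 * K ^ 2 * M) * (OM χ D t + 1))) := by gcongr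
      _ ≤ _ := by
        rw [← mul_assoc, ← mul_assoc]; gcongr
        rw [show (27 : ℝ≥0∞) = ENNReal.ofReal 27 by simp, ← ENNReal.ofReal_mul (by norm_num), ← ENNReal.ofReal_mul (by positivity)]
        refine ENNReal.ofReal_le_ofReal ?_
        have a1 : 0 ≤ 18 * (2 + 81 * K ^ 2 * M) := by positivity
        have a2 : 0 ≤ 18 * (K ^ 2 * M) := by positivity
        linarith
  · have q : ∀ i j, ∫⁻ x, ‖χ x * D (x, t) i j‖ₑ ^ 2 ≤ 2 * (R + ENNReal.ofReal (K ^ 2 * M)) := by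
      intro i j
      calc _ ≤ ∫⁻ x, 2 * (‖E i j x‖ₑ ^ 2 + (ENNReal.ofReal 1 * (ENNReal.ofReal K * ‖v (x, t)‖ₑ)) ^ 2) := by
            refine lintegral_mono fun x => (pow_le_pow_left' ?_ 2).trans (sq2 _ _)
            have e : χ x * D (x, t) i j = E i j x - fderiv ℝ χ x (bs i) * v (x, t) j := by simp only [hE]; ring
            rw [e, ENNReal.ofReal_one, one_mul]
            exact enorm_sub_le.trans (by gcongr; exact dv _ _ _)
        _ = 2 * ((∫⁻ x, ‖E i j x‖ₑ ^ 2) + ∫⁻ x, (ENNReal.ofReal 1 * (ENNReal.ofReal K * ‖v (x, t)‖ₑ)) ^ 2) := by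
            rw [lintegral_const_mul' _ _ (by simp), lintegral_add_right _ (((mv'.enorm.const_mul _).const_mul _).pow_const 2)]
        _ ≤ _ := by gcongr; exacts [(hs i j).1, (hv2 1 (by norm_num)).trans (le_of_eq (by norm_num))]
    calc _ ≤ ∫⁻ x, ∑ i, ∑ j, ‖χ x * D (x, t) i j‖ₑ ^ 2 := by
          refine lintegral_mono fun x => ?_
          simp only [enorm_mul, mul_pow, ← Finset.mul_sum]; gcongr; exact D_sumE _
      _ = ∑ i, ∑ j, ∫⁻ x, ‖χ x * D (x, t) i j‖ₑ ^ 2 := by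
          have mm : ∀ i j, Measurable fun x => ‖χ x * D (x, t) i j‖ₑ ^ 2 := fun i j => (mχ.mul (mDc i j)).enorm.pow_const 2
          rw [lintegral_finsetSum _ fun i _ => Finset.measurable_sum _ fun j _ => mm i j]
          exact Finset.sum_congr rfl fun i _ => lintegral_finsetSum _ fun j _ => mm i j
      _ ≤ ∑ i : Fin 3, ∑ j : Fin 3, 2 * (R + ENNReal.ofReal (K ^ 2 * M)) := Finset.sum_le_sum fun i _ => Finset.sum_le_sum fun j _ => q i j
      _ = ENNReal.ofReal 18 * (R + ENNReal.ofReal (K ^ 2 * M)) := by simp; ring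
      _ ≤ ENNReal.ofReal 18 * (ENNReal.ofReal (2 + 81 * K ^ 2 * M) * (OM χ D t + 1) + ENNReal.ofReal (K ^ 2 * M) * (OM χ D t + 1)) := by
          gcongr; exact le_mul_of_one_le_right' le_add_self
      _ ≤ _ := by
          rw [← add_mul, ← mul_assoc]; gcongr
          rw [← ENNReal.ofReal_add (by positivity) (by positivity), ← ENNReal.ofReal_mul (by positivity)]
          refine ENNReal.ofReal_le_ofReal ?_
          have a1 : 0 ≤ 27 * C0 * (2 + 81 * K ^ 2 * M) := by positivity
          linarith

end

section
lemma li_sq2 {F : Type*} [MeasurableSpace F] {μ : Measure F} {f : F → ℝ}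
    (hi : Integrable (fun x => f x ^ 2) μ) : ∫⁻ x, ‖f x‖ₑ ^ 2 ∂μ = ENNReal.ofReal (∫ x, f x ^ 2 ∂μ) := by
  rw [ofReal_integral_eq_lintegral_ofReal hi (ae_of_all _ fun _ => sq_nonneg _)]
  refine lintegral_congr fun x => ?_
  rw [← ofReal_norm, ← ENNReal.ofReal_pow (norm_nonneg _), Real.norm_eq_abs, sq_abs]
/-- space-time integrals -/
lemma st_prod {f : E3 × ℝ → ℝ≥0∞} (hf : Measurable f) : ∫⁻ z, f z = ∫⁻ t, ∫⁻ x, f (x, t) :=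
  lintegral_prod_symm (μ := (volume : Measure E3)) (ν := (volume : Measure ℝ)) f hf.aemeasurable
def Exf (l : ℝ) (Dn : E3 × ℝ → ℝ≥0∞) (t : ℝ) : ℝ≥0∞ := (∫⁻ x, Dn (x, t) ^ (3/(1+l))) ^ (2*(1+l)/(3*(1-l)))
lemma sl_meas {f : E3 × ℝ → ℝ≥0∞} (hf : Measurable f) : Measurable fun t => ∫⁻ x, f (x, t) :=
  hf.lintegral_prod_left'
lemma Exf_meas {l : ℝ} {Dn : E3 × ℝ → ℝ≥0∞} (h : Measurable Dn) : Measurable (Exf l Dn) :=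
  (sl_meas (h.pow_const _)).pow_const _
lemma sl1_meas {f : E3 × ℝ → ℝ≥0∞} (hf : Measurable f) (t : ℝ) : Measurable fun x => f (x, t) :=
  hf.comp (measurable_id.prodMk measurable_const)
set_option maxHeartbeats 1000000 in
lemma HN {l : ℝ} (h0 : 0 ≤ l) (h1 : l < 1) {A Dn G : E3 × ℝ → ℝ≥0∞} (mA : Measurable A) (mD : Measurable Dn) (mG : Measurable G)
    {μ : Measure ℝ} {N : ℝ≥0∞} (hN : ∀ᵐ t ∂μ, ∫⁻ x, G (x, t) ^ 2 ≤ N)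
    (hN6 : ∫⁻ t, (∫⁻ x, G (x, t) ^ 6) ^ (1/3 : ℝ) ∂μ ≤ N) :
    (∫⁻ t, (∫⁻ x, A (x, t) * Dn (x, t) * G (x, t)) ∂μ) ^ 2 ≤
      (∫⁻ t, (∫⁻ x, A (x, t) ^ 6) ^ (1/3 : ℝ) ∂μ) * (∫⁻ t, Exf l Dn t ∂μ) ^ (1 - l) * N := by
  have hl1 : 0 < 1 - l := by linarith
  have hl2 : 0 < 1 + l := by linarith
  have sp : ∀ t, ∫⁻ x, A (x, t) * Dn (x, t) * G (x, t) ≤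
      (∫⁻ x, A (x, t) ^ 6) ^ (1/6 : ℝ) * (∫⁻ x, Dn (x, t) ^ (3/(1+l))) ^ ((1+l)/3) * (∫⁻ x, G (x, t) ^ 2) ^ ((1-l)/2) * (∫⁻ x, G (x, t) ^ 6) ^ (l/6) := by
    intro t
    have h := ENNReal.lintegral_prod_norm_pow_le (μ := (volume : Measure E3)) (Finset.univ : Finset (Fin 4))
      (f := ![fun x => A (x, t) ^ 6, fun x => Dn (x, t) ^ (3/(1+l)), fun x => G (x, t) ^ 2, fun x => G (x, t) ^ 6])
      (p := ![1/6, (1+l)/3, (1-l)/2, l/6])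
      (by
        intro i _; fin_cases i
        · exact ((sl1_meas mA t).pow_const 6).aemeasurable
        · exact ((sl1_meas mD t).pow_const _).aemeasurable
        · exact ((sl1_meas mG t).pow_const 2).aemeasurable
        · exact ((sl1_meas mG t).pow_const 6).aemeasurable)
      (by simp [Fin.sum_univ_four]; ring)
      (by intro i _; fin_cases i <;> simp <;> positivity)
    simp only [Fin.prod_univ_four, Matrix.cons_val] at h
    refine le_trans (le_of_eq (lintegral_congr fun x => ?_)) h
    have e1 : (A (x, t) ^ 6) ^ (1/6 : ℝ) = A (x, t) := by rw [← ENNReal.rpow_natCast, ← ENNReal.rpow_mul]; norm_num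
    have e2 : (Dn (x, t) ^ (3/(1+l))) ^ ((1+l)/3) = Dn (x, t) := by
      rw [← ENNReal.rpow_mul, show 3/(1+l)*((1+l)/3) = 1 by field_simp]; simp
    have e3 : (G (x, t) ^ 2) ^ ((1-l)/2) * (G (x, t) ^ 6) ^ (l/6) = G (x, t) := by
      rw [← ENNReal.rpow_natCast, ← ENNReal.rpow_natCast, ← ENNReal.rpow_mul, ← ENNReal.rpow_mul, ← ENNReal.rpow_add_of_nonneg _ _ (by positivity) (by positivity),
        show ((2:ℕ):ℝ) * ((1-l)/2) + ((6:ℕ):ℝ) * (l/6) = 1 by push_cast; ring, ENNReal.rpow_one]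
    rw [e1, e2, mul_assoc (A (x, t) * Dn (x, t)), e3]
  set a : ℝ → ℝ≥0∞ := fun t => (∫⁻ x, A (x, t) ^ 6) ^ (1/3 : ℝ)
  set g : ℝ → ℝ≥0∞ := fun t => (∫⁻ x, G (x, t) ^ 6) ^ (1/3 : ℝ)
  have ma : Measurable a := (sl_meas (mA.pow_const 6)).pow_const _
  have mg : Measurable g := (sl_meas (mG.pow_const 6)).pow_const _
  have mE : Measurable (Exf l Dn) := Exf_meas mD
  have tm := ENNReal.lintegral_prod_norm_pow_le (μ := μ) (Finset.univ : Finset (Fin 3)) (f := ![a, Exf l Dn, g]) (p := ![1/2, (1-l)/2, l/2])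
      (by
        intro i _; fin_cases i
        · exact ma.aemeasurable
        · exact mE.aemeasurable
        · exact mg.aemeasurable)
      (by simp [Fin.sum_univ_three]; ring)
      (by intro i _; fin_cases i <;> simp <;> positivity)
  simp only [Fin.prod_univ_three, Matrix.cons_val] at tm
  have key : ∫⁻ t, (∫⁻ x, A (x, t) * Dn (x, t) * G (x, t)) ∂μ ≤ N ^ ((1-l)/2) * ((∫⁻ t, a t ∂μ) ^ (1/2 : ℝ) * (∫⁻ t, Exf l Dn t ∂μ) ^ ((1-l)/2) * N ^ (l/2)) := by
    calc _ ≤ ∫⁻ t, N ^ ((1-l)/2) * (a t ^ (1/2 : ℝ) * (Exf l Dn t) ^ ((1-l)/2) * g t ^ (l/2)) ∂μ := by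
          refine lintegral_mono_ae ?_
          filter_upwards [hN] with t ht
          refine (sp t).trans ?_
          have e1 : a t ^ (1/2 : ℝ) = (∫⁻ x, A (x, t) ^ 6) ^ (1/6 : ℝ) := by
            simp only [a]; rw [← ENNReal.rpow_mul]; norm_num
          have e2 : (Exf l Dn t) ^ ((1-l)/2) = (∫⁻ x, Dn (x, t) ^ (3/(1+l))) ^ ((1+l)/3) := by
            simp only [Exf]; rw [← ENNReal.rpow_mul]; congr 1; field_simp
          have e3 : g t ^ (l/2) = (∫⁻ x, G (x, t) ^ 6) ^ (l/6) := by
            simp only [g]; rw [← ENNReal.rpow_mul]; congr 1; ring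
          rw [e1, e2, e3]
          calc _ ≤ (∫⁻ x, A (x, t) ^ 6) ^ (1/6 : ℝ) * (∫⁻ x, Dn (x, t) ^ (3/(1+l))) ^ ((1+l)/3) * N ^ ((1-l)/2) * (∫⁻ x, G (x, t) ^ 6) ^ (l/6) := by
                gcongr
            _ = _ := by ring
      _ = N ^ ((1-l)/2) * ∫⁻ t, (a t ^ (1/2 : ℝ) * (Exf l Dn t) ^ ((1-l)/2) * g t ^ (l/2)) ∂μ :=
          lintegral_const_mul _ (((ma.pow_const _).mul (mE.pow_const _)).mul (mg.pow_const _))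
      _ ≤ _ := by
        gcongr N ^ ((1-l)/2) * ?_
        refine tm.trans ?_
        gcongr
  refine (pow_le_pow_left' key 2).trans (le_of_eq ?_)
  have eN : N ^ ((1-l)/2) * N ^ (l/2) = N ^ (1/2 : ℝ) := by
    rw [← ENNReal.rpow_add_of_nonneg _ _ (by positivity) (by positivity)]; congr 1; ring
  have e : ∀ b : ℝ≥0∞, (b ^ (1/2 : ℝ)) ^ 2 = b := fun a => by rw [← ENNReal.rpow_natCast, ← ENNReal.rpow_mul]; norm_num
  have e' : ∀ b : ℝ≥0∞, (b ^ ((1-l)/2)) ^ 2 = b ^ (1-l) := fun a => by rw [← ENNReal.rpow_natCast, ← ENNReal.rpow_mul]; congr 1; push_cast; ring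
  calc _ = ((∫⁻ t, a t ∂μ) ^ (1/2 : ℝ)) ^ 2 * ((∫⁻ t, Exf l Dn t ∂μ) ^ ((1-l)/2)) ^ 2 * (N ^ ((1-l)/2) * N ^ (l/2)) ^ 2 := by ring
    _ = _ := by rw [eN, e, e, e']
lemma pot_zero {S b : ℝ} {g : E3 × ℝ → ℝ} (hg : Sm g) (hc : HasCompactSupport g) (h : ∀ z, b ≤ z.2 → g z = 0) (z : E3 × ℝ) (hz : b ≤ z.2) :
    pot 1 S g z = 0 := by
  rw [pot_eq hg.continuous hc]
  refine setIntegral_eq_zero_of_forall_eq_zero fun s hs => ?_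
  have : ∀ y, g (z - sg 1 (s, y)) = 0 := fun y => h _ (by simp [sg]; linarith [hs.1])
  simp [this]
lemma pot_back {S t1 : ℝ} (hS : 0 < S) {g : E3 × ℝ → ℝ} (hg : Sm g) (hc : HasCompactSupport g) (h : ∀ z, t1 ≤ z.2 → g z = 0) (z : E3 × ℝ) (hz : t1 - S ≤ z.2) :
    lapz (pot 1 S g) z + tdz (pot 1 S g) z = - g z := by
  have := pot_heat (l := 1) hS hg hc z
  have e : ∀ y, g (z - sg 1 (S, y)) = 0 := fun y => h _ (by simp [sg]; linarith)
  simpa [e] using this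
set_option maxHeartbeats 1000000 in
lemma psi_pack {S t1 τ : ℝ} (hτ : 0 < τ) (hS : τ ≤ S) {g : E3 × ℝ → ℝ} (hg : Sm g) (hc : HasCompactSupport g)
    (h0 : ∀ z, t1 ≤ z.2 → g z = 0) :
    (∀ t ∈ Ioo (t1 - τ) t1, ∀ i, ∫⁻ x, ‖sdz (pot 1 S g) i (x, t)‖ₑ ^ 2 ≤ ∫⁻ z, ‖g z‖ₑ ^ 2) ∧
    ∀ i l, ∫⁻ t in Ioo (t1 - τ) t1, ∫⁻ x, ‖sdz (sdz (pot 1 S g) i) l (x, t)‖ₑ ^ 2 ≤ ∫⁻ z, ‖g z‖ₑ ^ 2 := by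
  have H : IsP (gM 1 S) (pot 1 S g) := ⟨g, hg, hc, rfl⟩
  set Ψ := pot 1 S g with hΨ
  have hS0 : 0 < S := by linarith
  have z1 : ∀ x i, sdz Ψ i (x, t1) = 0 := by
    intro x i
    have e : sdz Ψ i = pot 1 S (sdz g i) := avg_sdz hg hc i
    rw [e]
    refine pot_zero (b := t1) (hg.sdz i) (cs_sdz hc i) (fun z hz => ?_) _ le_rfl
    have := slice_fderiv hg z.2 z.1 i
    rw [show (fun x => g (x, z.2)) = fun _ => 0 from funext fun x => h0 _ hz] at this
    simpa using this.symm
  have hen : ∀ t' ∈ Ico (t1 - τ) t1, (∫ x, ∑ i, (sdz Ψ i (x, t')) ^ 2) + ∫ t in Ioc t' t1, ∫ x, ∑ i, ∑ l, (sdz (sdz Ψ i) l (x, t)) ^ 2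
      ≤ ∫ t in Ioc t' t1, ∫ x, (g (x, t)) ^ 2 := fun t' ht => H.energy ht.2.le z1 hg hc fun x t ht' => pot_back hS0 hg hc h0 _ (by simp; linarith [ht.1, ht'.1])
  have hgc2 : HasCompactSupport fun z => g z ^ 2 := hc.comp_left (g := fun u : ℝ => u ^ 2) (by simp)
  have hg2 : Integrable fun z => g z ^ 2 := (hg.continuous.pow 2).integrable_of_hasCompactSupport hgc2
  have hgb : ∀ t', ENNReal.ofReal (∫ t in Ioc t' t1, ∫ x, (g (x, t)) ^ 2) ≤ ∫⁻ z, ‖g z‖ₑ ^ 2 := by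
    intro t'
    rw [li_sq hg.continuous hc]
    refine ENNReal.ofReal_le_ofReal ?_
    have e : ∫ z, g z ^ 2 = ∫ t, ∫ x, g (x, t) ^ 2 := integral_prod_symm (μ := (volume : Measure E3)) (ν := (volume : Measure ℝ)) _ hg2
    rw [e]
    exact setIntegral_le_integral (Integrable.integral_prod_right (μ := (volume : Measure E3)) (ν := (volume : Measure ℝ)) hg2) (ae_of_all _ fun t => integral_nonneg fun x => sq_nonneg _)
  have i1 : ∀ i t, Integrable fun x => sdz Ψ i (x, t) ^ 2 := fun i t => by simpa only [pow_two] using (H.sdz i).mul_sl (H.sdz i) t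
  have i2 : ∀ i l t, Integrable fun x => sdz (sdz Ψ i) l (x, t) ^ 2 := fun i l t => by simpa only [pow_two] using ((H.sdz i).sdz l).mul_sl ((H.sdz i).sdz l) t
  have i3 : ∀ i l, Integrable fun z => sdz (sdz Ψ i) l z ^ 2 := fun i l => by simpa only [pow_two] using ((H.sdz i).sdz l).mul_int ((H.sdz i).sdz l)
  have i4 : ∀ i l, Integrable fun t => ∫ x, sdz (sdz Ψ i) l (x, t) ^ 2 := fun i l => Integrable.integral_prod_right (μ := (volume : Measure E3)) (ν := (volume : Measure ℝ)) (i3 i l)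
  have i5 : Integrable fun t => ∫ x, ∑ i, ∑ l, (sdz (sdz Ψ i) l (x, t)) ^ 2 := 
    Integrable.integral_prod_right (μ := (volume : Measure E3)) (ν := (volume : Measure ℝ)) (f := fun z => ∑ i, ∑ l, (sdz (sdz Ψ i) l z) ^ 2) (integrable_finsetSum _ fun i _ => integrable_finsetSum _ fun l _ => i3 i l)
  constructor
  · intro t ht i
    rw [li_sq2 (i1 i t)]
    refine le_trans (ENNReal.ofReal_le_ofReal ?_) (hgb t)
    have h := hen t ⟨ht.1.le, ht.2⟩
    have p2 : 0 ≤ ∫ t in Ioc t t1, ∫ x, ∑ i, ∑ l, (sdz (sdz Ψ i) l (x, t)) ^ 2 := integral_nonneg fun t => integral_nonneg fun x => by positivity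
    have p1 : ∫ x, sdz Ψ i (x, t) ^ 2 ≤ ∫ x, ∑ i, (sdz Ψ i (x, t)) ^ 2 :=
      integral_mono (i1 i t) (integrable_finsetSum _ fun i _ => i1 i t) fun x => Finset.single_le_sum (f := fun i => sdz Ψ i (x, t) ^ 2) (fun i _ => sq_nonneg _) (Finset.mem_univ i)
    linarith
  · intro i l
    have h := hen (t1 - τ) ⟨le_rfl, by linarith⟩
    have p1 : 0 ≤ ∫ x, ∑ i, (sdz Ψ i (x, t1 - τ)) ^ 2 := integral_nonneg fun x => by positivity
    calc _ ≤ ∫⁻ t in Ioc (t1 - τ) t1, ENNReal.ofReal (∫ x, sdz (sdz Ψ i) l (x, t) ^ 2) := by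
          refine (lintegral_mono_set Ioo_subset_Ioc_self).trans (le_of_eq (lintegral_congr fun t => li_sq2 (i2 i l t)))
      _ = ENNReal.ofReal (∫ t in Ioc (t1 - τ) t1, ∫ x, sdz (sdz Ψ i) l (x, t) ^ 2) :=
          (ofReal_integral_eq_lintegral_ofReal (i4 i l).integrableOn (ae_of_all _ fun t => integral_nonneg fun x => sq_nonneg _)).symm
      _ ≤ _ := by
        refine le_trans (ENNReal.ofReal_le_ofReal ?_) (hgb (t1 - τ))
        refine le_trans ?_ (le_trans (le_add_of_nonneg_left p1) h)
        refine integral_mono (i4 i l).integrableOn i5.integrableOn fun t => ?_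
        refine integral_mono (i2 i l t) (integrable_finsetSum _ fun i _ => integrable_finsetSum _ fun l _ => i2 i l t) fun x => ?_
        exact (Finset.single_le_sum (f := fun l => sdz (sdz Ψ i) l (x, t) ^ 2) (fun i _ => sq_nonneg _) (Finset.mem_univ l)).trans
          (Finset.single_le_sum (f := fun i => ∑ l, sdz (sdz Ψ i) l (x, t) ^ 2) (fun i _ => Finset.sum_nonneg fun _ _ => sq_nonneg _) (Finset.mem_univ i))

end

section
lemma eta : ∃ C : ℝ, 0 ≤ C ∧ ∀ t1 τ : ℝ, 0 < τ → ∃ η : ℝ → ℝ, Sm η ∧ (∀ t, 0 ≤ η t ∧ η t ≤ 1) ∧ (∀ t ≤ t1 - 3 * τ / 4, η t = 0) ∧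
    (∀ t ≥ t1 - τ / 2, η t = 1) ∧ ∀ t, |deriv η t| ≤ C / τ := by
  have sm : Sm Real.smoothTransition := Real.smoothTransition.contDiff
  have hc : HasCompactSupport (deriv Real.smoothTransition) := by
    refine HasCompactSupport.of_support_subset_isCompact (K := Icc 0 1) isCompact_Icc fun x hx => ?_
    by_contra h
    apply hx
    simp only [mem_Icc, not_and_or, not_le] at h
    rcases h with h | h
    · have : Real.smoothTransition =ᶠ[nhds x] fun _ => 0 := by
        filter_upwards [Iio_mem_nhds h] with y hy using Real.smoothTransition.zero_of_nonpos (le_of_lt hy)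
      rw [this.deriv_eq]; simp
    · have : Real.smoothTransition =ᶠ[nhds x] fun _ => 1 := by
        filter_upwards [Ioi_mem_nhds h] with y hy using Real.smoothTransition.one_of_one_le (le_of_lt hy)
      rw [this.deriv_eq]; simp
  obtain ⟨C, hC⟩ := cs_bdd (sm.continuous_deriv (by simp)) hc
  have hC0 : 0 ≤ C := (abs_nonneg _).trans (hC 0)
  refine ⟨C * 4, by positivity, fun t1 τ hτ => ⟨fun t => Real.smoothTransition (4 / τ * (t - t1 + τ) - 1), sm.comp (by fun_prop), fun t => ⟨Real.smoothTransition.nonneg _, Real.smoothTransition.le_one _⟩, fun t ht => ?_, fun t ht => ?_, fun t => ?_⟩⟩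
  · refine Real.smoothTransition.zero_of_nonpos ?_
    rw [sub_nonpos, div_mul_eq_mul_div, div_le_one hτ]; linarith
  · refine Real.smoothTransition.one_of_one_le ?_
    rw [le_sub_iff_add_le, div_mul_eq_mul_div, le_div_iff₀ hτ]; linarith
  · have h1 : HasDerivAt (fun t => 4 / τ * (t - t1 + τ) - 1) (4 / τ) t := by
      simpa using ((((hasDerivAt_id t).sub_const t1).add_const τ).const_mul (4 / τ)).sub_const 1
    have h2 := ((sm.differentiable (by simp)) (4 / τ * (t - t1 + τ) - 1)).hasDerivAt.comp t h1
    have h3 : deriv (fun t => Real.smoothTransition (4 / τ * (t - t1 + τ) - 1)) t = _ := h2.deriv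
    rw [h3, abs_mul, abs_of_pos (show 0 < 4 / τ by positivity), mul_div_assoc]
    gcongr; exact hC _
lemma cutb {χ : E3 → ℝ} (h1 : Sm χ) (h2 : HasCompactSupport χ) : ∃ K : ℝ, 0 ≤ K ∧ (∀ x, |χ x| ≤ K) ∧
    (∀ i (z : E3 × ℝ), |sdz (fun z => χ z.1) i z| ≤ K) ∧ ∀ z : E3 × ℝ, |lapz (fun z => χ z.1) z| ≤ K := by
  obtain ⟨K0, q0⟩ := cs_bdd h1.continuous h2
  choose K1 q1 using fun i => cs_bdd (h1.dd (bs i)).continuous (cs_dd h2 (bs i))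
  choose K2 q2 using fun i => cs_bdd ((h1.dd (bs i)).dd (bs i)).continuous (cs_dd (cs_dd h2 (bs i)) (bs i))
  have n0 := (abs_nonneg _).trans (q0 0)
  have n1 := fun i => (abs_nonneg _).trans (q1 i 0)
  have n2 := fun i => (abs_nonneg _).trans (q2 i 0)
  have s1 := Finset.sum_nonneg fun i (_ : i ∈ Finset.univ) => n1 i
  have s2 := Finset.sum_nonneg fun i (_ : i ∈ Finset.univ) => n2 i
  refine ⟨K0 + ∑ i, K1 i + ∑ i, K2 i, by positivity, fun x => (q0 x).trans (by linarith), fun i z => ?_, fun z => ?_⟩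
  · rw [sdz_fst h1]
    refine (q1 i z.1).trans ?_
    have := Finset.single_le_sum (fun i _ => n1 i) (Finset.mem_univ i); linarith
  · have e : ∀ i, sdz (sdz (fun z => χ z.1) i) i z = fderiv ℝ (fun x => fderiv ℝ χ x (bs i)) z.1 (bs i) := by
      intro i
      rw [show sdz (fun z : E3 × ℝ => χ z.1) i = fun z => (fun x => fderiv ℝ χ x (bs i)) z.1 from funext fun z => sdz_fst h1 i z, sdz_fst (h1.dd (bs i))]
    simp only [lapz, e]
    refine (Finset.abs_sum_le_sum_abs _ _).trans ?_
    have := Finset.sum_le_sum fun i (_ : i ∈ Finset.univ) => q2 i z.1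
    linarith
lemma Loc.iom {x0 t0 r v D} (L : Loc x0 t0 r v D) (j k) : Integrable (om D j k) := ((L.iD.eval j).eval k).sub ((L.iD.eval k).eval j)
lemma Loc.ivd {x0 t0 r v D} (L : Loc x0 t0 r v D) (a i j) : Integrable fun z => v z a * D z i j := by
  refine L.ivD.mono' ?_ (ae_of_all _ fun z => ?_)
  · exact ((EuclideanSpace.proj (𝕜 := ℝ) a).integrable_comp L.iv).aestronglyMeasurable.mul ((L.iD.eval i).eval j).aestronglyMeasurable
  · rw [norm_mul]; gcongr
    · exact PiLp.norm_apply_le _ _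
    · exact D_le _ _ _
lemma om_le (D : E3 × ℝ → Fin 3 → Fin 3 → ℝ) (j k z) : |om D j k z| ≤ 2 * ‖D z‖ := by
  have h1 := D_le (D z) j k
  have h2 := D_le (D z) k j
  have := abs_sub (D z j k) (D z k j)
  unfold om; linarith
/-- weighted error integrand -/
def errI (χ χ1 : E3 → ℝ) (v : E3 × ℝ → E3) (D : E3 × ℝ → Fin 3 → Fin 3 → ℝ) (τ : ℝ) (j k : Fin 3) (Ψ : E3 × ℝ → ℝ) (z : E3 × ℝ) : ℝ≥0∞ :=
  ENNReal.ofReal τ⁻¹ * ‖χ z.1 * om D j k z‖ₑ * ‖Ψ z‖ₑ + ‖D z‖ₑ * (‖Ψ z‖ₑ + ∑ i, ‖sdz Ψ i z‖ₑ)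
    + (‖χ z.1‖ₑ * ‖v z‖ₑ) * ‖D z‖ₑ * (‖χ1 z.1‖ₑ * ∑ i, ‖sdz Ψ i z‖ₑ) + (‖χ1 z.1‖ₑ * ‖v z‖ₑ) * ‖D z‖ₑ * (‖χ1 z.1‖ₑ * ‖Ψ z‖ₑ)
set_option maxHeartbeats 2000000 in
lemma Loc.tst {x0 t0 r v D} (L : Loc x0 t0 r v D) {χ χ1 : E3 → ℝ} (h1 : Sm χ) (h2 : HasCompactSupport χ) (h3 : tsupport χ ⊆ Metric.ball x0 r)
    (h4 : ∀ x ∈ tsupport χ, χ1 x = 1) : ∃ K : ℝ, 0 ≤ K ∧ ∀ t1 τ S b : ℝ, ∀ g : E3 × ℝ → ℝ, 0 < τ → τ ≤ S → t1 ≤ t0 → t0 - r ^ 2 ≤ t1 - τ → b < t1 →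
      Sm g → HasCompactSupport g → (∀ z, b ≤ z.2 → g z = 0) → (∀ z, z.2 ≤ t1 - τ / 2 → g z = 0) → ∀ j k,
      ‖∫ z, χ z.1 * om D j k z * g z‖ₑ ≤ ENNReal.ofReal K * ∫⁻ t in Ioo (t1 - τ) t1, ∫⁻ x, errI χ χ1 v D τ j k (pot 1 S g) (x, t) := by
  obtain ⟨C, hC, heta⟩ := eta
  obtain ⟨K, hK, k0, k1, k2⟩ := cutb h1 h2
  refine ⟨C + 10 * K + 6, by positivity, fun t1 τ S b g hτ hS ht1 ht0 hb hg hgc g1 g2 j k => ?_⟩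
  obtain ⟨η, e1, e2, e3, e4, e5⟩ := heta t1 τ hτ
  have hS0 : 0 < S := by linarith
  have H : IsP (gM 1 S) (pot 1 S g) := ⟨g, hg, hgc, rfl⟩
  have hz := pot_zero (S := S) hg hgc g1
  have hbk := pot_back hS0 hg hgc fun z hz => g1 z (hb.le.trans hz)
  set Ψ := pot 1 S g with hΨ
  have sΨ : Sm Ψ := H.sm
  have sχ : Sm fun z : E3 × ℝ => χ z.1 := h1.comp contDiff_fst
  have sη : Sm fun z : E3 × ℝ => η z.2 := e1.comp contDiff_snd
  set c : E3 × ℝ → ℝ := fun z => χ z.1 * η z.2 with hc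
  have sc : Sm c := sχ.mul sη
  set Φ : E3 × ℝ → ℝ := fun z => c z * Ψ z with hΦ
  have sΦ : Sm Φ := sc.mul sΨ
  have ts : tsupport Φ ⊆ tsupport χ ×ˢ Icc (t1 - 3 * τ / 4) b := by
    refine closure_minimal (fun z hz' => ?_) ((isClosed_tsupport χ).prod isClosed_Icc)
    rw [Function.mem_support] at hz'
    refine ⟨subset_tsupport _ fun h => hz' (by simp [hΦ, hc, h]), ?_, ?_⟩
    · by_contra h; exact hz' (by simp [hΦ, hc, e3 z.2 (by linarith)])
    · by_contra h; exact hz' (by simp [hΦ, hz z (by linarith)])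
  have cΦ : HasCompactSupport Φ := (h2.isCompact.prod isCompact_Icc).of_isClosed_subset (isClosed_tsupport _) ts
  have tsQ : tsupport Φ ⊆ pcyl (x0, t0) r := by
    refine ts.trans (prod_mono h3 fun t ht => ⟨?_, ?_⟩)
    · simp only; linarith [ht.1]
    · simp only; linarith [ht.2]
  have h0 := L.H2 Φ sΦ cΦ tsQ j k
  set I : E3 × ℝ → ℝ := fun z => om D j k z * (tdz Φ z + lapz Φ z) + ∑ l, v z l * (D z l k * sdz Φ j z - D z l j * sdz Φ k z) with hI
  obtain ⟨M1, b1⟩ := cs_bdd sΦ.tdz.continuous (cs_tdz cΦ)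
  have clap : HasCompactSupport (lapz Φ) := HasCompactSupport.of_support_subset_isCompact cΦ fun z hz => by
    by_contra h; exact hz (out_l h)
  obtain ⟨M2, b2⟩ := cs_bdd sΦ.lapz.continuous clap
  choose M3 b3 using fun i => cs_bdd (sΦ.sdz i).continuous (cs_sdz cΦ i)
  obtain ⟨M4, b4⟩ := cs_bdd hg.continuous hgc
  have iI : Integrable I := by
    have a1 : Integrable fun z => om D j k z * (tdz Φ z + lapz Φ z) :=
      (L.iom j k).mul_bdd (c := M1 + M2) (sΦ.tdz.continuous.add sΦ.lapz.continuous).aestronglyMeasurable (ae_of_all _ fun z => (abs_add_le _ _).trans (add_le_add (b1 z) (b2 z)))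
    refine a1.add (integrable_finsetSum _ fun l _ => ?_)
    have a2 : Integrable fun z => v z l * D z l k * sdz Φ j z := (L.ivd l l k).mul_bdd (c := M3 j) (sΦ.sdz j).continuous.aestronglyMeasurable (ae_of_all _ (b3 j))
    have a3 : Integrable fun z => v z l * D z l j * sdz Φ k z := (L.ivd l l j).mul_bdd (c := M3 k) (sΦ.sdz k).continuous.aestronglyMeasurable (ae_of_all _ (b3 k))
    exact (a2.sub a3).congr (ae_of_all _ fun z => by simp only [Pi.sub_apply]; ring)
  have iw : Integrable fun z => χ z.1 * om D j k z * g z := by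
    have : Integrable fun z => χ z.1 * om D j k z := (L.iom j k).bdd_mul (c := K) sχ.continuous.aestronglyMeasurable (ae_of_all _ fun z => k0 z.1)
    exact this.mul_bdd (c := M4) hg.continuous.aestronglyMeasurable (ae_of_all _ b4)
  have eq : ∫ z, χ z.1 * om D j k z * g z = ∫ z, (χ z.1 * om D j k z * g z + I z) := by
    rw [integral_add iw iI, h0, add_zero]
  rw [eq]
  refine (enorm_integral_le_lintegral_enorm _).trans ?_
  have mE : Measurable fun z => ‖χ z.1 * om D j k z * g z + I z‖ₑ := by
    have mo : Measurable (om D j k) := by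
      have := L.mD; unfold om; fun_prop
    have mΦ1 := sΦ.tdz.continuous.measurable
    have mΦ2 := sΦ.lapz.continuous.measurable
    have mΦ3 := fun i => (sΦ.sdz i).continuous.measurable
    have mv : ∀ l, Measurable fun z => v z l := fun l => (EuclideanSpace.proj (𝕜 := ℝ) l).continuous.measurable.comp L.mv
    have mD : ∀ i l, Measurable fun z => D z i l := fun i l => (measurable_pi_apply l).comp ((measurable_pi_apply i).comp L.mD)
    refine Measurable.enorm (Measurable.add ((sχ.continuous.measurable.mul mo).mul hg.continuous.measurable) ((mo.mul (mΦ1.add mΦ2)).add ?_))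
    exact Finset.measurable_sum _ fun l _ => (mv l).mul (((mD l k).mul (mΦ3 j)).sub ((mD l j).mul (mΦ3 k)))
  rw [st_prod mE, ← lintegral_const_mul' _ _ ofReal_ne_top, ← lintegral_indicator measurableSet_Ioo]
  refine lintegral_mono fun t => ?_
  rw [indicator_apply]
  have out : ∀ z : E3 × ℝ, z ∉ tsupport Φ → I z = 0 := fun z hz => by
    simp [hI, out_l hz, out_t hz, out_s hz]
  split_ifs with ht
  swap
  · refine le_of_eq ?_
    have : ∀ x, χ x * om D j k (x, t) * g (x, t) + I (x, t) = 0 := by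
      intro x
      have : g (x, t) = 0 := by
        by_cases q : t1 ≤ t
        · exact g1 _ (hb.le.trans q)
        · refine g2 _ ?_
          by_contra q2; simp only at q2; exact ht ⟨by linarith, by linarith⟩
      rw [this, out (x, t) fun h => ht ?_]; · simp
      have := (ts h).2; simp only [mem_Icc] at this
      exact ⟨by linarith, by linarith⟩
    simp [this]
  rw [← lintegral_const_mul' _ _ ofReal_ne_top]
  refine lintegral_mono fun x => ?_
  simp only
  by_cases hx : x ∈ tsupport χ
  swap
  · rw [out (x, t) fun h => hx (ts h).1, image_eq_zero_of_notMem_tsupport hx]; simp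
  set z : E3 × ℝ := (x, t)
  have hx1 : χ1 x = 1 := h4 x hx
  have hcg : c z * g z = χ x * g z := by
    by_cases q : t ≤ t1 - τ / 2
    · rw [g2 z q]; simp
    · simp only [hc]; rw [e4 z.2 (not_le.1 q).le]; simp [z]
  have d1 : tdz Φ z + lapz Φ z = (χ x * deriv η t + η t * lapz (fun z => χ z.1) z) * Ψ z + 2 * η t * ∑ i, sdz (fun z => χ z.1) i z * sdz Ψ i z - χ x * g z := by
    have q1 : tdz Φ z = tdz c z * Ψ z + c z * tdz Ψ z := congrFun (tdz_mul sc sΨ) z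
    have q2 := lapz_mul sc sΨ z
    have q3 : tdz c z = χ x * deriv η t := by
      have := congrFun (tdz_mul sχ sη) z
      rw [tdz_fst h1, tdz_snd e1] at this; simpa [z] using this
    have sd : ∀ i, sdz c i z = η t * sdz (fun z => χ z.1) i z := by
      intro i
      have := congrFun (sdz_mul sχ sη i) z
      rw [sdz_snd e1] at this; simpa [z, mul_comm] using this
    have q4 : lapz c z = η t * lapz (fun z => χ z.1) z := by
      have := lapz_mul sχ sη z
      have q : ∀ i, sdz (fun z : E3 × ℝ => η z.2) i = fun _ => 0 := fun i => funext fun z => sdz_snd e1 i z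
      have q' : lapz (fun z : E3 × ℝ => η z.2) z = 0 := by simp [lapz, q, sdz]
      simp only [q, q'] at this
      rw [this]; simp [z, mul_comm]
    have q5 := hbk z (by simp only [z]; linarith [ht.1])
    rw [q1, q2, q3, q4]
    simp only [sd]
    have q6 : ∑ i, η t * sdz (fun z => χ z.1) i z * sdz Ψ i z = η t * ∑ i, sdz (fun z => χ z.1) i z * sdz Ψ i z := by
      rw [Finset.mul_sum]; exact Finset.sum_congr rfl fun i _ => by ring
    rw [q6]
    linear_combination c z * q5 - hcg
  have d2 : ∀ i, |sdz Φ i z| ≤ K * |Ψ z| + |χ x| * ∑ i, |sdz Ψ i z| := by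
    intro i
    have q1 : sdz Φ i z = sdz c i z * Ψ z + c z * sdz Ψ i z := congrFun (sdz_mul sc sΨ i) z
    have q2 : sdz c i z = η t * sdz (fun z => χ z.1) i z := by
      have := congrFun (sdz_mul sχ sη i) z
      rw [sdz_snd e1] at this; simpa [z, mul_comm] using this
    have hη : |η t| ≤ 1 := by rw [abs_of_nonneg (e2 t).1]; exact (e2 t).2
    have q3 : |sdz Ψ i z| ≤ ∑ i, |sdz Ψ i z| := Finset.single_le_sum (f := fun i => |sdz Ψ i z|) (fun _ _ => abs_nonneg _) (Finset.mem_univ i)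
    rw [q1, q2]
    refine (abs_add_le _ _).trans ?_
    simp only [hc, abs_mul, z]
    gcongr ?_ * |Ψ _| + ?_
    · exact (mul_le_mul hη (k1 i z) (abs_nonneg _) zero_le_one).trans (by simp)
    · calc |χ x| * |η t| * |sdz Ψ i (x, t)| ≤ |χ x| * 1 * ∑ i, |sdz Ψ i z| := by gcongr
        _ = _ := by ring
  have hη : |η t| ≤ 1 := by rw [abs_of_nonneg (e2 t).1]; exact (e2 t).2
  have hR : |χ x * om D j k z * g z + I z| ≤ (C + 10 * K + 6) * (τ⁻¹ * |χ x * om D j k z| * |Ψ z| + ‖D z‖ * (|Ψ z| + ∑ i, |sdz Ψ i z|)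
     + (|χ x| * ‖v z‖) * ‖D z‖ * (|χ1 x| * ∑ i, |sdz Ψ i z|) + (|χ1 x| * ‖v z‖) * ‖D z‖ * (|χ1 x| * |Ψ z|)) := by
    have ee : χ x * om D j k z * g z + I z = (χ x * om D j k z) * deriv η t * Ψ z + om D j k z * (η t * lapz (fun z => χ z.1) z * Ψ z + 2 * η t * ∑ i, sdz (fun z => χ z.1) i z * sdz Ψ i z)
       + ∑ l, v z l * (D z l k * sdz Φ j z - D z l j * sdz Φ k z) := by
      simp only [hI, d1]; ring
    rw [ee]
    have r1 : |(χ x * om D j k z) * deriv η t * Ψ z| ≤ C * (τ⁻¹ * |χ x * om D j k z| * |Ψ z|) := by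
      rw [abs_mul, abs_mul]
      calc _ ≤ |χ x * om D j k z| * (C / τ) * |Ψ z| := by gcongr; exact e5 t
        _ = _ := by rw [div_eq_mul_inv]; ring
    have r2 : |om D j k z * (η t * lapz (fun z => χ z.1) z * Ψ z + 2 * η t * ∑ i, sdz (fun z => χ z.1) i z * sdz Ψ i z)| ≤
        2 * ‖D z‖ * (K * |Ψ z| + 2 * (K * ∑ i, |sdz Ψ i z|)) := by
      rw [abs_mul]
      gcongr
      · exact om_le _ _ _ _
      · refine (abs_add_le _ _).trans ?_
        gcongr
        · rw [abs_mul, abs_mul]; gcongr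
          exact (mul_le_mul hη (k2 z) (abs_nonneg _) zero_le_one).trans (by simp)
        · rw [abs_mul, abs_mul, abs_two, mul_assoc, Finset.mul_sum]
          gcongr 2 * ?_
          refine (mul_le_mul hη (Finset.abs_sum_le_sum_abs _ _) (abs_nonneg _) zero_le_one).trans ?_
          rw [one_mul]
          refine Finset.sum_le_sum fun i _ => ?_
          rw [abs_mul]; gcongr; exact k1 i z
    have r3 : |∑ l, v z l * (D z l k * sdz Φ j z - D z l j * sdz Φ k z)| ≤ 3 * (‖v z‖ * (‖D z‖ * (2 * (K * |Ψ z| + |χ x| * ∑ i, |sdz Ψ i z|)))) := by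
      refine (Finset.abs_sum_le_sum_abs _ _).trans ?_
      have : ∀ l ∈ Finset.univ, |v z l * (D z l k * sdz Φ j z - D z l j * sdz Φ k z)| ≤ (‖v z‖ * (‖D z‖ * (2 * (K * |Ψ z| + |χ x| * ∑ i, |sdz Ψ i z|)))) := by
        intro l _
        rw [abs_mul]
        gcongr
        · exact PiLp.norm_apply_le (v z) l
        · refine (abs_sub _ _).trans ?_
          rw [abs_mul, abs_mul]
          have w1 : |D z l k| * |sdz Φ j z| ≤ ‖D z‖ * (K * |Ψ z| + |χ x| * ∑ i, |sdz Ψ i z|) := by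
            gcongr
            · exact D_le _ _ _
            · exact d2 j
          have w2 : |D z l j| * |sdz Φ k z| ≤ ‖D z‖ * (K * |Ψ z| + |χ x| * ∑ i, |sdz Ψ i z|) := by
            gcongr
            · exact D_le _ _ _
            · exact d2 k
          linarith
      refine (Finset.sum_le_sum this).trans (by simp)
    refine (abs_add_le _ _).trans (add_le_add ((abs_add_le _ _).trans (add_le_add r1 r2)) r3) |>.trans ?_
    rw [hx1, abs_one]
    set P := |Ψ z|
    set Q := ∑ i, |sdz Ψ i z|
    have hP : 0 ≤ P := abs_nonneg _
    have hQ : 0 ≤ Q := Finset.sum_nonneg fun _ _ => abs_nonneg _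
    have a1 : 0 ≤ τ⁻¹ * |χ x * om D j k z| * P := by positivity
    have a2 : 0 ≤ ‖D z‖ * P := by positivity
    have a3 : 0 ≤ ‖D z‖ * Q := by positivity
    have a4 : 0 ≤ (|χ x| * ‖v z‖) * ‖D z‖ * Q := by positivity
    have a5 : 0 ≤ ‖v z‖ * ‖D z‖ * P := by positivity
    have b1 := mul_nonneg hK a1
    have b2 := mul_nonneg hK a2
    have b3 := mul_nonneg hK a3
    have b4 := mul_nonneg hK a4
    have b5 := mul_nonneg hK a5
    have c1 := mul_nonneg hC a1
    have c2 := mul_nonneg hC a2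
    have c3 := mul_nonneg hC a3
    have c4 := mul_nonneg hC a4
    have c5 := mul_nonneg hC a5
    nlinarith
  rw [← ofReal_norm, Real.norm_eq_abs]
  refine (ENNReal.ofReal_le_ofReal hR).trans (le_of_eq ?_)
  have n1 : 0 ≤ ∑ i, |sdz Ψ i z| := Finset.sum_nonneg fun _ _ => abs_nonneg _
  have ab : ∀ a : ℝ, ENNReal.ofReal |a| = ‖a‖ₑ := fun a => by rw [← ofReal_norm, Real.norm_eq_abs]
  have nn : 0 < τ⁻¹ := by positivity
  rw [ENNReal.ofReal_mul (by positivity)]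
  generalize ENNReal.ofReal (C + 10 * K + 6) = KK
  rw [ENNReal.ofReal_add (by positivity) (by positivity), ENNReal.ofReal_add (by positivity) (by positivity), ENNReal.ofReal_add (by positivity) (by positivity)]
  simp only [errI]
  congr 1
  have es : ENNReal.ofReal (∑ i, |sdz Ψ i z|) = ∑ i, ‖sdz Ψ i z‖ₑ := by
    rw [ENNReal.ofReal_sum_of_nonneg fun _ _ => abs_nonneg _]; simp only [ab]
  simp only [z] at es ⊢
  congr 1
  · congr 1
    · congr 1
      · rw [ENNReal.ofReal_mul (by positivity), ENNReal.ofReal_mul (by positivity), ab, ab]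
      · rw [ENNReal.ofReal_mul (by positivity), ENNReal.ofReal_add (by positivity) (by positivity), es, ab, ofReal_norm]
    · rw [ENNReal.ofReal_mul (by positivity), ENNReal.ofReal_mul (by positivity), ENNReal.ofReal_mul (by positivity), ENNReal.ofReal_mul (by positivity), es, ab, ab, ofReal_norm, ofReal_norm]
  · rw [ENNReal.ofReal_mul (by positivity), ENNReal.ofReal_mul (by positivity), ENNReal.ofReal_mul (by positivity), ENNReal.ofReal_mul (by positivity), ab, ab, ofReal_norm, ofReal_norm]

end

section
lemma gnsl {χ : E3 → ℝ} (h1 : Sm χ) (h2 : HasCompactSupport χ) : ∃ C : ℝ≥0∞, C ≠ ∞ ∧ ∀ h : E3 × ℝ → ℝ, Sm h → ∀ t,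
    (∫⁻ x, (‖χ x‖ₑ * ‖h (x, t)‖ₑ) ^ 6) ^ (1/3 : ℝ) ≤ C * ((∫⁻ x, ‖h (x, t)‖ₑ ^ 2) + ∑ l, ∫⁻ x, ‖sdz h l (x, t)‖ₑ ^ 2) := by
  obtain ⟨C, hC, hg⟩ := gns
  obtain ⟨K, hK, k0, k1, -⟩ := cutb h1 h2
  refine ⟨ENNReal.ofReal C * (6 * ENNReal.ofReal K ^ 2), by finiteness, fun h sh t => ?_⟩
  have sf : Sm fun x => χ x * h (x, t) := h1.mul (sm_slice sh t)
  have := hg _ sf h2.mul_right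
  simp only [enorm_mul] at this
  refine this.trans ?_
  rw [mul_assoc]
  gcongr ENNReal.ofReal C * ?_
  have ke : ∀ a : ℝ, |a| ≤ K → ‖a‖ₑ ≤ ENNReal.ofReal K := fun a ha => by rw [← ofReal_norm]; exact ENNReal.ofReal_le_ofReal ha
  have mh : Measurable fun x => ‖h (x, t)‖ₑ ^ 2 := ((sm_slice sh t).continuous.measurable.enorm).pow_const 2
  have b : ∀ i, ∫⁻ x, ‖fderiv ℝ (fun x => χ x * h (x, t)) x (bs i)‖ₑ ^ 2 ≤ 2 * ENNReal.ofReal K ^ 2 * ((∫⁻ x, ‖h (x, t)‖ₑ ^ 2) + ∫⁻ x, ‖sdz h i (x, t)‖ₑ ^ 2) := by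
    intro i
    rw [← lintegral_add_left mh, ← lintegral_const_mul' _ _ (by finiteness)]
    refine lintegral_mono fun x => ?_
    rw [dd_mul h1 (sm_slice sh t), slice_fderiv sh]
    refine (pow_le_pow_left' (enorm_add_le _ _) 2).trans ((sq2 _ _).trans ?_)
    rw [enorm_mul, enorm_mul, mul_pow, mul_pow, mul_assoc, mul_add (ENNReal.ofReal K ^ 2)]
    have q := k1 i (x, t)
    rw [sdz_fst h1] at q
    gcongr
    · exact ke _ q
    · exact ke _ (k0 x)
  refine (Finset.sum_le_sum fun i _ => b i).trans ?_
  rw [← Finset.mul_sum, Finset.sum_add_distrib]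
  simp only [Finset.sum_const, Finset.card_univ, Fintype.card_fin, nsmul_eq_mul]
  generalize (∫⁻ x, ‖h (x, t)‖ₑ ^ 2) = A
  generalize (∑ l, ∫⁻ x, ‖sdz h l (x, t)‖ₑ ^ 2) = B
  calc _ ≤ 2 * ENNReal.ofReal K ^ 2 * (3 * A + 3 * B) := by
        push_cast
        gcongr
        calc B = 1 * B := (one_mul _).symm
          _ ≤ _ := by gcongr; norm_num
    _ = _ := by ring
lemma le_rt {a Z : ℝ≥0∞} (h : a ^ 2 ≤ Z) : a ≤ Z ^ (1/2 : ℝ) := by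
  calc a = (a ^ 2) ^ (1/2 : ℝ) := by rw [← ENNReal.rpow_natCast, ← ENNReal.rpow_mul]; norm_num
    _ ≤ _ := by gcongr
lemma rt_sq (Z : ℝ≥0∞) : (Z ^ (1/2 : ℝ)) ^ 2 = Z := by rw [← ENNReal.rpow_natCast, ← ENNReal.rpow_mul]; norm_num
lemma dl_eq (I : Set ℝ) {f : E3 × ℝ → ℝ≥0∞} (hf : Measurable f) : ∫⁻ t in I, ∫⁻ x, f (x, t) = ∫⁻ z, f z ∂((volume : Measure E3).prod (volume.restrict I)) :=
  (lintegral_prod_symm f hf.aemeasurable).symm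
lemma dl_le (I : Set ℝ) {f : E3 × ℝ → ℝ≥0∞} (hf : Measurable f) : ∫⁻ t in I, ∫⁻ x, f (x, t) ≤ ∫⁻ z, f z := by
  rw [st_prod hf]; exact setLIntegral_le_lintegral _ _
lemma OM_meas {χ : E3 → ℝ} (h1 : Sm χ) {D} (mD : Measurable D) : Measurable (OM χ D) := by
  unfold OM
  refine Finset.measurable_sum _ fun j _ => Finset.measurable_sum _ fun k _ => ?_
  have mo : Measurable (om D j k) := by unfold om; fun_prop
  have : Measurable fun z : E3 × ℝ => ‖χ z.1 * om D j k z‖ₑ ^ 2 := (((h1.continuous.measurable.comp measurable_fst).mul mo).enorm).pow_const 2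
  exact sl_meas this
lemma OM_le {χ : E3 → ℝ} (h1 : Sm χ) (h2 : HasCompactSupport χ) (D) : ∃ C : ℝ≥0∞, C ≠ ∞ ∧ ∀ t, OM χ D t ≤ C * ∫⁻ x, ‖D (x, t)‖ₑ ^ 2 := by
  obtain ⟨K, hK, k0, -⟩ := cutb h1 h2
  refine ⟨9 * ENNReal.ofReal (K * 2) ^ 2, by finiteness, fun t => ?_⟩
  have : ∀ j k, ∫⁻ x, ‖χ x * om D j k (x, t)‖ₑ ^ 2 ≤ ENNReal.ofReal (K * 2) ^ 2 * ∫⁻ x, ‖D (x, t)‖ₑ ^ 2 := by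
    intro j k
    rw [← lintegral_const_mul' _ _ (by finiteness)]
    refine lintegral_mono fun x => ?_
    rw [← mul_pow]; gcongr
    rw [← ofReal_norm, ← ofReal_norm, ← ENNReal.ofReal_mul (by positivity)]
    refine ENNReal.ofReal_le_ofReal ?_
    rw [norm_mul, mul_assoc]; gcongr
    · exact k0 x
    · exact om_le D j k _
  refine (Finset.sum_le_sum fun j _ => Finset.sum_le_sum fun k _ => this j k).trans (le_of_eq ?_)
  simp; ring
set_option maxHeartbeats 2000000 in
lemma Loc.step1 {x0 t0 r v D} (L : Loc x0 t0 r v D) {χ χ1 : E3 → ℝ} (h1 : Sm χ) (h2 : HasCompactSupport χ) (h3 : tsupport χ ⊆ Metric.ball x0 r)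
    (h1' : Sm χ1) (h2' : HasCompactSupport χ1) (h3' : tsupport χ1 ⊆ Metric.ball x0 r) (h4 : ∀ x ∈ tsupport χ, χ1 x = 1)
    {l : ℝ} (hl0 : 0 ≤ l) (hl1 : l < 1) (hE : ∫⁻ t, Exf l (fun z => ‖D z‖ₑ) t < ∞) :
    ∃ C : ℝ≥0∞, C ≠ ∞ ∧ ∀ t1 τ θ b : ℝ, ∀ g : E3 × ℝ → ℝ, 0 < τ → t1 ≤ t0 → t0 - r ^ 2 ≤ t1 - τ → 0 < θ → θ ≤ 1/2 → b < t1 →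
      Sm g → HasCompactSupport g → (∀ z, b ≤ z.2 → g z = 0) → (∀ z, z.2 ≤ t1 - θ * τ → g z = 0) → ∀ j k,
      ‖∫ z, χ z.1 * om D j k z * g z‖ₑ ^ 2 ≤ C * ((ENNReal.ofReal θ + (∫⁻ t in Ioo (t1 - τ) t1, Exf l (fun z => ‖D z‖ₑ) t) ^ (1 - l)) *
        (∫⁻ t in Ioo (t1 - τ) t1, OM χ D t) + ENNReal.ofReal τ) * ∫⁻ z, ‖g z‖ₑ ^ 2 := by
  obtain ⟨K, hK, tst⟩ := L.tst h1 h2 h3 h4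
  obtain ⟨K1, hK1, k1, -⟩ := cutb h1' h2'
  obtain ⟨Cg, hCg, gn⟩ := gnsl h1' h2'
  obtain ⟨C5, hC5, v5⟩ := L.H5 h1 h2 h3
  obtain ⟨C6, hC6, v6⟩ := L.H5 h1' h2' h3'
  obtain ⟨C7, hC7, o7⟩ := OM_le h1' h2' D
  set E0 := ∫⁻ t, Exf l (fun z => ‖D z‖ₑ) t with hE0
  set B := ∫⁻ z, ‖D z‖ₑ ^ 2 with hB
  have hBf : B ≠ ∞ := L.D2.ne
  set R := ENNReal.ofReal (r ^ 2) with hR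
  have hE' : E0 ^ (1 - l) ≠ ∞ := (ENNReal.rpow_lt_top_of_nonneg (by linarith) hE.ne).ne
  set N := ENNReal.ofReal K1 ^ 2 + Cg * (R + 3) with hN
  have hNf : N ≠ ∞ := by finiteness
  set E := E0 ^ (1 - l) with hEE
  set A6 := ENNReal.ofReal C6 * (C7 * B + R) with hA6
  have hA6f : A6 ≠ ∞ := by finiteness
  set c0 := 1 + B * R + B + ENNReal.ofReal C5 * N * (1 + E) + A6 * N * E with hc0
  have hc0f : c0 ≠ ∞ := by finiteness
  refine ⟨ENNReal.ofReal K ^ 2 * (81 * c0), by finiteness, fun t1 τ θ b g hτ ht1 ht0 hθ hθ2 hb hg hgc g1 g2 j k => ?_⟩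
  have tτ : τ ≤ r ^ 2 := by linarith
  have hθτ : θ * τ ≤ τ / 2 := by nlinarith
  have hm := tst t1 τ τ b g hτ le_rfl ht1 ht0 hb hg hgc g1 (fun z hz => g2 z (by linarith)) j k
  have g1' : ∀ z : E3 × ℝ, t1 ≤ z.2 → g z = 0 := fun z hz => g1 z (hb.le.trans hz)
  obtain ⟨p1, p2⟩ := psi_pack hτ le_rfl hg hgc g1'
  have H : IsP (gM 1 τ) (pot 1 τ g) := ⟨g, hg, hgc, rfl⟩
  have p0 := pot_l2 (S := τ) (a := t1 - θ * τ) (L := θ * τ) (by positivity) hg (fun z hz => by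
    by_cases q : t1 ≤ z.2
    · exact g1' z q
    · refine g2 z ?_
      by_contra q2; exact hz ⟨by linarith, by linarith⟩)
  have sΨ : Sm (pot 1 τ g) := H.sm
  have s1 : ∀ i, Sm (sdz (pot 1 τ g) i) := fun i => sΨ.sdz i
  have s2 : ∀ i l, Sm (sdz (sdz (pot 1 τ g) i) l) := fun i l => (s1 i).sdz l
  generalize pot 1 τ g = Ψ at *
  clear H tst
  set I := Ioo (t1 - τ) t1 with hI
  set ε := ∫⁻ t in I, Exf l (fun z => ‖D z‖ₑ) t with hε
  set Y := ∫⁻ t in I, OM χ D t with hY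
  set G2 := ∫⁻ z, ‖g z‖ₑ ^ 2 with hG2
  have hεE : ε ^ (1 - l) ≤ E := ENNReal.rpow_le_rpow (setLIntegral_le_lintegral _ _) (by linarith)
  have hIv : volume I = ENNReal.ofReal τ := by simp [hI]
  set T := ENNReal.ofReal τ with hT
  have hTR : T ≤ R := ENNReal.ofReal_le_ofReal tτ
  set Θ := ENNReal.ofReal θ with hΘ
  have hΘ1 : Θ ≤ 1 := by rw [hΘ, ← ENNReal.ofReal_one]; exact ENNReal.ofReal_le_ofReal (by linarith)
  have hΘT : ENNReal.ofReal (θ * τ) = Θ * T := ENNReal.ofReal_mul hθ.le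
  set Z := ((Θ + ε ^ (1 - l)) * Y + T) * G2 with hZ
  have ZT : T * G2 ≤ Z := by rw [hZ]; gcongr; exact le_add_self
  -- measurability
  have mo : Measurable (om D j k) := by have := L.mD; unfold om; fun_prop
  have mχ : Measurable fun z : E3 × ℝ => ‖χ z.1‖ₑ := (h1.continuous.measurable.comp measurable_fst).enorm
  have mχ1 : Measurable fun z : E3 × ℝ => ‖χ1 z.1‖ₑ := (h1'.continuous.measurable.comp measurable_fst).enorm
  have mco : Measurable fun z : E3 × ℝ => ‖χ z.1 * om D j k z‖ₑ := ((h1.continuous.measurable.comp measurable_fst).mul mo).enorm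
  have mD : Measurable fun z => ‖D z‖ₑ := L.mD.enorm
  have mv : Measurable fun z => ‖v z‖ₑ := L.mv.enorm
  have mP : Measurable fun z => ‖Ψ z‖ₑ := sΨ.continuous.measurable.enorm
  have mPi : ∀ i, Measurable fun z => ‖sdz Ψ i z‖ₑ := fun i => (s1 i).continuous.measurable.enorm
  have mPil : ∀ i l, Measurable fun z => ‖sdz (sdz Ψ i) l z‖ₑ := fun i l => (s2 i l).continuous.measurable.enorm
  set μ := (volume : Measure E3).prod (volume.restrict I) with hμ
  -- basic bounds
  have q0 : ∫⁻ t in I, ∫⁻ x, ‖Ψ (x, t)‖ₑ ^ 2 ≤ T * (Θ * T * G2) := by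
    calc _ ≤ ∫⁻ t in I, Θ * T * G2 := lintegral_mono fun t => by rw [← hΘT]; exact p0 t
      _ = _ := by rw [setLIntegral_const, hIv, mul_comm]
  have q1 : ∀ i, ∫⁻ t in I, ∫⁻ x, ‖sdz Ψ i (x, t)‖ₑ ^ 2 ≤ T * G2 := by
    intro i
    calc _ ≤ ∫⁻ t in I, G2 := setLIntegral_mono measurable_const fun t ht => p1 t ht i
      _ = _ := by rw [setLIntegral_const, hIv, mul_comm]
  have q0' : T * (Θ * T * G2) ≤ R * (T * G2) := by
    calc _ = Θ * (T * (T * G2)) := by ring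
      _ ≤ 1 * (R * (T * G2)) := by gcongr
      _ = _ := one_mul _
  have DB : ∫⁻ z, ‖D z‖ₑ ^ 2 ∂μ ≤ B := by
    rw [← dl_eq I (mD.pow_const 2)]; exact dl_le I (mD.pow_const 2)
  have k1e : ∀ x, ‖χ1 x‖ₑ ≤ ENNReal.ofReal K1 := fun x => by rw [← ofReal_norm]; exact ENNReal.ofReal_le_ofReal (k1 x)
  have cN : ∀ (h : E3 × ℝ → ℝ) (t : ℝ), ∫⁻ x, (‖χ1 x‖ₑ * ‖h (x, t)‖ₑ) ^ 2 ≤ ENNReal.ofReal K1 ^ 2 * ∫⁻ x, ‖h (x, t)‖ₑ ^ 2 := by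
    intro h t
    rw [← lintegral_const_mul' _ _ (by finiteness)]
    refine lintegral_mono fun x => ?_
    rw [mul_pow]; gcongr; exact k1e x
  have cG : ∀ h : E3 × ℝ → ℝ, Sm h → ∫⁻ t in I, (∫⁻ x, (‖χ1 x‖ₑ * ‖h (x, t)‖ₑ) ^ 6) ^ (1/3 : ℝ) ≤
      Cg * ((∫⁻ t in I, ∫⁻ x, ‖h (x, t)‖ₑ ^ 2) + ∑ l, ∫⁻ t in I, ∫⁻ x, ‖sdz h l (x, t)‖ₑ ^ 2) := by
    intro h sh
    refine (lintegral_mono fun t => gn h sh t).trans (le_of_eq ?_)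
    have m0 : Measurable fun z => ‖h z‖ₑ ^ 2 := sh.continuous.measurable.enorm.pow_const 2
    have m1 : ∀ l, Measurable fun z => ‖sdz h l z‖ₑ ^ 2 := fun l => (sh.sdz l).continuous.measurable.enorm.pow_const 2
    rw [lintegral_const_mul' _ _ hCg, lintegral_add_left (sl_meas m0), lintegral_finsetSum _ fun l _ => sl_meas (m1 l)]
  -- the terms
  have t1b : (∫⁻ z, ENNReal.ofReal τ⁻¹ * ‖χ z.1 * om D j k z‖ₑ * ‖Ψ z‖ₑ ∂μ) ^ 2 ≤ c0 * Z := by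
    have e : ∫⁻ z, ENNReal.ofReal τ⁻¹ * ‖χ z.1 * om D j k z‖ₑ * ‖Ψ z‖ₑ ∂μ = ENNReal.ofReal τ⁻¹ * ∫⁻ z, ‖χ z.1 * om D j k z‖ₑ * ‖Ψ z‖ₑ ∂μ := by
      rw [← lintegral_const_mul' _ _ ofReal_ne_top]; simp only [mul_assoc]
    have y1 : ∫⁻ z, ‖χ z.1 * om D j k z‖ₑ ^ 2 ∂μ ≤ Y := by
      rw [← dl_eq I (mco.pow_const 2)]
      refine lintegral_mono fun t => ?_
      exact (Finset.single_le_sum (f := fun k => ∫⁻ x, ‖χ x * om D j k (x, t)‖ₑ ^ 2) (fun i _ => zero_le) (Finset.mem_univ k)).trans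
          (Finset.single_le_sum (f := fun i => ∑ l, ∫⁻ x, ‖χ x * om D i l (x, t)‖ₑ ^ 2) (fun i _ => zero_le) (Finset.mem_univ j))
    have y2 : ∫⁻ z, ‖Ψ z‖ₑ ^ 2 ∂μ ≤ T * (Θ * T * G2) := by rw [← dl_eq I (mP.pow_const 2)]; exact q0
    have tt : ENNReal.ofReal τ⁻¹ * T = 1 := by rw [hT, ← ENNReal.ofReal_mul (by positivity), inv_mul_cancel₀ hτ.ne', ENNReal.ofReal_one]
    rw [e, mul_pow]
    calc _ ≤ ENNReal.ofReal τ⁻¹ ^ 2 * (Y * (T * (Θ * T * G2))) := by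
          gcongr ENNReal.ofReal τ⁻¹ ^ 2 * ?_
          exact (cs_lint mco.aemeasurable mP.aemeasurable).trans (mul_le_mul' y1 y2)
      _ = (ENNReal.ofReal τ⁻¹ * T) ^ 2 * (Θ * Y * G2) := by ring
      _ = 1 * (Θ * Y * G2) := by rw [tt]; ring
      _ ≤ c0 * Z := by
        gcongr
        · rw [hc0]; simp only [add_assoc]; exact le_self_add
        · rw [hZ]; gcongr ?_ * G2
          calc Θ * Y ≤ (Θ + ε ^ (1 - l)) * Y := by gcongr; exact le_self_add
            _ ≤ _ := le_self_add
  have c1 : B * R ≤ c0 := by rw [hc0]; refine le_trans ?_ (le_add_right (le_add_right (le_add_right le_rfl))); exact le_add_self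
  have c2 : B ≤ c0 := by rw [hc0]; refine le_trans ?_ (le_add_right (le_add_right le_rfl)); exact le_add_self
  have c3 : ENNReal.ofReal C5 * N * (1 + E) ≤ c0 := by rw [hc0]; refine le_trans ?_ (le_add_right le_rfl); exact le_add_self
  have c4 : A6 * N * E ≤ c0 := by rw [hc0]; exact le_add_self
  have t2b : (∫⁻ z, ‖D z‖ₑ * ‖Ψ z‖ₑ ∂μ) ^ 2 ≤ c0 * Z := by
    have y2 : ∫⁻ z, ‖Ψ z‖ₑ ^ 2 ∂μ ≤ R * (T * G2) := by rw [← dl_eq I (mP.pow_const 2)]; exact q0.trans q0'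
    refine (cs_lint mD.aemeasurable mP.aemeasurable).trans ((mul_le_mul' DB y2).trans ?_)
    rw [← mul_assoc]; exact mul_le_mul' c1 ZT
  have t3b : ∀ i, (∫⁻ z, ‖D z‖ₑ * ‖sdz Ψ i z‖ₑ ∂μ) ^ 2 ≤ c0 * Z := by
    intro i
    have y2 : ∫⁻ z, ‖sdz Ψ i z‖ₑ ^ 2 ∂μ ≤ (T * G2) := by rw [← dl_eq I ((mPi i).pow_const 2)]; exact q1 i
    exact (cs_lint mD.aemeasurable (mPi i).aemeasurable).trans ((mul_le_mul' DB y2).trans (mul_le_mul' c2 ZT))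
  have t4b : ∀ i, (∫⁻ z, (‖χ z.1‖ₑ * ‖v z‖ₑ) * ‖D z‖ₑ * (‖χ1 z.1‖ₑ * ‖sdz Ψ i z‖ₑ) ∂μ) ^ 2 ≤ c0 * Z := by
    intro i
    have mA : Measurable fun z : E3 × ℝ => ‖χ z.1‖ₑ * ‖v z‖ₑ := mχ.mul mv
    have mG : Measurable fun z : E3 × ℝ => ‖χ1 z.1‖ₑ * ‖sdz Ψ i z‖ₑ := mχ1.mul (mPi i)
    have hn := HN hl0 hl1 mA mD mG (μ := volume.restrict I) (N := N * G2) (by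
        filter_upwards [ae_restrict_mem measurableSet_Ioo] with t ht
        refine (cN _ t).trans ?_
        rw [hN]
        exact mul_le_mul' le_self_add (p1 t ht i)) (by
        refine (cG _ (s1 i)).trans ?_
        calc _ ≤ Cg * (R * G2 + ∑ l : Fin 3, G2) := by
              gcongr with l
              · exact (q1 i).trans (by gcongr)
              · exact p2 i l
          _ = Cg * (R + 3) * G2 := by simp; ring
          _ ≤ _ := by rw [hN]; gcongr; exact le_add_self)
    rw [dl_eq I (f := fun z => (‖χ z.1‖ₑ * ‖v z‖ₑ) * ‖D z‖ₑ * (‖χ1 z.1‖ₑ * ‖sdz Ψ i z‖ₑ)) ((mA.mul mD).mul mG)] at hn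
    refine hn.trans ?_
    have a5 : ∫⁻ t in I, (∫⁻ x, (‖χ x‖ₑ * ‖v (x, t)‖ₑ) ^ 6) ^ (1/3 : ℝ) ≤ ENNReal.ofReal C5 * (Y + T) := by
      calc _ ≤ ∫⁻ t in I, ENNReal.ofReal C5 * (OM χ D t + 1) := lintegral_mono_ae ((ae_restrict_of_ae v5).mono fun t ht => ht.1)
        _ = _ := by rw [lintegral_const_mul' _ _ ofReal_ne_top, lintegral_add_right _ measurable_const, setLIntegral_const, hIv, one_mul]
    calc _ ≤ ENNReal.ofReal C5 * (Y + T) * ε ^ (1 - l) * (N * G2) := by gcongr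
      _ = ENNReal.ofReal C5 * N * ((ε ^ (1 - l) * Y + ε ^ (1 - l) * T) * G2) := by ring
      _ ≤ ENNReal.ofReal C5 * N * (((1 + E) * (ε ^ (1 - l) * Y) + (1 + E) * T) * G2) := by
        gcongr ENNReal.ofReal C5 * N * (?_ * G2)
        refine add_le_add ?_ (mul_le_mul_left (hεE.trans le_add_self) T)
        have h1E : (1 : ℝ≥0∞) ≤ 1 + E := le_self_add
        exact (one_mul _).symm.le.trans (mul_le_mul_left h1E _)
      _ = ENNReal.ofReal C5 * N * (1 + E) * ((ε ^ (1 - l) * Y + T) * G2) := by ring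
      _ ≤ c0 * Z := by
        rw [hZ]
        gcongr
        exact le_add_self
  have t5b : (∫⁻ z, (‖χ1 z.1‖ₑ * ‖v z‖ₑ) * ‖D z‖ₑ * (‖χ1 z.1‖ₑ * ‖Ψ z‖ₑ) ∂μ) ^ 2 ≤ c0 * Z := by
    have mA : Measurable fun z : E3 × ℝ => ‖χ1 z.1‖ₑ * ‖v z‖ₑ := mχ1.mul mv
    have mG : Measurable fun z : E3 × ℝ => ‖χ1 z.1‖ₑ * ‖Ψ z‖ₑ := mχ1.mul mP
    have hn := HN hl0 hl1 mA mD mG (μ := volume.restrict I) (N := N * (T * G2)) (by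
        filter_upwards [ae_restrict_mem measurableSet_Ioo] with t ht
        refine (cN _ t).trans ?_
        rw [hN]
        refine mul_le_mul' le_self_add ((p0 t).trans ?_)
        rw [hΘT, mul_assoc]
        exact mul_le_of_le_one_left zero_le hΘ1) (by
        refine (cG _ sΨ).trans ?_
        calc _ ≤ Cg * (R * (T * G2) + ∑ l : Fin 3, T * G2) := by
              gcongr with l
              · exact q0.trans q0'
              · exact q1 l
          _ = Cg * (R + 3) * (T * G2) := by simp; ring
          _ ≤ _ := by rw [hN]; gcongr; exact le_add_self)
    rw [dl_eq I (f := fun z => (‖χ1 z.1‖ₑ * ‖v z‖ₑ) * ‖D z‖ₑ * (‖χ1 z.1‖ₑ * ‖Ψ z‖ₑ)) ((mA.mul mD).mul mG)] at hn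
    refine hn.trans ?_
    have a6 : ∫⁻ t in I, (∫⁻ x, (‖χ1 x‖ₑ * ‖v (x, t)‖ₑ) ^ 6) ^ (1/3 : ℝ) ≤ A6 := by
      calc _ ≤ ∫⁻ t in I, ENNReal.ofReal C6 * (OM χ1 D t + 1) := lintegral_mono_ae ((ae_restrict_of_ae v6).mono fun t ht => ht.1)
        _ = ENNReal.ofReal C6 * ((∫⁻ t in I, OM χ1 D t) + T) := by
          rw [lintegral_const_mul' _ _ ofReal_ne_top, lintegral_add_right _ measurable_const, setLIntegral_const, hIv, one_mul]
        _ ≤ _ := by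
          rw [hA6]; gcongr
          refine (lintegral_mono fun t => o7 t).trans ?_
          rw [lintegral_const_mul' _ _ hC7]
          gcongr
          exact dl_le I (mD.pow_const 2)
    calc _ ≤ A6 * E * (N * (T * G2)) := by gcongr
      _ = A6 * N * E * (T * G2) := by ring
      _ ≤ c0 * Z := mul_le_mul' c4 ZT
  set W := (c0 * Z) ^ (1/2 : ℝ) with hW
  have split : ∫⁻ t in I, ∫⁻ x, errI χ χ1 v D τ j k Ψ (x, t) = (∫⁻ z, ENNReal.ofReal τ⁻¹ * ‖χ z.1 * om D j k z‖ₑ * ‖Ψ z‖ₑ ∂μ) + ((∫⁻ z, ‖D z‖ₑ * ‖Ψ z‖ₑ ∂μ)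
      + (∑ i, ∫⁻ z, ‖D z‖ₑ * ‖sdz Ψ i z‖ₑ ∂μ)) + (∑ i, ∫⁻ z, (‖χ z.1‖ₑ * ‖v z‖ₑ) * ‖D z‖ₑ * (‖χ1 z.1‖ₑ * ‖sdz Ψ i z‖ₑ) ∂μ) +
      ∫⁻ z, (‖χ1 z.1‖ₑ * ‖v z‖ₑ) * ‖D z‖ₑ * (‖χ1 z.1‖ₑ * ‖Ψ z‖ₑ) ∂μ := by
    have a1 : Measurable fun z : E3 × ℝ => ENNReal.ofReal τ⁻¹ * ‖χ z.1 * om D j k z‖ₑ * ‖Ψ z‖ₑ := (mco.const_mul _).mul mP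
    have a2 : Measurable fun z => ‖D z‖ₑ * ‖Ψ z‖ₑ := mD.mul mP
    have a3 : ∀ i, Measurable fun z => ‖D z‖ₑ * ‖sdz Ψ i z‖ₑ := fun i => mD.mul (mPi i)
    have a4 : ∀ i, Measurable fun z : E3 × ℝ => (‖χ z.1‖ₑ * ‖v z‖ₑ) * ‖D z‖ₑ * (‖χ1 z.1‖ₑ * ‖sdz Ψ i z‖ₑ) := fun i => ((mχ.mul mv).mul mD).mul (mχ1.mul (mPi i))
    have a5 : Measurable fun z : E3 × ℝ => (‖χ1 z.1‖ₑ * ‖v z‖ₑ) * ‖D z‖ₑ * (‖χ1 z.1‖ₑ * ‖Ψ z‖ₑ) := ((mχ1.mul mv).mul mD).mul (mχ1.mul mP)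
    have a3' := Finset.measurable_sum Finset.univ fun i _ => a3 i
    have a4' := Finset.measurable_sum Finset.univ fun i _ => a4 i
    have eI : errI χ χ1 v D τ j k Ψ = fun z => ENNReal.ofReal τ⁻¹ * ‖χ z.1 * om D j k z‖ₑ * ‖Ψ z‖ₑ + (‖D z‖ₑ * ‖Ψ z‖ₑ + ∑ i, ‖D z‖ₑ * ‖sdz Ψ i z‖ₑ)
        + (∑ i, (‖χ z.1‖ₑ * ‖v z‖ₑ) * ‖D z‖ₑ * (‖χ1 z.1‖ₑ * ‖sdz Ψ i z‖ₑ)) + (‖χ1 z.1‖ₑ * ‖v z‖ₑ) * ‖D z‖ₑ * (‖χ1 z.1‖ₑ * ‖Ψ z‖ₑ) := by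
      funext z; simp only [errI, mul_add, Finset.mul_sum]
    have mE : Measurable (errI χ χ1 v D τ j k Ψ) := by rw [eI]; exact ((a1.add (a2.add a3')).add a4').add a5
    rw [dl_eq I mE, eI]
    rw [lintegral_add_right _ a5, lintegral_add_right _ a4', lintegral_add_left a1, lintegral_add_left a2,
      lintegral_finsetSum _ fun i _ => a3 i, lintegral_finsetSum _ fun i _ => a4 i]
  have tot : ∫⁻ t in I, ∫⁻ x, errI χ χ1 v D τ j k Ψ (x, t) ≤ 9 * W := by
    rw [split]
    calc _ ≤ W + (W + ∑ i : Fin 3, W) + (∑ i : Fin 3, W) + W := by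
          gcongr with i _ i
          · exact le_rt t1b
          · exact le_rt t2b
          · exact le_rt (t3b i)
          · exact le_rt (t4b i)
          · exact le_rt t5b
      _ = _ := by simp; ring
  calc _ ≤ (ENNReal.ofReal K * (9 * W)) ^ 2 := by
        gcongr; exact hm.trans (by gcongr)
    _ = ENNReal.ofReal K ^ 2 * (81 * W ^ 2) := by ring
    _ = _ := by rw [hW, rt_sq]; ring

end

section
open scoped Topology
lemma dual0 {F : E3 × ℝ → ℝ} (mF : Measurable F) (hF : ∫⁻ z, ‖F z‖ₑ ^ 2 < ∞) {K : ℝ≥0∞}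
    (h : ∀ g : E3 × ℝ → ℝ, Sm g → HasCompactSupport g → ‖∫ z, F z * g z‖ₑ ^ 2 ≤ K * ∫⁻ z, ‖g z‖ₑ ^ 2) : ∫⁻ z, ‖F z‖ₑ ^ 2 ≤ 10 * K := by
  set A := ∫⁻ z, ‖F z‖ₑ ^ 2 with hA
  by_cases hA0 : A = 0
  · rw [hA0]; exact zero_le
  have ha : 0 < A.toReal := ENNReal.toReal_pos hA0 hF.ne
  have hm : MemLp F 2 := ⟨mF.aestronglyMeasurable, by
      rw [eLpNorm_lt_top_iff_lintegral_rpow_enorm_lt_top (by simp) (by simp)]; simpa using hF⟩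
  obtain ⟨g, gc, gs, ge⟩ := hm.exist_eLpNorm_sub_le (by simp) (by simp) (ε := √(A.toReal / 4)) (by positivity)
  have gs : Sm g := gs
  have e : ∫⁻ z, ‖F z - g z‖ₑ ^ 2 ≤ A / 4 := by
    rw [eLpNorm_eq_lintegral_rpow_enorm_toReal (by simp) (by simp)] at ge
    have := pow_le_pow_left' ge 2
    rw [← ENNReal.ofReal_pow (by positivity), Real.sq_sqrt (by positivity), ENNReal.ofReal_div_of_pos (by norm_num), ENNReal.ofReal_toReal hF.ne,
      ← ENNReal.rpow_natCast, ← ENNReal.rpow_mul] at this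
    simpa using this
  have mg : Measurable g := gs.continuous.measurable
  have g2 : ∫⁻ z, ‖g z‖ₑ ^ 2 ≤ 2 * (A + A / 4) := by
    calc _ ≤ ∫⁻ z, 2 * (‖F z‖ₑ ^ 2 + ‖F z - g z‖ₑ ^ 2) := by
          refine lintegral_mono fun z => ?_
          refine le_trans (pow_le_pow_left' ?_ 2) (sq2 _ _)
          calc ‖g z‖ₑ = ‖F z - (F z - g z)‖ₑ := by simp
            _ ≤ _ := enorm_sub_le
      _ ≤ _ := by
        rw [lintegral_const_mul' _ _ (by simp), lintegral_add_left (mF.enorm.pow_const 2)]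
        gcongr
  have hg2 : ∫⁻ z, ‖g z‖ₑ ^ 2 < ∞ := g2.trans_lt (by exact (ENNReal.mul_ne_top (by simp) (ENNReal.add_ne_top.2 ⟨hF.ne, ENNReal.div_ne_top hF.ne (by simp)⟩)).lt_top)
  have i1 : Integrable fun z => F z * g z := by
    have := l2_mul mF.aestronglyMeasurable mg.aestronglyMeasurable hF hg2
    exact this.mono' (mF.mul mg).aestronglyMeasurable (ae_of_all _ fun z => (norm_mul _ _).le)
  have key : A ≤ ‖∫ z, F z * g z‖ₑ + ∫⁻ z, ‖F z‖ₑ * ‖F z - g z‖ₑ := by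
    have iF : Integrable fun z => F z ^ 2 := by simpa using hm.integrable_sq
    have : A = ‖∫ z, F z ^ 2‖ₑ := by
      rw [hA, li_sq2 iF, Real.enorm_eq_ofReal (integral_nonneg fun z => sq_nonneg _)]
    rw [this]
    have i2 : Integrable fun z => F z * (F z - g z) := (iF.sub i1).congr (ae_of_all _ fun z => by simp; ring)
    have : ∫ z, F z ^ 2 = (∫ z, F z * g z) + ∫ z, F z * (F z - g z) := by
      rw [← integral_add i1 i2]; congr 1; funext z; ring
    rw [this]
    refine (enorm_add_le _ _).trans ?_
    gcongr
    refine (enorm_integral_le_lintegral_enorm _).trans (le_of_eq ?_)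
    simp only [enorm_mul]
  have k2 : A ^ 2 ≤ 2 * (K * (2 * (A + A / 4)) + A * (A / 4)) := by
    refine (pow_le_pow_left' key 2).trans ((sq2 _ _).trans ?_)
    gcongr
    · exact (h g gs gc).trans (by gcongr)
    · exact (cs_lint mF.enorm.aemeasurable (mF.sub mg).enorm.aemeasurable).trans (by gcongr; exact e)
  by_cases hK : K = ∞
  · rw [hK]; simp
  have hr := ENNReal.toReal_mono (by have := hF.ne; finiteness) k2
  have hAf := hF.ne
  have hA4 : A / 4 ≠ ∞ := by finiteness
  rw [ENNReal.toReal_pow, ENNReal.toReal_mul, ENNReal.toReal_add (by finiteness) (by finiteness), ENNReal.toReal_mul, ENNReal.toReal_mul, ENNReal.toReal_mul,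
    ENNReal.toReal_add hAf hA4, ENNReal.toReal_div] at hr
  norm_num at hr
  rw [← ENNReal.toReal_le_toReal hAf (by finiteness), ENNReal.toReal_mul]
  norm_num
  nlinarith
lemma dual {f : E3 × ℝ → ℝ} (mf : Measurable f) (hf : ∫⁻ z, ‖f z‖ₑ ^ 2 < ∞) {K : ℝ≥0∞} {a t1 : ℝ} (hat : a < t1)
    (h : ∀ b < t1, ∀ g : E3 × ℝ → ℝ, Sm g → HasCompactSupport g → (∀ z, b ≤ z.2 → g z = 0) → (∀ z, z.2 ≤ a → g z = 0) →
      ‖∫ z, f z * g z‖ₑ ^ 2 ≤ K * ∫⁻ z, ‖g z‖ₑ ^ 2) : ∫⁻ t in Ioo a t1, ∫⁻ x, ‖f (x, t)‖ₑ ^ 2 ≤ 10 * K := by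
  set c := (a + t1) / 2 with hc
  set d := (t1 - a) / 2 with hd
  have d0 : 0 < d := by rw [hd]; linarith
  have np : ∀ n : ℕ, (0 : ℝ) < n + 3 := fun n => by positivity
  let ζ : ∀ n : ℕ, ContDiffBump c := fun n => ⟨d * (1 - 2 / ((n : ℝ) + 3)), d * (1 - 1 / ((n : ℝ) + 3)), mul_pos d0 (by
      rw [sub_pos, div_lt_one (np n)]; have : (0 : ℝ) ≤ n := n.cast_nonneg; linarith), by
      gcongr; norm_num⟩
  have z1 : ∀ n t, ‖ζ n t‖ₑ ≤ 1 := fun n t => by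
    rw [Real.enorm_eq_ofReal (ζ n).nonneg, ← ENNReal.ofReal_one]; exact ENNReal.ofReal_le_ofReal (ζ n).le_one
  have ms : ∀ n, Measurable fun z : E3 × ℝ => ζ n z.2 := fun n => (ζ n).continuous.measurable.comp measurable_snd
  have zs : ∀ n, Sm fun z : E3 × ℝ => ζ n z.2 := fun n => ((ζ n).contDiff (n := (⊤ : ℕ∞))).comp contDiff_snd
  have main : ∀ n, ∫⁻ z, ‖ζ n z.2 * f z‖ₑ ^ 2 ≤ 10 * K := by
    intro n
    refine dual0 (F := fun z => ζ n z.2 * f z) ((ms n).mul mf) (lt_of_le_of_lt (lintegral_mono fun z => ?_) hf) fun g hg gc => ?_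
    · rw [enorm_mul]; gcongr; exact mul_le_of_le_one_left zero_le (z1 n _)
    · have z0 : ∀ z : E3 × ℝ, d * (1 - 1 / ((n : ℝ) + 3)) ≤ |z.2 - c| → ζ n z.2 = 0 := fun z hz => by
        have : z.2 ∉ Function.support (ζ n) := by
          rw [(ζ n).support_eq, Metric.mem_ball, Real.dist_eq]; exact not_lt.2 hz
        simpa using this
      have w : d * (1 - 1 / ((n : ℝ) + 3)) < d := by
        have : 0 < 1 / ((n : ℝ) + 3) := by have := np n; positivity
        nlinarith
      have := h (c + d * (1 - 1 / ((n : ℝ) + 3))) (by rw [hc]; linarith) (fun z => ζ n z.2 * g z) ((zs n).mul hg) gc.mul_left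
        (fun z hz => by rw [z0 z ((by linarith : _ ≤ z.2 - c).trans (le_abs_self _)), zero_mul])
        (fun z hz => by rw [z0 z ((by linarith : _ ≤ -(z.2 - c)).trans (neg_le_abs _)), zero_mul])
      calc _ = ‖∫ z, f z * (ζ n z.2 * g z)‖ₑ ^ 2 := by congr 2; refine integral_congr_ae (ae_of_all _ fun z => ?_); dsimp only; ring
        _ ≤ _ := this
        _ ≤ _ := by
          gcongr with z
          rw [enorm_mul]; exact mul_le_of_le_one_left zero_le (z1 n _)
  rw [dl_eq _ (mf.enorm.pow_const 2)]
  refine fatou_pow (u := fun n z => ζ n z.2 * f z) (fun n => ((ms n).mul mf).aemeasurable) ?_ 2 fun n => ?_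
  · have : ∀ᵐ z ∂((volume : Measure E3).prod (volume.restrict (Ioo a t1))), z.2 ∈ Ioo a t1 :=
      Measure.quasiMeasurePreserving_snd.ae (ae_restrict_mem measurableSet_Ioo)
    filter_upwards [this] with z hz
    have hlt : |z.2 - c| < d := by rw [abs_lt, hc, hd]; constructor <;> linarith [hz.1, hz.2]
    have lim : Tendsto (fun n : ℕ => d * (1 - 2 / ((n : ℝ) + 3))) atTop (𝓝 (d * (1 - 0))) := by
      refine (tendsto_const_nhds.sub ?_).const_mul d
      exact tendsto_const_nhds.div_atTop (tendsto_atTop_add_const_right _ _ tendsto_natCast_atTop_atTop)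
    have ev := lim.eventually (lt_mem_nhds (a := |z.2 - c|) (by simpa using hlt))
    refine tendsto_const_nhds.congr' (ev.mono fun n hn => ?_)
    dsimp only
    rw [(ζ n).one_of_mem_closedBall (by rw [Metric.mem_closedBall, Real.dist_eq]; exact hn.le), one_mul]
  · rw [← dl_eq (f := fun z => ‖ζ n z.2 * f z‖ₑ ^ 2) _ (((ms n).mul mf).enorm.pow_const 2)]
    exact (dl_le (f := fun z => ‖ζ n z.2 * f z‖ₑ ^ 2) _ (((ms n).mul mf).enorm.pow_const 2)).trans (main n)
lemma Loc.decay {x0 t0 r v D} (L : Loc x0 t0 r v D) {χ χ1 : E3 → ℝ} (h1 : Sm χ) (h2 : HasCompactSupport χ) (h3 : tsupport χ ⊆ Metric.ball x0 r)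
    (h1' : Sm χ1) (h2' : HasCompactSupport χ1) (h3' : tsupport χ1 ⊆ Metric.ball x0 r) (h4 : ∀ x ∈ tsupport χ, χ1 x = 1)
    {l : ℝ} (hl0 : 0 ≤ l) (hl1 : l < 1) (hE : ∫⁻ t, Exf l (fun z => ‖D z‖ₑ) t < ∞) :
    ∃ C : ℝ≥0∞, C ≠ ∞ ∧ ∀ t1 τ θ : ℝ, 0 < τ → t1 ≤ t0 → t0 - r ^ 2 ≤ t1 - τ → 0 < θ → θ ≤ 1/2 →
      (∫⁻ t in Ioo (t1 - θ * τ) t1, OM χ D t) ≤ C * ((ENNReal.ofReal θ + (∫⁻ t in Ioo (t1 - τ) t1, Exf l (fun z => ‖D z‖ₑ) t) ^ (1 - l)) *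
        (∫⁻ t in Ioo (t1 - τ) t1, OM χ D t) + ENNReal.ofReal τ) := by
  obtain ⟨C, hC, H⟩ := L.step1 h1 h2 h3 h1' h2' h3' h4 hl0 hl1 hE
  refine ⟨90 * C, by finiteness, fun t1 τ θ hτ ht1 ht0 hθ hθ2 => ?_⟩
  have mo : ∀ j k, Measurable fun z : E3 × ℝ => χ z.1 * om D j k z := fun j k => by
    have := L.mD
    have mo : Measurable (om D j k) := by unfold om; fun_prop
    exact (h1.continuous.measurable.comp measurable_fst).mul mo
  have lo : ∀ j k, ∫⁻ z : E3 × ℝ, ‖χ z.1 * om D j k z‖ₑ ^ 2 < ∞ := fun j k => by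
    obtain ⟨C7, hC7, o7⟩ := OM_le h1 h2 D
    rw [st_prod ((mo j k).enorm.pow_const 2)]
    refine lt_of_le_of_lt (lintegral_mono (g := fun t => C7 * ∫⁻ x, ‖D (x, t)‖ₑ ^ 2) fun t => ?_) ?_
    · exact (((Finset.single_le_sum (f := fun k => ∫⁻ x, ‖χ x * om D j k (x, t)‖ₑ ^ 2) (fun i _ => zero_le) (Finset.mem_univ k)).trans
          (Finset.single_le_sum (f := fun i => ∑ l, ∫⁻ x, ‖χ x * om D i l (x, t)‖ₑ ^ 2) (fun i _ => zero_le) (Finset.mem_univ j)))).trans (o7 t)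
    · rw [lintegral_const_mul' _ _ hC7, ← st_prod (L.mD.enorm.pow_const 2)]
      exact ENNReal.mul_lt_top hC7.lt_top L.D2
  unfold OM
  rw [lintegral_finsetSum _ fun j _ => Finset.measurable_sum _ fun k _ => sl_meas ((mo j k).enorm.pow_const 2)]
  simp_rw [lintegral_finsetSum (f := fun k t => ∫⁻ x, ‖χ x * om D _ k (x, t)‖ₑ ^ 2) _ fun k _ => sl_meas ((mo _ k).enorm.pow_const 2)]
  have hp : 0 < θ * τ := by positivity
  refine (Finset.sum_le_sum fun j _ => Finset.sum_le_sum fun k _ => dual (mo j k) (lo j k) (a := t1 - θ * τ) (by linarith) fun b hb g hg gc g1 g2 =>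
    H t1 τ θ b g hτ ht1 ht0 hθ hθ2 hb hg gc g1 g2 j k).trans (le_of_eq ?_)
  simp only [Finset.sum_const, Finset.card_univ, Fintype.card_fin, nsmul_eq_mul, OM]
  rw [lintegral_finsetSum _ fun j _ => Finset.measurable_sum _ fun k _ => sl_meas ((mo j k).enorm.pow_const 2)]
  simp_rw [lintegral_finsetSum (f := fun k t => ∫⁻ x, ‖χ x * om D _ k (x, t)‖ₑ ^ 2) _ fun k _ => sl_meas ((mo _ k).enorm.pow_const 2)]
  push_cast; ring

end

section
lemma iterate {y e : ℝ → ℝ≥0∞} (hy : ∫⁻ t, y t < ∞) (he : ∫⁻ t, e t < ∞) {C : ℝ≥0∞} (hC : C ≠ ∞) {q t0 ρ : ℝ} (hq : 0 < q) (hρ : 0 < ρ)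
    (H : ∀ t1 τ θ : ℝ, 0 < τ → t1 ≤ t0 → t0 - ρ ≤ t1 - τ → 0 < θ → θ ≤ 1/2 → (∫⁻ t in Ioo (t1 - θ * τ) t1, y t) ≤
      C * ((ENNReal.ofReal θ + (∫⁻ t in Ioo (t1 - τ) t1, e t) ^ q) * (∫⁻ t in Ioo (t1 - τ) t1, y t) + ENNReal.ofReal τ)) :
    ∃ B : ℝ, 0 ≤ B ∧ ∀ t1 τ : ℝ, 0 < τ → t1 ≤ t0 → t0 - ρ / 2 ≤ t1 → ∫⁻ t in Ioo (t1 - τ) t1, y t ≤ ENNReal.ofReal (B * τ ^ (24/25 : ℝ)) := by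
  set c := C.toReal with hc
  have hc0 : 0 ≤ c := ENNReal.toReal_nonneg
  have hCc : C = ENNReal.ofReal c := (ENNReal.ofReal_toReal hC).symm
  set θ := min (1/2) ((1 / (4 * (c + 1))) ^ 25) with hθ
  have t0' : 0 < θ := lt_min (by norm_num) (by positivity)
  have t2 : θ ≤ 1/2 := min_le_left _ _
  have tsp : ∀ s : ℝ, 0 < s → s = s ^ (24/25 : ℝ) * s ^ (1/25 : ℝ) := fun s hs => by rw [← Real.rpow_add hs]; norm_num
  have t1 : θ ^ (1/25 : ℝ) ≤ 1 / (4 * (c + 1)) := by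
    calc _ ≤ ((1 / (4 * (c + 1))) ^ 25) ^ (1/25 : ℝ) := Real.rpow_le_rpow t0'.le (min_le_right _ _) (by norm_num)
      _ = _ := by rw [← Real.rpow_natCast, ← Real.rpow_mul (by positivity)]; norm_num
  set P := θ ^ (24/25 : ℝ) with hP
  have P0 : 0 < P := by positivity
  have cc : c * (1 / (4 * (c + 1))) ≤ 1 / 4 := by
    rw [mul_one_div, div_le_div_iff₀ (by positivity) (by norm_num)]; linarith
  have a1 : c * θ ≤ P / 4 := by
    rw [tsp θ t0']
    calc c * (P * θ ^ (1/25 : ℝ)) ≤ c * (P * (1 / (4 * (c + 1)))) := by gcongr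
      _ = P * (c * (1 / (4 * (c + 1)))) := by ring
      _ ≤ P * (1 / 4) := by gcongr
      _ = _ := by ring
  set e0 := (P / (4 * (c + 1))) ^ (1 / q) with he0
  have e00 : 0 < e0 := by positivity
  have a2 : c * e0 ^ q ≤ P / 4 := by
    rw [he0, ← Real.rpow_mul (by positivity), one_div_mul_cancel hq.ne', Real.rpow_one]
    calc _ = P * (c * (1 / (4 * (c + 1)))) := by ring
      _ ≤ P * (1 / 4) := by gcongr
      _ = _ := by ring
  obtain ⟨δ, hδ, hδ'⟩ := exists_pos_setLIntegral_lt_of_measure_lt he.ne (ε := ENNReal.ofReal e0) (by simpa using e00)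
  obtain ⟨d, d0, dδ⟩ := ENNReal.lt_iff_exists_nnreal_btwn.1 hδ
  have d0 : 0 < (d : ℝ) := by exact_mod_cast d0
  set τ0 := min (ρ / 2) d with hτ0
  have τ00 : 0 < τ0 := lt_min (by linarith) d0
  set A := (∫⁻ t, y t).toReal with hA
  have A0 : 0 ≤ A := ENNReal.toReal_nonneg
  have yA : ∀ s, ∫⁻ t in s, y t ≤ ENNReal.ofReal A := fun s => (setLIntegral_le_lintegral _ _).trans (ENNReal.ofReal_toReal hy.ne).symm.le
  have hp0 : 0 < (θ * τ0) ^ (24/25 : ℝ) := by positivity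
  set B := A / (θ * τ0) ^ (24/25 : ℝ) + 2 * c * τ0 ^ (1/25 : ℝ) / P with hB
  have B0 : 0 ≤ B := by positivity
  have big : ∀ t1 τ, θ * τ0 ≤ τ → ∫⁻ t in Ioo (t1 - τ) t1, y t ≤ ENNReal.ofReal (B * τ ^ (24/25 : ℝ)) := fun t1 τ h => by
    refine (yA _).trans (ENNReal.ofReal_le_ofReal ?_)
    calc A = A / (θ * τ0) ^ (24/25 : ℝ) * (θ * τ0) ^ (24/25 : ℝ) := by field_simp
      _ ≤ B * τ ^ (24/25 : ℝ) := by
        gcongr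
        rw [hB]; exact le_add_of_nonneg_right (by positivity)
  have ind : ∀ n : ℕ, ∀ t1 τ : ℝ, θ ^ n * (θ * τ0) < τ → t1 ≤ t0 → t0 - ρ / 2 ≤ t1 → ∫⁻ t in Ioo (t1 - τ) t1, y t ≤ ENNReal.ofReal (B * τ ^ (24/25 : ℝ)) := by
    intro n
    induction n with
    | zero => intro t1 τ h _ _; exact big t1 τ (by simpa using h.le)
    | succ n ih =>
      intro t1 τ h hh1 hh2
      by_cases hb : θ * τ0 ≤ τ
      · exact big t1 τ hb
      push Not at hb
      have τp : 0 < τ := lt_trans (by positivity) h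
      set σ := τ / θ with hσ
      have σp : 0 < σ := by positivity
      have es : θ * σ = τ := by rw [hσ]; field_simp
      have σ1 : σ < τ0 := by rw [hσ, div_lt_iff₀ t0']; linarith
      have σ2 : θ ^ n * (θ * τ0) < σ := by rw [hσ, lt_div_iff₀ t0']; calc _ = _ := by ring
                                                                        _ < _ := h
      have σρ : σ ≤ ρ / 2 := σ1.le.trans (min_le_left _ _)
      have := H t1 σ θ σp hh1 (by linarith) t0' t2
      rw [es] at this
      refine this.trans ?_
      have eb : (∫⁻ t in Ioo (t1 - σ) t1, e t) ^ q ≤ ENNReal.ofReal (e0 ^ q) := by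
        rw [← ENNReal.ofReal_rpow_of_pos e00]
        refine ENNReal.rpow_le_rpow (hδ' _ ?_).le hq.le
        rw [Real.volume_Ioo]
        refine lt_of_le_of_lt ?_ dδ
        rw [← ENNReal.ofReal_coe_nnreal]
        exact ENNReal.ofReal_le_ofReal (by have := min_le_right (ρ / 2) (d : ℝ); linarith)
      rw [hCc]
      calc _ ≤ ENNReal.ofReal c * ((ENNReal.ofReal θ + ENNReal.ofReal (e0 ^ q)) * ENNReal.ofReal (B * σ ^ (24/25 : ℝ)) + ENNReal.ofReal σ) := by
            gcongr; exact ih t1 σ σ2 hh1 hh2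
        _ = ENNReal.ofReal (c * ((θ + e0 ^ q) * (B * σ ^ (24/25 : ℝ)) + σ)) := by
          rw [← ENNReal.ofReal_add (by positivity) (by positivity), ← ENNReal.ofReal_mul (by positivity), ← ENNReal.ofReal_add (by positivity) (by positivity), ← ENNReal.ofReal_mul hc0]
        _ ≤ _ := by
          refine ENNReal.ofReal_le_ofReal ?_
          have s1 : τ ^ (24/25 : ℝ) = P * σ ^ (24/25 : ℝ) := by rw [← es, Real.mul_rpow t0'.le σp.le]
          have s2 : σ ≤ σ ^ (24/25 : ℝ) * τ0 ^ (1/25 : ℝ) := by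
            conv_lhs => rw [tsp σ σp]
            gcongr
          have s3 : 2 * c * τ0 ^ (1/25 : ℝ) ≤ B * P := by
            calc _ = (2 * c * τ0 ^ (1/25 : ℝ) / P) * P := by field_simp
              _ ≤ _ := by gcongr; rw [hB]; exact le_add_of_nonneg_left (by positivity)
          rw [s1]
          set X := σ ^ (24/25 : ℝ) with hX
          have X0 : 0 ≤ X := by positivity
          calc c * ((θ + e0 ^ q) * (B * X) + σ) ≤ (c * θ + c * e0 ^ q) * (B * X) + c * (X * τ0 ^ (1/25 : ℝ)) := by
                have := mul_le_mul_of_nonneg_left s2 hc0; linarith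
            _ ≤ (P / 4 + P / 4) * (B * X) + B * P / 2 * X := by
                have u1 : c * (X * τ0 ^ (1/25 : ℝ)) ≤ B * P / 2 * X := by
                  calc _ = (2 * c * τ0 ^ (1/25 : ℝ)) / 2 * X := by ring
                    _ ≤ _ := by gcongr
                have u2 : (c * θ + c * e0 ^ q) * (B * X) ≤ (P / 4 + P / 4) * (B * X) := mul_le_mul_of_nonneg_right (add_le_add a1 a2) (by positivity)
                linarith
            _ = B * (P * X) := by ring
  refine ⟨B, B0, fun t1 τ hτ h1 h2 => ?_⟩
  obtain ⟨n, hn⟩ := exists_pow_lt_of_lt_one (show 0 < τ / (θ * τ0) by positivity) (show θ < 1 by linarith)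
  exact ind n t1 τ (by rwa [lt_div_iff₀ (by positivity)] at hn) h1 h2
def yM (v : E3 × ℝ → E3) (D : E3 × ℝ → Fin 3 → Fin 3 → ℝ) (t : ℝ) : ℝ≥0∞ := (∫⁻ x, ‖D (x, t)‖ₑ ^ 2) + (∫⁻ x, ‖v (x, t)‖ₑ ^ 6) ^ (1/3 : ℝ)
lemma bump (x0 : E3) {a b : ℝ} (ha : 0 < a) (hab : a < b) : ∃ χ : E3 → ℝ, Sm χ ∧ HasCompactSupport χ ∧ tsupport χ ⊆ Metric.closedBall x0 b ∧
    (∀ x ∈ Metric.closedBall x0 a, χ x = 1) := by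
  let f : ContDiffBump x0 := ⟨a, b, ha, hab⟩
  exact ⟨f, f.contDiff (n := (⊤ : ℕ∞)), f.hasCompactSupport, f.tsupport_eq.le, fun x hx => f.one_of_mem_closedBall hx⟩
lemma Loc.morrey {x0 t0 r v D} (L : Loc x0 t0 r v D) {l : ℝ} (hl0 : 0 ≤ l) (hl1 : l < 1) (hE : ∫⁻ t, Exf l (fun z => ‖D z‖ₑ) t < ∞) :
    ∃ B : ℝ, 0 ≤ B ∧ ∀ t1 τ : ℝ, 0 < τ → ∫⁻ t in Ioo (t1 - τ) t1, yM ((pcyl (x0, t0) (r/2)).indicator v) ((pcyl (x0, t0) (r/2)).indicator D) t ≤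
      ENNReal.ofReal (B * τ ^ (24/25 : ℝ)) := by
  have hr := L.hr
  obtain ⟨χ, h1, h2, h3, c1⟩ := bump x0 (a := r/2) (b := 2*r/3) (by linarith) (by linarith)
  obtain ⟨χ1, h1', h2', h3', c1'⟩ := bump x0 (a := 2*r/3) (b := 3*r/4) (by linarith) (by linarith)
  have h3r := h3.trans (Metric.closedBall_subset_ball (show 2*r/3 < r by linarith))
  obtain ⟨C, hC, H⟩ := L.decay h1 h2 h3r h1' h2' (h3'.trans (Metric.closedBall_subset_ball (show 3*r/4 < r by linarith)))
    (fun x hx => c1' x (h3 hx)) hl0 hl1 hE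
  obtain ⟨C5, hC5, v5⟩ := L.H5 h1 h2 h3r
  obtain ⟨C7, hC7, o7⟩ := OM_le h1 h2 D
  have hy : ∫⁻ t, OM χ D t < ∞ := by
    refine (lintegral_mono fun t => o7 t).trans_lt ?_
    rw [lintegral_const_mul' _ _ hC7, ← st_prod (L.mD.enorm.pow_const 2)]
    exact ENNReal.mul_lt_top hC7.lt_top L.D2
  obtain ⟨B, hB, HB⟩ := iterate hy hE hC (q := 1 - l) (by linarith) (ρ := r ^ 2) (by positivity) H
  set R := (r ^ 2) ^ (1/25 : ℝ) with hR
  have R0 : 0 ≤ R := by positivity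
  refine ⟨2 * C5 * (B + R), by positivity, fun t1 τ hτ => ?_⟩
  set J := Ioo (t0 - (r/2) ^ 2) t0 with hJ
  have pt : ∀ᵐ t, yM ((pcyl (x0, t0) (r/2)).indicator v) ((pcyl (x0, t0) (r/2)).indicator D) t ≤ J.indicator (fun t => ENNReal.ofReal (2 * C5) * (OM χ D t + 1)) t := by
    filter_upwards [v5] with t ht
    by_cases htJ : t ∈ J
    · rw [indicator_of_mem htJ]
      have key : ∀ {F : Type} [NormedAddCommGroup F] (u : E3 × ℝ → F) x, ‖(pcyl (x0, t0) (r/2)).indicator u (x, t)‖ₑ ≤ ‖χ x‖ₑ * ‖u (x, t)‖ₑ := by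
        intro F _ u x
        by_cases hx : (x, t) ∈ pcyl (x0, t0) (r/2)
        · rw [indicator_of_mem hx, c1 x (Metric.ball_subset_closedBall hx.1)]; simp
        · rw [indicator_of_notMem hx]; simp
      calc _ ≤ (∫⁻ x, (‖χ x‖ₑ * ‖D (x, t)‖ₑ) ^ 2) + (∫⁻ x, (‖χ x‖ₑ * ‖v (x, t)‖ₑ) ^ 6) ^ (1/3 : ℝ) := by
            unfold yM
            refine add_le_add (lintegral_mono fun x => ?_) (ENNReal.rpow_le_rpow (lintegral_mono fun x => ?_) (by norm_num))
            · exact pow_le_pow_left' (key D x) 2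
            · exact pow_le_pow_left' (key v x) 6
        _ ≤ _ := add_le_add ht.2 ht.1
        _ = _ := by rw [ENNReal.ofReal_mul (by norm_num)]; simp; ring
    · rw [indicator_of_notMem htJ]
      have key : ∀ {F : Type} [NormedAddCommGroup F] (u : E3 × ℝ → F) x, (pcyl (x0, t0) (r/2)).indicator u (x, t) = 0 := fun u x =>
        indicator_of_notMem (fun h => htJ h.2) _
      simp [yM, key]
  refine (lintegral_mono_ae (ae_restrict_of_ae pt)).trans ?_
  rw [setLIntegral_indicator measurableSet_Ioo]
  by_cases hJe : t1 ≤ t0 - (r/2) ^ 2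
  · rw [show J ∩ Ioo (t1 - τ) t1 = ∅ from by ext t; simp only [hJ, mem_inter_iff, mem_Ioo, mem_empty_iff_false, iff_false]; rintro ⟨⟨a, b⟩, c, d⟩; linarith]
    simp
  push Not at hJe
  set t2 := min t1 t0 with ht2
  set σ := min τ (r ^ 2) with hσ
  have σ0 : 0 < σ := lt_min hτ (by positivity)
  have sub : J ∩ Ioo (t1 - τ) t1 ⊆ Ioo (t2 - σ) t2 := by
    rintro t ⟨⟨a, b⟩, c, d⟩
    refine ⟨?_, lt_min d b⟩
    have q1 : t2 ≤ t1 := min_le_left _ _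
    have q2 : t2 ≤ t0 := min_le_right _ _
    rcases min_choice τ (r ^ 2) with e | e <;> rw [hσ, e] <;> nlinarith
  refine (lintegral_mono_set sub).trans ?_
  rw [lintegral_const_mul' _ _ ofReal_ne_top, lintegral_add_right _ measurable_const, setLIntegral_const, one_mul, Real.volume_Ioo]
  have hb := HB t2 σ σ0 (min_le_right _ _) (le_min (by nlinarith) (by nlinarith))
  calc _ ≤ ENNReal.ofReal (2 * C5) * (ENNReal.ofReal (B * σ ^ (24/25 : ℝ)) + ENNReal.ofReal σ) := by gcongr; simp
    _ = ENNReal.ofReal (2 * C5 * (B * σ ^ (24/25 : ℝ) + σ)) := by rw [← ENNReal.ofReal_add (by positivity) (by positivity), ← ENNReal.ofReal_mul (by positivity)]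
    _ ≤ _ := by
      refine ENNReal.ofReal_le_ofReal ?_
      have s1 : σ ^ (24/25 : ℝ) ≤ τ ^ (24/25 : ℝ) := Real.rpow_le_rpow σ0.le (min_le_left _ _) (by norm_num)
      have s2 : σ ≤ τ ^ (24/25 : ℝ) * R := by
        calc σ = σ ^ (24/25 : ℝ) * σ ^ (1/25 : ℝ) := by rw [← Real.rpow_add σ0]; norm_num
          _ ≤ τ ^ (24/25 : ℝ) * R := mul_le_mul s1 (Real.rpow_le_rpow σ0.le (min_le_right _ _) (by norm_num)) (by positivity) (by positivity)
      calc _ ≤ 2 * C5 * (B * τ ^ (24/25 : ℝ) + τ ^ (24/25 : ℝ) * R) := by gcongr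
        _ = _ := by ring

end

section
def kR (R : ℝ) : E3 → ℝ≥0∞ := (Metric.ball 0 R).indicator kap
lemma kR_meas (R : ℝ) : Measurable (kR R) := kap_meas.indicator measurableSet_ball
lemma kap_ball (R : ℝ) {a : ℝ} (ha : a < 10/7) : ∫⁻ w in Metric.ball (0:E3) R, kap w ^ a < ∞ := by
  have h : IntegrableOn (fun x : E3 => (fun y : ℝ => y ^ (-(21/10) * a)) ‖x‖) (Metric.ball 0 R) volume := by
    rw [integrableOn_fun_norm_addHaar (E := E3) volume (f := fun y : ℝ => y ^ (-(21/10) * a)), finrank_euclideanSpace_fin]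
    have h1 : IntegrableOn (fun y : ℝ => y ^ (2 + -(21/10) * a)) (Ioo 0 R) := by
      rcases le_or_gt R 0 with hR | hR
      · rw [Ioo_eq_empty (by linarith)]; exact integrableOn_empty
      exact (intervalIntegral.integrableOn_Ioo_rpow_iff hR).2 (by linarith)
    refine h1.congr_fun (fun y hy => ?_) measurableSet_Ioo
    simp only [smul_eq_mul]
    rw [Real.rpow_add hy.1]; norm_num
  have h2 := h.2
  refine lt_of_eq_of_lt (lintegral_congr_ae ?_) h2
  refine ae_restrict_of_ae ((Measure.ae_ne volume (0:E3)).mono fun w hw => ?_)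
  have hw' : 0 < ‖w‖ := norm_pos_iff.2 hw
  dsimp only
  rw [kap, ← ofReal_norm, ← ENNReal.rpow_mul, ENNReal.ofReal_rpow_of_pos hw', Real.enorm_of_nonneg (by positivity)]
lemma kR_pow (R : ℝ) {a : ℝ} (h0 : 0 < a) (ha : a < 10/7) : ∫⁻ w, kR R w ^ a < ∞ := by
  refine lt_of_eq_of_lt ?_ (kap_ball R ha)
  rw [← lintegral_indicator measurableSet_ball]
  refine lintegral_congr fun w => ?_
  by_cases h : w ∈ Metric.ball (0:E3) R <;> simp [kR, h, h0]
def Pk (R : ℝ) : ℝ≥0∞ := (∫⁻ w, kR R w ^ (24/17 : ℝ)) ^ (17/24 : ℝ)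
lemma Pk_top (R : ℝ) : Pk R ≠ ∞ := ENNReal.rpow_ne_top_of_nonneg (by norm_num) (kR_pow R (by norm_num) (by norm_num)).ne
def kc (R : ℝ) (f : E3 → ℝ≥0∞) (x : E3) : ℝ≥0∞ := ∫⁻ w, kR R w * f (x + w)
lemma kc_meas (R : ℝ) {f : E3 → ℝ≥0∞} (hf : Measurable f) : Measurable (kc R f) := by
  refine Measurable.lintegral_prod_right' (f := fun q : E3 × E3 => kR R q.2 * f (q.1 + q.2)) ?_
  have := kR_meas R
  fun_prop
lemma hol2 {F : Type*} [MeasurableSpace F] {μ : Measure F} {f g : F → ℝ≥0∞} (hf : AEMeasurable f μ) (hg : AEMeasurable g μ) {a b : ℝ} (ha : 0 < a) (hb : 0 < b) (hab : a + b = 1) :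
    ∫⁻ x, f x * g x ∂μ ≤ (∫⁻ x, f x ^ (1/a) ∂μ) ^ a * (∫⁻ x, g x ^ (1/b) ∂μ) ^ b := by
  have h := ENNReal.lintegral_prod_norm_pow_le (μ := μ) (Finset.univ : Finset (Fin 2)) (f := ![fun x => f x ^ (1/a), fun x => g x ^ (1/b)]) (p := ![a, b])
    (by intro i _; fin_cases i; exacts [hf.pow_const _, hg.pow_const _]) (by simpa using hab) (by intro i _; fin_cases i; exacts [ha.le, hb.le])
  simp only [Fin.prod_univ_two, Matrix.cons_val_zero, Matrix.cons_val_one] at h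
  refine le_of_eq_of_le (lintegral_congr fun x => ?_) h
  rw [← ENNReal.rpow_mul, ← ENNReal.rpow_mul, one_div_mul_cancel ha.ne', one_div_mul_cancel hb.ne', ENNReal.rpow_one, ENNReal.rpow_one]
lemma tr_lint (f : E3 → ℝ≥0∞) (x : E3) : ∫⁻ w, f (x + w) = ∫⁻ w, f w := lintegral_add_left_eq_self f x
lemma kc_sup (R : ℝ) {f : E3 → ℝ≥0∞} (hf : Measurable f) (x : E3) : kc R f x ≤ Pk R * (∫⁻ x, f x ^ (24/7 : ℝ)) ^ (7/24 : ℝ) := by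
  have h := hol2 (μ := (volume : Measure E3)) (f := kR R) (g := fun w => f (x + w)) (kR_meas R).aemeasurable (by fun_prop) (a := 17/24) (b := 7/24) (by norm_num) (by norm_num) (by norm_num)
  rw [tr_lint (fun w => f w ^ (1/(7/24) : ℝ)) x] at h
  norm_num at h
  exact h
/-- Young's inequality -/
lemma kc_young (R : ℝ) {f : E3 → ℝ≥0∞} (hf : Measurable f) {a b : ℝ} (hb : 0 < b) (ha1 : a < 1) (hab : a = b + 7/24) :
    (∫⁻ x, kc R f x ^ (1/b)) ^ b ≤ Pk R * (∫⁻ x, f x ^ (1/a)) ^ a := by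
  have hk := kR_meas R
  have ha : 0 < a := by linarith
  have pt : ∀ x, kc R f x ≤ (∫⁻ w, kR R w ^ (24/17 : ℝ) * f (x + w) ^ (1/a)) ^ b * ((∫⁻ w, kR R w ^ (24/17 : ℝ)) ^ (1 - a) * (∫⁻ x, f x ^ (1/a)) ^ (7/24 : ℝ)) := by
    intro x
    have h := ENNReal.lintegral_prod_norm_pow_le (μ := (volume : Measure E3)) (Finset.univ : Finset (Fin 3))
      (f := ![fun w => kR R w ^ (24/17 : ℝ) * f (x + w) ^ (1/a), fun w => kR R w ^ (24/17 : ℝ), fun w => f (x + w) ^ (1/a)]) (p := ![b, 1 - a, 7/24])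
      (by intro i _; fin_cases i <;> simp <;> fun_prop) (by simp [Fin.sum_univ_three]; linarith)
      (by intro i _; fin_cases i <;> simp <;> linarith)
    simp only [Fin.prod_univ_three, Matrix.cons_val_zero, Matrix.cons_val_one, Matrix.cons_val] at h
    rw [tr_lint (fun w => f w ^ (1/a)) x, mul_assoc] at h
    refine le_of_eq_of_le (lintegral_congr fun w => ?_) h
    rw [ENNReal.mul_rpow_of_nonneg _ _ hb.le, ← ENNReal.rpow_mul, ← ENNReal.rpow_mul, ← ENNReal.rpow_mul, ← ENNReal.rpow_mul, mul_assoc, mul_mul_mul_comm,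
      ← ENNReal.rpow_add_of_nonneg _ _ (by positivity) (by linarith), ← ENNReal.rpow_add_of_nonneg _ _ (by positivity) (by positivity)]
    rw [show 24/17 * b + 24/17 * (1 - a) = 1 by rw [hab]; ring, show 1/a * b + 1/a * (7/24) = 1 by rw [← mul_add, ← hab]; field_simp, ENNReal.rpow_one, ENNReal.rpow_one]
  set A := ∫⁻ w, kR R w ^ (24/17 : ℝ)
  set B := ∫⁻ x, f x ^ (1/a)
  have tot : ∫⁻ x, ∫⁻ w, kR R w ^ (24/17 : ℝ) * f (x + w) ^ (1/a) = A * B := by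
    rw [lintegral_lintegral_swap (by fun_prop), ← lintegral_mul_const _ (by fun_prop)]
    refine lintegral_congr fun w => ?_
    rw [lintegral_const_mul _ (by fun_prop), lintegral_add_right_eq_self (fun x => f x ^ (1/a)) w]
  calc (∫⁻ x, kc R f x ^ (1/b)) ^ b ≤ (∫⁻ x, (∫⁻ w, kR R w ^ (24/17 : ℝ) * f (x + w) ^ (1/a)) * (A ^ (1 - a) * B ^ (7/24 : ℝ)) ^ (1/b)) ^ b := by
        refine ENNReal.rpow_le_rpow (lintegral_mono fun x => ?_) hb.le
        refine (ENNReal.rpow_le_rpow (pt x) (by positivity)).trans (le_of_eq ?_)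
        rw [ENNReal.mul_rpow_of_nonneg _ _ (by positivity), ← ENNReal.rpow_mul, mul_one_div_cancel hb.ne', ENNReal.rpow_one]
    _ = (A * B) ^ b * (A ^ (1 - a) * B ^ (7/24 : ℝ)) := by
        rw [lintegral_mul_const _ (Measurable.lintegral_prod_right' (f := fun q : E3 × E3 => kR R q.2 ^ (24/17 : ℝ) * f (q.1 + q.2) ^ (1/a)) (by fun_prop)), tot, ENNReal.mul_rpow_of_nonneg _ _ hb.le, ← ENNReal.rpow_mul _ (1/b),
          one_div_mul_cancel hb.ne', ENNReal.rpow_one]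
    _ = Pk R * B ^ a := by
        rw [ENNReal.mul_rpow_of_nonneg _ _ hb.le, mul_mul_mul_comm, ← ENNReal.rpow_add_of_nonneg _ _ hb.le (by linarith), ← ENNReal.rpow_add_of_nonneg _ _ hb.le (by norm_num), ← hab, Pk]
        congr 2; linarith
lemma hol3 {d g : E3 → ℝ≥0∞} (hd : Measurable d) (hg : Measurable g) {a b c : ℝ} (ha : 0 < a) (hb : 0 < b) (hc : c = a + b) :
    (∫⁻ y, (d y * g y) ^ (1/c)) ^ c ≤ (∫⁻ x, d x ^ (1/a)) ^ a * (∫⁻ y, g y ^ (1/b)) ^ b := by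
  have hc0 : 0 < c := by linarith
  have h := hol2 (μ := (volume : Measure E3)) (f := fun y => d y ^ (1/c)) (g := fun y => g y ^ (1/c)) (by fun_prop) (by fun_prop) (a := a/c) (b := b/c) (by positivity) (by positivity) (by rw [hc]; field_simp)
  have h' := ENNReal.rpow_le_rpow h hc0.le
  rw [ENNReal.mul_rpow_of_nonneg _ _ hc0.le, ← ENNReal.rpow_mul, ← ENNReal.rpow_mul] at h'
  simp only [← ENNReal.rpow_mul, ← ENNReal.mul_rpow_of_nonneg _ _ (show (0:ℝ) ≤ 1/c by positivity)] at h'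
  rwa [div_mul_cancel₀ _ hc0.ne', div_mul_cancel₀ _ hc0.ne', show 1/c * (1/(a/c)) = 1/a by field_simp, show 1/c * (1/(b/c)) = 1/b by field_simp] at h'
lemma kc_two (R : ℝ) {d g : E3 → ℝ≥0∞} (hd : Measurable d) (hg : Measurable g) (x : E3) :
    kc R (kc R (fun y => d y * g y)) x ≤ Pk R ^ 2 * ((∫⁻ x, d x ^ (2:ℝ)) ^ (1/2 : ℝ) * (∫⁻ x, g x ^ (12 : ℝ)) ^ (1/12 : ℝ)) := by
  have m3 : Measurable fun y => d y * g y := hd.mul hg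
  have y3 := kc_young R m3 (a := 7/12) (b := 7/24) (by norm_num) (by norm_num) (by norm_num)
  have y4 := kc_sup R (kc_meas R m3) x
  have hh := hol3 hd hg (a := 1/2) (b := 1/12) (c := 7/12) (by norm_num) (by norm_num) (by norm_num)
  norm_num at y3 y4 hh ⊢
  rw [sq, mul_assoc]
  exact y4.trans (mul_le_mul_right (y3.trans (mul_le_mul_right hh _)) _)
lemma kc_four (R : ℝ) {d f : E3 → ℝ≥0∞} (hd : Measurable d) (hf : Measurable f) (x : E3) :
    kc R (kc R (fun y => d y * kc R (kc R f) y)) x ≤ Pk R ^ 4 * ((∫⁻ x, d x ^ (2:ℝ)) ^ (1/2 : ℝ) * (∫⁻ x, f x ^ (3/2 : ℝ)) ^ (2/3 : ℝ)) := by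
  have m1 := kc_meas R hf
  have y1 := kc_young R hf (a := 2/3) (b := 3/8) (by norm_num) (by norm_num) (by norm_num)
  have y2 := kc_young R m1 (a := 3/8) (b := 1/12) (by norm_num) (by norm_num) (by norm_num)
  have y3 := kc_two R hd (kc_meas R m1) x
  norm_num at y1 y2 y3 ⊢
  calc _ ≤ Pk R ^ 2 * ((∫⁻ x, d x ^ 2) ^ (1/2 : ℝ) * (Pk R * (Pk R * (∫⁻ x, f x ^ (3/2 : ℝ)) ^ (2/3 : ℝ)))) :=
        y3.trans (mul_le_mul_right (mul_le_mul_right (y2.trans (mul_le_mul_right y1 _)) _) _)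
    _ = _ := by ring
lemma kc_meas2 (R : ℝ) {F : E3 × ℝ → ℝ≥0∞} (hF : Measurable F) : Measurable fun q : E3 × ℝ => kc R (fun y => F (y, q.2)) q.1 := by
  refine Measurable.lintegral_prod_right' (f := fun q : (E3 × ℝ) × E3 => kR R q.2 * F (q.1.1 + q.2, q.1.2)) ?_
  have := kR_meas R
  fun_prop
lemma kc_swap (R : ℝ) {F : E3 × ℝ → ℝ≥0∞} (hF : Measurable F) (μ : Measure ℝ) [SFinite μ] (x : E3) :
    kc R (fun y => ∫⁻ s, F (y, s) ∂μ) x = ∫⁻ s, kc R (fun y => F (y, s)) x ∂μ := by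
  have := kR_meas R
  unfold kc
  rw [lintegral_lintegral_swap (by fun_prop)]
  refine lintegral_congr fun w => ?_
  rw [lintegral_const_mul _ (by fun_prop)]
lemma kc_mono (R : ℝ) {f g : E3 → ℝ≥0∞} (h : ∀ x, f x ≤ g x) (x : E3) : kc R f x ≤ kc R g x :=
  lintegral_mono fun _ => mul_le_mul_right (h _) _
lemma kc_const (R : ℝ) {f : E3 → ℝ≥0∞} (hf : Measurable f) (c : ℝ≥0∞) (x : E3) : kc R (fun y => c * f y) x = c * kc R f x := by
  have := kR_meas R
  unfold kc
  rw [← lintegral_const_mul _ (by fun_prop)]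
  exact lintegral_congr fun w => by ring
def mK (R : ℝ) : Measure E3 := volume.withDensity (kR R)
def mS (S : ℝ) : Measure ℝ := (volume.restrict (Ioo 0 S)).withDensity fun s => ENNReal.ofReal (s ^ (-(19/20) : ℝ))
lemma mK_fin (R : ℝ) : IsFiniteMeasure (mK R) := by
  refine isFiniteMeasure_withDensity ?_
  have := kR_pow R (a := 1) (by norm_num) (by norm_num)
  simpa using this.ne
lemma mS_fin {S : ℝ} (hS : 0 < S) : IsFiniteMeasure (mS S) := by
  refine isFiniteMeasure_withDensity_ofReal ?_
  exact ((intervalIntegral.integrableOn_Ioo_rpow_iff hS).2 (by norm_num)).2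
lemma mS_int {S : ℝ} {f : ℝ → ℝ≥0∞} (hf : Measurable f) : ∫⁻ s, f s ∂mS S = ∫⁻ s in Ioo 0 S, ENNReal.ofReal (s ^ (-(19/20) : ℝ)) * f s :=
  lintegral_withDensity_eq_lintegral_mul _ (by fun_prop) hf
lemma mK_int {R : ℝ} {f : E3 → ℝ≥0∞} (hf : Measurable f) : ∫⁻ s, f s ∂mK R = ∫⁻ w, kR R w * f w :=
  lintegral_withDensity_eq_lintegral_mul _ (kR_meas R) hf
def NN (ρ : ℝ) : Measure (E3 × ℝ) := ((mS (ρ^2)).prod ((mK (2*ρ)).prod (mK (2*ρ)))).map fun q => (q.2.1 + q.2.2, -q.1)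
lemma NN_fin {ρ : ℝ} (h : 0 < ρ) : IsFiniteMeasure (NN ρ) := by
  have := mK_fin (2*ρ)
  have := mS_fin (S := ρ^2) (by positivity)
  unfold NN; infer_instance
lemma NN_int {ρ : ℝ} (h : 0 < ρ) {F : E3 × ℝ → ℝ≥0∞} (hF : Measurable F) :
    ∫⁻ q, F q ∂NN ρ = ∫⁻ s, (∫⁻ w, kR (2*ρ) w * ∫⁻ w', kR (2*ρ) w' * F (w + w', -s)) ∂mS (ρ^2) := by
  have := mK_fin (2*ρ)
  have := mS_fin (S := ρ^2) (by positivity)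
  rw [NN, lintegral_map hF (by fun_prop), lintegral_prod _ (by fun_prop)]
  refine lintegral_congr fun s => ?_
  rw [lintegral_prod _ (by fun_prop), mK_int (Measurable.lintegral_prod_right' (f := fun q : E3 × E3 => F (q.1 + q.2, -s)) (by fun_prop))]
  refine lintegral_congr fun w => ?_
  rw [mK_int (by fun_prop)]
def TT (ρ : ℝ) (F : E3 × ℝ → ℝ≥0∞) (z : E3 × ℝ) : ℝ≥0∞ := ∫⁻ q, F (z + q) ∂NN ρ
lemma TT_eq {ρ : ℝ} (h : 0 < ρ) {F : E3 × ℝ → ℝ≥0∞} (hF : Measurable F) (z : E3 × ℝ) :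
    TT ρ F z = ∫⁻ s, kc (2*ρ) (kc (2*ρ) fun y => F (y, z.2 - s)) z.1 ∂mS (ρ^2) := by
  rw [TT, NN_int h (by fun_prop)]
  refine lintegral_congr fun s => lintegral_congr fun w => congrArg _ (lintegral_congr fun w' => ?_)
  rw [add_assoc z.1, sub_eq_add_neg]
  rfl
lemma TT_meas {ρ : ℝ} (h : 0 < ρ) {F : E3 × ℝ → ℝ≥0∞} (hF : Measurable F) : Measurable (TT ρ F) := by
  have := NN_fin h
  exact Measurable.lintegral_prod_right' (f := fun q : (E3 × ℝ) × (E3 × ℝ) => F (q.1 + q.2)) (by fun_prop)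
lemma TT_dual {ρ : ℝ} (h : 0 < ρ) {F G : E3 × ℝ → ℝ≥0∞} (hF : Measurable F) (hG : Measurable G) :
    ∫⁻ z, F z * ∫⁻ q, G (z - q) ∂NN ρ = ∫⁻ z, TT ρ F z * G z := by
  have := NN_fin h
  calc _ = ∫⁻ z, ∫⁻ q, F z * G (z - q) ∂NN ρ := lintegral_congr fun z => (lintegral_const_mul _ (by fun_prop)).symm
    _ = ∫⁻ q, (∫⁻ z, F z * G (z - q)) ∂NN ρ := lintegral_lintegral_swap (by fun_prop)
    _ = ∫⁻ q, (∫⁻ z, F (z + q) * G z) ∂NN ρ := lintegral_congr fun q => by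
        rw [← lintegral_add_right_eq_self _ q]; simp
    _ = ∫⁻ z, ∫⁻ q, F (z + q) * G z ∂NN ρ := lintegral_lintegral_swap (by fun_prop)
    _ = _ := lintegral_congr fun z => lintegral_mul_const _ (by fun_prop)
lemma TT_L1 {ρ : ℝ} (h : 0 < ρ) {F : E3 × ℝ → ℝ≥0∞} (hF : Measurable F) (hi : ∫⁻ z, F z < ∞) : ∫⁻ z, TT ρ F z < ∞ := by
  have := NN_fin h
  have := TT_dual h hF (G := fun _ => 1) measurable_const
  simp only [lintegral_const, one_mul, mul_one] at this
  rw [← this, lintegral_mul_const _ hF]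
  exact ENNReal.mul_lt_top hi (measure_lt_top _ _)
/-- time convolution against a Morrey density -/
lemma time_morrey {y : ℝ → ℝ≥0∞} (hy : Measurable y) {B : ℝ} (hB : 0 ≤ B) (h : ∀ t1 τ : ℝ, 0 < τ → ∫⁻ t in Ioo (t1-τ) t1, y t ≤ ENNReal.ofReal (B*τ^(24/25:ℝ))) {S : ℝ} (hS : 0 < S) :
    ∃ C : ℝ≥0∞, C ≠ ∞ ∧ ∀ t, ∫⁻ s in Ioo 0 S, ENNReal.ofReal (s ^ (-(19/20) : ℝ)) * y (t - s) ≤ C := by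
  have hq : (0:ℝ) < (1/2)^(1/100:ℝ) := by positivity
  refine ⟨∑' n : ℕ, ENNReal.ofReal (2 * B * S^(1/100:ℝ)) * ENNReal.ofReal ((1/2)^(1/100:ℝ)) ^ n, ?_, fun t => ?_⟩
  · rw [ENNReal.tsum_mul_left, ENNReal.tsum_geometric]
    refine ENNReal.mul_ne_top ENNReal.ofReal_ne_top (ENNReal.inv_ne_top.2 (tsub_pos_of_lt ?_).ne')
    rw [← ENNReal.ofReal_one]
    exact (ENNReal.ofReal_lt_ofReal_iff one_pos).2 (Real.rpow_lt_one (by norm_num) (by norm_num) (by norm_num))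
  set a : ℕ → ℝ := fun n => S * (1/2)^n with ha
  have apos : ∀ n, 0 < a n := fun n => by positivity
  have cov : Ioo 0 S ⊆ ⋃ n, Ioc (a (n+1)) (a n) := by
    intro s hs
    obtain ⟨n, h1, h2⟩ := exists_nat_pow_near_of_lt_one (x := s / S) (y := (1/2:ℝ)) (div_pos hs.1 hS) ((div_lt_one hS).2 hs.2).le (by norm_num) (by norm_num)
    rw [lt_div_iff₀ hS] at h1
    rw [div_le_iff₀ hS] at h2
    exact mem_iUnion.2 ⟨n, by simp only [ha]; linarith, by simp only [ha]; linarith⟩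
  refine (lintegral_mono_set cov).trans ((lintegral_iUnion_le _ _).trans (ENNReal.tsum_le_tsum fun n => ?_))
  have an := apos n
  have a1 : a (n+1) = a n / 2 := by simp only [ha]; ring
  calc ∫⁻ s in Ioc (a (n+1)) (a n), ENNReal.ofReal (s ^ (-(19/20) : ℝ)) * y (t - s)
      ≤ ∫⁻ s in Ioc (a (n+1)) (a n), ENNReal.ofReal (a (n+1) ^ (-(19/20) : ℝ)) * y (t - s) := by
        refine setLIntegral_mono' measurableSet_Ioc fun s hs => mul_le_mul_left (ENNReal.ofReal_le_ofReal ?_) _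
        exact Real.rpow_le_rpow_of_nonpos (apos _) hs.1.le (by norm_num)
    _ ≤ ENNReal.ofReal (a (n+1) ^ (-(19/20) : ℝ)) * ∫⁻ s in Ioo 0 (a n), y (t - s) := by
        rw [lintegral_const_mul _ (by fun_prop), setLIntegral_congr Ioo_ae_eq_Ioc]
        exact mul_le_mul_right (lintegral_mono_set (Ioc_subset_Ioc_left (apos _).le)) _
    _ ≤ ENNReal.ofReal (a (n+1) ^ (-(19/20) : ℝ)) * ENNReal.ofReal (B * a n ^ (24/25:ℝ)) := by
        refine mul_le_mul_right (le_of_eq_of_le ?_ (h t (a n) an)) _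
        rw [← lintegral_indicator measurableSet_Ioo, ← lintegral_indicator measurableSet_Ioo, ← lintegral_sub_left_eq_self ((Ioo (t - a n) t).indicator y) t]
        refine lintegral_congr fun s => ?_
        by_cases hs : s ∈ Ioo 0 (a n)
        · rw [indicator_of_mem hs, indicator_of_mem (show t - s ∈ Ioo (t - a n) t from ⟨by linarith [hs.2], by linarith [hs.1]⟩)]
        · rw [indicator_of_notMem hs, indicator_of_notMem fun h => hs ⟨by linarith [h.2], by linarith [h.1]⟩]
    _ ≤ _ := by
        rw [← ENNReal.ofReal_mul (by positivity), ← ENNReal.ofReal_pow hq.le, ← ENNReal.ofReal_mul (by positivity)]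
        refine ENNReal.ofReal_le_ofReal ?_
        have e1 : S^(1/100:ℝ) * ((1/2)^(1/100:ℝ))^n = a n ^ (1/100:ℝ) := by
          simp only [ha]
          rw [Real.mul_rpow hS.le (by positivity), ← Real.rpow_natCast, ← Real.rpow_natCast, ← Real.rpow_mul (by norm_num), ← Real.rpow_mul (by norm_num), mul_comm (1/100:ℝ)]
        have e2 : a (n+1) ^ (-(19/20) : ℝ) ≤ 2 * a n ^ (-(19/20) : ℝ) := by
          rw [a1, Real.div_rpow an.le (by norm_num), div_eq_mul_inv, mul_comm, ← Real.rpow_neg (by norm_num)]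
          refine mul_le_mul_of_nonneg_right ?_ (by positivity)
          calc (2:ℝ) ^ (- -(19/20:ℝ)) ≤ 2 ^ (1:ℝ) := Real.rpow_le_rpow_of_exponent_le (by norm_num) (by norm_num)
            _ = 2 := by norm_num
        have e3 : a n ^ (-(19/20) : ℝ) * a n ^ (24/25:ℝ) = a n ^ (1/100:ℝ) := by rw [← Real.rpow_add an]; norm_num
        calc _ ≤ 2 * a n ^ (-(19/20) : ℝ) * (B * a n ^ (24/25:ℝ)) := mul_le_mul_of_nonneg_right e2 (by positivity)
          _ = 2 * B * (a n ^ (-(19/20) : ℝ) * a n ^ (24/25:ℝ)) := by ring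
          _ = _ := by rw [e3, ← e1]; ring
lemma sl2_meas {f : E3 × ℝ → ℝ≥0∞} (hf : Measurable f) (x : E3) : Measurable fun t => f (x, t) := hf.comp (measurable_const.prodMk measurable_id)
set_option maxHeartbeats 800000 in
lemma two_bound {R r : ℝ} (hR : 0 < R) {x0 : E3} {d u : E3 × ℝ → ℝ≥0∞} (hd : Measurable d) (hu : Measurable u)
    (d0 : ∀ z : E3 × ℝ, z.1 ∉ Metric.ball x0 r → d z = 0) {B : ℝ} (hB : 0 ≤ B)
    (h : ∀ t1 τ : ℝ, 0 < τ → ∫⁻ t in Ioo (t1-τ) t1, ((∫⁻ x, d (x,t)^2) + (∫⁻ x, u (x,t)^6)^(1/3:ℝ)) ≤ ENNReal.ofReal (B*τ^(24/25:ℝ))) :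
    ∃ C : ℝ≥0∞, C ≠ ∞ ∧ ∀ z, TT R (fun z => d z * (1 + TT R (fun z => d z * (1 + u z)) z)) z ≤ C := by
  set y : ℝ → ℝ≥0∞ := fun t => (∫⁻ x, d (x,t)^2) + (∫⁻ x, u (x,t)^6)^(1/3:ℝ) with hy
  have my : Measurable y := (sl_meas (hd.pow_const 2)).add ((sl_meas (hu.pow_const 6)).pow_const _)
  have fS := mS_fin (S := R^2) (by positivity)
  obtain ⟨C0, hC0, h0⟩ := time_morrey my hB h (S := R^2) (by positivity)
  set M := mS (R^2) univ + C0 with hM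
  have hMt : M ≠ ∞ := ENNReal.add_ne_top.2 ⟨(measure_lt_top _ _).ne, hC0⟩
  have J : ∀ t, ∫⁻ s, (1 + y (t - s)) ∂mS (R^2) ≤ M := by
    intro t
    rw [lintegral_add_left measurable_const, lintegral_const, one_mul, mS_int (by fun_prop)]
    exact add_le_add_right (h0 t) _
  set b : E3 → ℝ≥0∞ := (Metric.ball x0 r).indicator fun _ => 1
  have mb : Measurable b := measurable_const.indicator measurableSet_ball
  set V : ℝ≥0∞ := volume (Metric.ball x0 r) with hV
  have hVt : V ≠ ∞ := measure_ball_lt_top.ne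
  have db : ∀ x t, d (x,t) = d (x,t) * b x := by
    intro x t
    by_cases hx : x ∈ Metric.ball x0 r
    · simp [b, hx]
    · rw [d0 (x,t) hx, zero_mul]
  have bI : ∀ a : ℝ, 0 < a → ∫⁻ x, b x ^ a = V := by
    intro a ha
    rw [hV, ← lintegral_indicator_one measurableSet_ball]
    refine lintegral_congr fun x => ?_
    by_cases hx : x ∈ Metric.ball x0 r <;> simp [b, hx, ha]
  have nd : ∀ t, (∫⁻ x, d (x,t) ^ (2:ℝ)) ^ (1/2:ℝ) ≤ 1 + y t := by
    intro t
    have e : ∀ X : ℝ≥0∞, X ^ (1/2:ℝ) ≤ 1 + X := fun X => by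
      rcases le_total X 1 with hX | hX
      · exact (ENNReal.rpow_le_one hX (by norm_num)).trans le_self_add
      · exact ((ENNReal.rpow_le_rpow_of_exponent_le hX (by norm_num)).trans_eq (ENNReal.rpow_one X)).trans le_add_self
    refine (e _).trans (add_le_add_right ?_ _)
    simp only [ENNReal.rpow_ofNat]
    exact le_self_add
  set F : E3 × ℝ → ℝ≥0∞ := fun z => d z * (1 + u z) with hF
  have mF : Measurable F := by fun_prop
  set c1 : ℝ≥0∞ := 4 + 4 * V ^ (1/3:ℝ)
  have hc1 : c1 ≠ ∞ := by
    have := ENNReal.rpow_ne_top_of_nonneg (show (0:ℝ) ≤ 1/3 by norm_num) hVt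
    finiteness
  have nF : ∀ t, (∫⁻ x, F (x,t) ^ (3/2:ℝ)) ^ (2/3:ℝ) ≤ c1 * (1 + y t) := by
    intro t
    have mbu : Measurable fun x => b x + u (x,t) := by fun_prop
    have h1 := hol3 (d := fun x => d (x,t)) (g := fun x => b x + u (x,t)) (by fun_prop) mbu (a := 1/2) (b := 1/6) (c := 2/3) (by norm_num) (by norm_num) (by norm_num)
    have e1 : ∀ x, F (x,t) = d (x,t) * (b x + u (x,t)) := fun x => by
      simp only [hF]; rw [mul_add, mul_one, mul_add, ← db]
    simp only [e1]
    norm_num at h1 ⊢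
    refine h1.trans ?_
    have e2 : ∫⁻ x, (b x + u (x,t)) ^ 6 ≤ 64 * (V + ∫⁻ x, u (x,t) ^ 6) := by
      have : ∫⁻ x, b x ^ 6 = V := by simpa using bI 6 (by norm_num)
      rw [← this, ← lintegral_add_left (by fun_prop), ← lintegral_const_mul _ (by fun_prop)]
      refine lintegral_mono fun x => ?_
      calc (b x + u (x,t)) ^ 6 ≤ (2 * max (b x) (u (x,t))) ^ 6 := by
            refine pow_le_pow_left' ?_ 6
            rw [two_mul]; exact add_le_add (le_max_left _ _) (le_max_right _ _)
        _ = 64 * max (b x) (u (x,t)) ^ 6 := by rw [mul_pow]; norm_num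
        _ ≤ _ := by
            refine mul_le_mul_right ?_ _
            rcases le_total (b x) (u (x,t)) with hh | hh
            · rw [max_eq_right hh]; exact le_add_self
            · rw [max_eq_left hh]; exact le_self_add
    set A := ∫⁻ x, d (x,t) ^ 2 with hA
    set G := ∫⁻ x, (b x + u (x,t)) ^ 6
    have e3 : A ^ (1/2:ℝ) * G ^ (1/6:ℝ) ≤ A + G ^ (1/3:ℝ) := by
      have s1 : ∀ X : ℝ≥0∞, X ^ (1/2:ℝ) * X ^ (1/2:ℝ) = X := fun X => by
        rw [← ENNReal.rpow_add_of_nonneg _ _ (by norm_num) (by norm_num)]; norm_num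
      rw [show (1/6:ℝ) = 1/3 * (1/2) by norm_num, ENNReal.rpow_mul]
      rcases le_total A (G ^ (1/3:ℝ)) with hh | hh
      · calc _ ≤ (G ^ (1/3:ℝ)) ^ (1/2:ℝ) * (G ^ (1/3:ℝ)) ^ (1/2:ℝ) := mul_le_mul_left (ENNReal.rpow_le_rpow hh (by norm_num)) _
          _ ≤ _ := by rw [s1]; exact le_add_self
      · calc _ ≤ A ^ (1/2:ℝ) * A ^ (1/2:ℝ) := mul_le_mul_right (ENNReal.rpow_le_rpow hh (by norm_num)) _
          _ ≤ _ := by rw [s1]; exact le_self_add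
    have e4 : G ^ (1/3:ℝ) ≤ 4 * V ^ (1/3:ℝ) + 4 * (∫⁻ x, u (x,t)^6)^(1/3:ℝ) := by
      refine (ENNReal.rpow_le_rpow e2 (by norm_num)).trans ?_
      rw [ENNReal.mul_rpow_of_nonneg _ _ (by norm_num), show (64:ℝ≥0∞) = 4 ^ (3:ℝ) by norm_num, ← ENNReal.rpow_mul, ← mul_add]
      norm_num
      exact mul_le_mul_right (ENNReal.rpow_add_le_add_rpow _ _ (by norm_num) (by norm_num)) _
    refine e3.trans ((add_le_add_right e4 _).trans ?_)
    set W := (∫⁻ x, u (x,t)^6)^(1/3:ℝ)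
    calc A + (4 * V ^ (1/3:ℝ) + 4 * W) ≤ 4 * A + (4 * V ^ (1/3:ℝ) + 4 * W) := add_le_add_left (le_mul_of_one_le_left zero_le (by norm_num)) _
      _ = 4 * V ^ (1/3:ℝ) + 4 * (A + W) := by ring
      _ ≤ c1 + c1 * (A + W) := add_le_add le_add_self (mul_le_mul_left le_self_add _)
      _ = c1 * (1 + y t) := by rw [mul_add c1 1, mul_one]
  refine ⟨Pk (2*R)^2 * V ^ (1/12:ℝ) * M + Pk (2*R)^4 * c1 * M * M, ?_, fun z => ?_⟩
  · have := Pk_top (2*R)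
    have := ENNReal.rpow_ne_top_of_nonneg (show (0:ℝ) ≤ 1/12 by norm_num) hVt
    finiteness
  have mT := TT_meas hR mF
  have mdT : Measurable fun z => d z * TT R F z := hd.mul mT
  have spl : TT R (fun z => d z * (1 + TT R F z)) z = TT R d z + TT R (fun z => d z * TT R F z) z := by
    unfold TT
    rw [← lintegral_add_left (by fun_prop)]
    exact lintegral_congr fun q => by dsimp only; rw [mul_add, mul_one]
  rw [spl]
  have key : ∀ (G : ℝ → E3 → ℝ≥0∞) (c : ℝ≥0∞), (∀ s, G s z.1 ≤ c * (1 + y (z.2 - s))) → ∫⁻ s, G s z.1 ∂mS (R^2) ≤ c * M := by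
    intro G c hG
    refine (lintegral_mono hG).trans ?_
    rw [lintegral_const_mul _ (by fun_prop)]
    exact mul_le_mul_right (J _) _
  refine add_le_add ?_ ?_
  · rw [TT_eq hR hd]
    refine key (fun s => kc (2*R) (kc (2*R) fun y => d (y, z.2 - s))) _ fun s => ?_
    have h1 := kc_two (2*R) (d := fun x => d (x, z.2 - s)) (g := b) (by fun_prop) mb z.1
    simp only [← db] at h1
    rw [bI 12 (by norm_num)] at h1
    refine h1.trans ?_
    rw [mul_comm (_ ^ (1/2:ℝ)), ← mul_assoc]
    exact mul_le_mul_right (nd _) _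
  · rw [TT_eq hR mdT]
    refine key (fun s => kc (2*R) (kc (2*R) fun y => d (y, z.2 - s) * TT R F (y, z.2 - s))) _ fun s => ?_
    set t := z.2 - s
    have mKK : Measurable fun q : E3 × ℝ => kc (2*R) (kc (2*R) fun x => F (x, t - q.2)) q.1 :=
      kc_meas2 _ (kc_meas2 (2*R) (F := fun q => F (q.1, t - q.2)) (by fun_prop))
    have mG : Measurable fun q : E3 × ℝ => d (q.1, t) * kc (2*R) (kc (2*R) fun x => F (x, t - q.2)) q.1 :=
      (hd.comp (by fun_prop : Measurable fun q : E3 × ℝ => (q.1, t))).mul mKK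
    have e : ∀ w, d (w, t) * TT R F (w, t) = ∫⁻ s', d (w,t) * kc (2*R) (kc (2*R) fun x => F (x, t - s')) w ∂mS (R^2) := by
      intro w
      have mm : Measurable fun s' => kc (2*R) (kc (2*R) fun x => F (x, t - s')) w := sl2_meas mKK w
      rw [TT_eq hR mF, lintegral_const_mul _ mm]
    simp only [e]
    have e' : ∀ w, kc (2*R) (fun w => ∫⁻ s', d (w,t) * kc (2*R) (kc (2*R) fun x => F (x, t - s')) w ∂mS (R^2)) w = ∫⁻ s', kc (2*R) (fun w => d (w,t) * kc (2*R) (kc (2*R) fun x => F (x, t - s')) w) w ∂mS (R^2) :=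
      fun w => kc_swap _ mG _ w
    rw [funext e', kc_swap _ (kc_meas2 (2*R) mG)]
    calc _ ≤ ∫⁻ s', Pk (2*R)^4 * c1 * (1 + y t) * (1 + y (t - s')) ∂mS (R^2) := by
          refine lintegral_mono fun s' => ?_
          have h1 := kc_four (2*R) (d := fun x => d (x,t)) (f := fun x => F (x, t - s')) (by fun_prop) (by fun_prop) z.1
          refine h1.trans ((mul_le_mul_right (mul_le_mul' (nd t) (nF (t - s'))) _).trans (le_of_eq (by ring)))
      _ ≤ Pk (2*R)^4 * c1 * (1 + y t) * M := by
          rw [lintegral_const_mul _ (by fun_prop)]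
          exact mul_le_mul_right (J _) _
      _ = _ := by ring

end

section
open scoped Topology
lemma ae_bound {V : E3 × ℝ → ℝ} (hV : Integrable V) {U : E3 × ℝ → ℝ≥0∞} (mU : Measurable U) {O : Set (E3 × ℝ)} (hO : IsOpen O) (iU : ∫⁻ z in O, U z < ∞)
    (h : ∀ g : E3 × ℝ → ℝ, Sm g → HasCompactSupport g → tsupport g ⊆ O → ‖∫ z, V z * g z‖ₑ ≤ ∫⁻ z, U z * ‖g z‖ₑ) :
    ∀ᵐ z, z ∈ O → ‖V z‖ₑ ≤ U z := by
  obtain ⟨η, e1, e2, e3, e4, e5, e6⟩ := moll (E3 × ℝ) volume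
  have m0 : Measurable (O.indicator U) := mU.indicator hO.measurableSet
  have i0 : ∫⁻ z, O.indicator U z ≠ ∞ := by rw [lintegral_indicator hO.measurableSet]; exact iU.ne
  have iu : Integrable fun z => (O.indicator U z).toReal := integrable_toReal_of_lintegral_ne_top m0.aemeasurable i0
  filter_upwards [e6 V hV, e6 _ iu, ae_lt_top m0 i0] with z h1 h2 h3 hz
  have h1' := (continuous_enorm.tendsto _).comp h1
  have h2' := (ENNReal.continuous_ofReal.tendsto _).comp h2
  rw [ENNReal.ofReal_toReal h3.ne, indicator_of_mem hz] at h2'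
  refine le_of_tendsto_of_tendsto h1' h2' ?_
  obtain ⟨ε, hε, hb⟩ := Metric.isOpen_iff.1 hO z hz
  obtain ⟨N, hN⟩ := exists_nat_one_div_lt hε
  filter_upwards [eventually_ge_atTop N] with n hn
  have hsub : tsupport (fun y => η n (z - y)) ⊆ Metric.closedBall z (1 / ((n:ℝ) + 1)) := by
    refine closure_minimal (fun y hy => ?_) Metric.isClosed_closedBall
    rw [Metric.mem_closedBall, dist_comm, dist_eq_norm]
    by_contra hh
    exact hy (e5 n _ (not_le.1 hh).le)
  have hO' : tsupport (fun y => η n (z - y)) ⊆ O := by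
    refine hsub.trans ((Metric.closedBall_subset_ball (lt_of_le_of_lt ?_ hN)).trans hb)
    exact one_div_le_one_div_of_le (by positivity) (by simpa using hn)
  have := h (fun y => η n (z - y)) ((e1 n).comp (contDiff_const.sub contDiff_id)) ((isCompact_closedBall _ _).of_isClosed_subset (isClosed_tsupport _) hsub) hO'
  simp only [Function.comp_def]
  calc _ = ‖∫ y, V y * η n (z - y)‖ₑ := by congr 2; funext y; ring
    _ ≤ _ := this
    _ = ∫⁻ y, ENNReal.ofReal (η n (z - y) * (O.indicator U y).toReal) := by
        refine lintegral_congr_ae ((ae_lt_top m0 i0).mono fun y hy => ?_)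
        dsimp only
        rw [ENNReal.ofReal_mul (e3 _ _), ENNReal.ofReal_toReal hy.ne, Real.enorm_of_nonneg (e3 _ _), mul_comm]
        by_cases hyO : y ∈ O
        · rw [indicator_of_mem hyO]
        · rw [image_eq_zero_of_notMem_tsupport (f := fun y => η n (z - y)) fun hh => hyO (hO' hh)]; simp
    _ = _ := by
        rw [ofReal_integral_eq_lintegral_ofReal _ (ae_of_all _ fun y => mul_nonneg (e3 _ _) ENNReal.toReal_nonneg)]
        obtain ⟨C, hC⟩ := cs_bdd (g := fun y => η n (z - y)) (((e1 n).continuous).comp (by fun_prop)) ((isCompact_closedBall _ _).of_isClosed_subset (isClosed_tsupport _) hsub)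
        exact iu.bdd_mul (c := C) (((e1 n).continuous).comp (by fun_prop)).aestronglyMeasurable (ae_of_all _ hC)
def c0 : ℝ≥0∞ := mS 1 univ
lemma c0_top : c0 ≠ ∞ := by
  have := mS_fin one_pos
  exact (measure_lt_top _ _).ne
lemma kp0 {G : E3 × ℝ → ℝ≥0∞} (z : E3 × ℝ) : KP 0 1 G z = c0 * ∫⁻ w, kap w * G (z.1 - w, z.2) := by
  have : c0 = ∫⁻ s in Ioo (0:ℝ) 1, ENNReal.ofReal (s ^ (-(19/20) : ℝ)) * 1 := by
    rw [c0, ← mS_int measurable_const, lintegral_const, one_mul]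
  simp only [KP, zero_mul, add_zero]
  rw [lintegral_mul_const _ (by fun_prop), this]; simp
lemma far {x0 : E3} {r : ℝ} (hr : 0 < r) {G : E3 × ℝ → ℝ≥0∞} (h0 : ∀ z : E3 × ℝ, z.1 ∉ Metric.ball x0 (r/2) → G z = 0) (z : E3 × ℝ) (hz : 5*r/8 ≤ dist z.1 x0) :
    KP 0 1 G z ≤ c0 * (ENNReal.ofReal ((r/8) ^ (-(21/10) : ℝ)) * ∫⁻ x, G (x, z.2)) := by
  rw [kp0, ← lintegral_sub_left_eq_self (fun x => G (x, z.2)) z.1, ← lintegral_const_mul' _ _ ENNReal.ofReal_ne_top]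
  refine mul_le_mul_right (lintegral_mono fun w => ?_) _
  by_cases hw : z.1 - w ∈ Metric.ball x0 (r/2)
  · have : r/8 ≤ ‖w‖ := by
      rw [Metric.mem_ball] at hw
      have := dist_triangle z.1 (z.1 - w) x0
      rw [dist_self_sub_right] at this; linarith
    refine mul_le_mul_left ?_ _
    have hw0 : 0 < ‖w‖ := by linarith
    rw [kap, ← ofReal_norm, ENNReal.ofReal_rpow_of_pos hw0]
    exact ENNReal.ofReal_le_ofReal (Real.rpow_le_rpow_of_nonpos (by positivity) this (by norm_num))
  · simp [h0 (z.1 - w, z.2) hw]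
lemma gS_le {g : E3 × ℝ → ℝ} (hg : Continuous g) (z : E3 × ℝ) : ‖∫ y, g (z - sg 0 (1, y)) ∂gν‖ₑ ≤ ENNReal.ofReal gc * ∫⁻ x, ‖g (x, z.2)‖ₑ := by
  refine (enorm_integral_le_lintegral_enorm _).trans ?_
  have := sg_cont 0
  rw [gν_lint (Continuous.measurable (by fun_prop)), ← lintegral_sub_left_eq_self (fun x => ‖g (x, z.2)‖ₑ) z.1, ← lintegral_const_mul' _ _ ENNReal.ofReal_ne_top]
  refine lintegral_mono fun y => mul_le_mul' (ENNReal.ofReal_le_ofReal ?_) (le_of_eq ?_)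
  · unfold gd
    exact mul_le_of_le_one_right gc_pos.le (Real.exp_le_one_iff.2 (by nlinarith [sq_nonneg ‖y‖]))
  · congr 2; simp [sg, Prod.ext_iff]
lemma pot0_sup {S : ℝ} {g : E3 × ℝ → ℝ} (hg : Sm g) (hc : HasCompactSupport g) {t : ℝ} (h : ∀ x, g (x, t) = 0) (x : E3) : pot 0 S g (x, t) = 0 := by
  rw [pot_eq hg.continuous hc]
  have : ∀ s y, g ((x, t) - sg 0 (s, y)) = 0 := fun s y => by simpa [sg] using h _
  simp [this]
/-- the time window of a test function -/
lemma win {x0 : E3} {t0 r : ℝ} {g : E3 × ℝ → ℝ} (hc : HasCompactSupport g) (hs : tsupport g ⊆ pcyl (x0, t0) (r/2)) :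
    ∃ a b : ℝ, t0 - (r/2)^2 < a ∧ b < t0 ∧ (∀ z, b ≤ z.2 → g z = 0) ∧ ∀ z, z.2 ≤ a → g z = 0 := by
  have hK : IsCompact (Prod.snd '' tsupport g) := hc.isCompact.image continuous_snd
  have hsub : Prod.snd '' tsupport g ⊆ Ioo (t0 - (r/2)^2) t0 := by rintro _ ⟨z, hz, rfl⟩; exact (hs hz).2
  rcases (Prod.snd '' tsupport g).eq_empty_or_nonempty with he | hne
  · have h0 : ∀ z, g z = 0 := fun z => image_eq_zero_of_notMem_tsupport fun h => by
      have := mem_image_of_mem Prod.snd h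
      rw [he] at this; exact this
    exact ⟨t0 - (r/2)^2 + 1, t0 - 1, by linarith, by linarith, fun z _ => h0 z, fun z _ => h0 z⟩
  · obtain ⟨b, hb, hb'⟩ := hK.exists_isGreatest hne
    obtain ⟨a, ha, ha'⟩ := hK.exists_isLeast hne
    have h1 := hsub hb
    have h2 := hsub ha
    refine ⟨(a + (t0 - (r/2)^2))/2, (b + t0)/2, by linarith [h2.1], by linarith [h1.2], fun z hz => ?_, fun z hz => ?_⟩
    · refine image_eq_zero_of_notMem_tsupport fun h => ?_
      linarith [hb' (mem_image_of_mem Prod.snd h), h1.2]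
    · refine image_eq_zero_of_notMem_tsupport fun h => ?_
      linarith [ha' (mem_image_of_mem Prod.snd h), h2.1]

end

section
open scoped Topology
lemma flat {f : E3 × ℝ → ℝ} {z : E3 × ℝ} {c : ℝ} (h : f =ᶠ[𝓝 z] fun _ => c) : (∀ i, sdz f i z = 0) ∧ lapz f z = 0 := by
  have a : ∀ i, sdz f i =ᶠ[𝓝 z] fun _ => (0:ℝ) := fun i => by
    filter_upwards [h.fderiv (𝕜 := ℝ)] with w hw
    simp [sdz, hw]
  refine ⟨fun i => (a i).self_of_nhds, ?_⟩
  simp only [lapz]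
  refine Finset.sum_eq_zero fun i _ => ?_
  simp [sdz, (a i).fderiv_eq]
lemma ts_cut {χ : E3 → ℝ} (h2 : HasCompactSupport χ) {g : E3 × ℝ → ℝ} (hg : Sm g) (hc : HasCompactSupport g)
    {a b : ℝ} (hb : ∀ z, b ≤ z.2 → g z = 0) (ha : ∀ z, z.2 ≤ a → g z = 0) :
    tsupport (fun z => χ z.1 * pot 0 1 g z) ⊆ tsupport χ ×ˢ Icc a b ∧ HasCompactSupport (fun z => χ z.1 * pot 0 1 g z) := by
  have ts : tsupport (fun z => χ z.1 * pot 0 1 g z) ⊆ tsupport χ ×ˢ Icc a b := by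
    refine closure_minimal (fun z hz' => ?_) ((isClosed_tsupport χ).prod isClosed_Icc)
    rw [Function.mem_support] at hz'
    refine ⟨subset_tsupport _ fun h => hz' (by simp [h]), ?_, ?_⟩
    · by_contra h; exact hz' (by rw [show z = (z.1, z.2) from rfl, pot0_sup hg hc (fun x => ha _ (not_le.1 h).le), mul_zero])
    · by_contra h; exact hz' (by rw [show z = (z.1, z.2) from rfl, pot0_sup hg hc (fun x => hb _ (not_le.1 h).le), mul_zero])
  exact ⟨ts, (h2.isCompact.prod isCompact_Icc).of_isClosed_subset (isClosed_tsupport _) ts⟩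
lemma cutE {x0 : E3} {t0 r : ℝ} (hr : 0 < r) {χ : E3 → ℝ} (h1 : Sm χ) (h2 : HasCompactSupport χ) (h4 : ∀ x ∈ Metric.closedBall x0 (5*r/8), χ x = 1) :
    ∃ C : ℝ≥0∞, C ≠ ∞ ∧ ∀ g : E3 × ℝ → ℝ, Sm g → HasCompactSupport g → tsupport g ⊆ pcyl (x0, t0) (r/2) → ∀ z,
      ‖lapz (fun z => χ z.1 * pot 0 1 g z) z + g z‖ₑ ≤ C * ∫⁻ x, ‖g (x, z.2)‖ₑ := by
  obtain ⟨K, hK, k0, k1, k2⟩ := cutb h1 h2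
  obtain ⟨A, hA, pb⟩ := pot_bound (l := 0) one_pos
  set F : ℝ≥0∞ := ENNReal.ofReal A * (c0 * ENNReal.ofReal ((r/8) ^ (-(21/10) : ℝ))) with hF
  have hF' : F ≠ ∞ := by have := c0_top; finiteness
  refine ⟨ENNReal.ofReal K * ENNReal.ofReal gc + 7 * (ENNReal.ofReal K * F), by finiteness, fun g hg hc hs z => ?_⟩
  have H : IsP (gM 0 1) (pot 0 1 g) := ⟨g, hg, hc, rfl⟩
  have sχ : Sm fun z : E3 × ℝ => χ z.1 := h1.comp contDiff_fst
  have hh := pot_heat (l := 0) one_pos hg hc z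
  have hχg : χ z.1 * g z = g z := by
    by_cases hz : z ∈ tsupport g
    · rw [h4 _ (Metric.ball_subset_closedBall (Metric.ball_subset_ball (by linarith) (hs hz).1)), one_mul]
    · simp [image_eq_zero_of_notMem_tsupport hz]
  have e : lapz (fun z => χ z.1 * pot 0 1 g z) z + g z = χ z.1 * (∫ y, g (z - sg 0 (1, y)) ∂gν) + (lapz (fun z => χ z.1) z * pot 0 1 g z
      + 2 * ∑ i, sdz (fun z => χ z.1) i z * sdz (pot 0 1 g) i z) := by
    rw [lapz_mul sχ H.sm]
    linear_combination χ z.1 * hh - hχg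
  set P := ∫⁻ x, ‖g (x, z.2)‖ₑ with hP
  rw [e, add_mul]
  have en : ∀ {a : ℝ}, |a| ≤ K → ‖a‖ₑ ≤ ENNReal.ofReal K := fun h => by
    rw [← ofReal_norm]; exact ENNReal.ofReal_le_ofReal h
  refine (enorm_add_le _ _).trans (add_le_add ?_ ?_)
  · rw [enorm_mul, mul_assoc]
    exact mul_le_mul' (en (k0 _)) (gS_le hg.continuous z)
  by_cases hd : dist z.1 x0 < 5*r/8
  · have hn : (fun z : E3 × ℝ => χ z.1) =ᶠ[𝓝 z] fun _ => 1 := by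
      filter_upwards [(Metric.isOpen_ball.preimage continuous_fst).mem_nhds (show z ∈ Prod.fst ⁻¹' Metric.ball x0 (5*r/8) from hd)] with w hw
      exact h4 _ (Metric.ball_subset_closedBall hw)
    obtain ⟨q1, q2⟩ := flat hn
    simp [q1, q2]
  · have hfar := far hr (G := fun z => ‖g z‖ₑ) (x0 := x0) (fun w hw => by
      rw [image_eq_zero_of_notMem_tsupport (f := g) fun h => hw (hs h).1, enorm_zero]) z (not_lt.1 hd)
    obtain ⟨p1, p2⟩ := pb hg hc z
    have hb : ENNReal.ofReal A * KP 0 1 (fun z => ‖g z‖ₑ) z ≤ F * P := by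
      refine (mul_le_mul_right hfar _).trans (le_of_eq ?_)
      rw [hF]; ring
    have q1 : ‖lapz (fun z => χ z.1) z * pot 0 1 g z‖ₑ ≤ ENNReal.ofReal K * (F * P) := by
      rw [enorm_mul]; exact mul_le_mul' (en (k2 z)) (p1.trans hb)
    have q2 : ∀ i, ‖sdz (fun z => χ z.1) i z * sdz (pot 0 1 g) i z‖ₑ ≤ ENNReal.ofReal K * (F * P) := fun i => by
      rw [enorm_mul]; exact mul_le_mul' (en (k1 i z)) ((p2 i).trans hb)
    refine (enorm_add_le _ _).trans ((add_le_add q1 ?_).trans (le_of_eq (a := ENNReal.ofReal K * (F * P) + 2 * (3 * (ENNReal.ofReal K * (F * P)))) (by ring)))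
    rw [enorm_mul, show ‖(2:ℝ)‖ₑ = 2 by rw [← ofReal_norm]; norm_num]
    refine mul_le_mul_right ((enorm_sum_le _ _).trans ((Finset.sum_le_sum fun i _ => q2 i).trans (by simp))) _
lemma Loc.v1 {x0 t0 r v D} (L : Loc x0 t0 r v D) : ∃ M : ℝ≥0∞, M ≠ ∞ ∧ ∀ᵐ t, ∫⁻ x, ‖v (x, t)‖ₑ ≤ M := by
  obtain ⟨M, hM, h⟩ := L.vM
  refine ⟨volume (Metric.ball x0 r) + ENNReal.ofReal M, by have := (measure_ball_lt_top (μ := (volume : Measure E3)) (x := x0) (r := r)).ne; finiteness, h.mono fun t ht => ?_⟩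
  refine le_trans ?_ (add_le_add_right ht _)
  rw [← lintegral_indicator_one Metric.isOpen_ball.measurableSet, ← lintegral_add_left (measurable_one.indicator Metric.isOpen_ball.measurableSet)]
  refine lintegral_mono fun x => ?_
  by_cases hx : x ∈ Metric.ball x0 r
  · simp only [indicator_of_mem hx, Pi.one_apply]
    rcases le_total ‖v (x, t)‖ₑ 1 with h | h
    · exact h.trans le_self_add
    · refine le_trans ?_ le_add_self
      rw [sq]; exact le_mul_of_one_le_left (zero_le) h
  · have : v (x, t) = 0 := L.v0 (x, t) fun h => hx h.1
    simp [this]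
lemma Loc.vtest {x0 t0 r v D} (L : Loc x0 t0 r v D) {χ : E3 → ℝ} (h1 : Sm χ) (h2 : HasCompactSupport χ) (h3 : tsupport χ ⊆ Metric.closedBall x0 (3*r/4))
    (h4 : ∀ x ∈ Metric.closedBall x0 (5*r/8), χ x = 1) :
    ∃ K : ℝ≥0∞, K ≠ ∞ ∧ ∀ g : E3 × ℝ → ℝ, Sm g → HasCompactSupport g → tsupport g ⊆ pcyl (x0, t0) (r/2) → ∀ i,
      ‖∫ z, v z i * g z‖ₑ ≤ K * (∫⁻ z, ‖g z‖ₑ) + ∑ j, ‖∫ z, om D j i z * sdz (fun z => χ z.1 * pot 0 1 g z) j z‖ₑ := by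
  have hr := L.hr
  obtain ⟨C, hC, hE⟩ := cutE (x0 := x0) (t0 := t0) hr h1 h2 h4
  obtain ⟨M, hM, hv⟩ := L.v1
  refine ⟨C * M, by finiteness, fun g hg hc hs i => ?_⟩
  obtain ⟨a, b, ha, hb, g1, g2⟩ := win hc hs
  obtain ⟨ts, cΦ⟩ := ts_cut h2 hg hc g1 g2
  have H : IsP (gM 0 1) (pot 0 1 g) := ⟨g, hg, hc, rfl⟩
  have hE' := hE g hg hc hs
  set Φ : E3 × ℝ → ℝ := fun z => χ z.1 * pot 0 1 g z with hΦ
  have sΦ : Sm Φ := (h1.comp contDiff_fst).mul H.sm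
  have tsQ : tsupport Φ ⊆ pcyl (x0, t0) r := by
    refine ts.trans (prod_mono (h3.trans (Metric.closedBall_subset_ball (by linarith))) fun t ht => ⟨?_, ?_⟩)
    · simp only; nlinarith [ht.1]
    · simp only; linarith [ht.2]
  have h0 := L.H3 Φ sΦ cΦ tsQ i
  obtain ⟨M2, b2⟩ := cs_bdd sΦ.lapz.continuous (HasCompactSupport.of_support_subset_isCompact cΦ fun z hz => by by_contra h; exact hz (out_l h))
  choose M3 b3 using fun i => cs_bdd (sΦ.sdz i).continuous (cs_sdz cΦ i)
  obtain ⟨M4, b4⟩ := cs_bdd hg.continuous hc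
  have iv : Integrable fun z => v z i := (EuclideanSpace.proj (𝕜 := ℝ) i).integrable_comp L.iv
  have i1 : Integrable fun z => v z i * lapz Φ z := iv.mul_bdd (c := M2) sΦ.lapz.continuous.aestronglyMeasurable (ae_of_all _ b2)
  have i2 : Integrable fun z => v z i * g z := iv.mul_bdd (c := M4) hg.continuous.aestronglyMeasurable (ae_of_all _ b4)
  have i3 : ∀ j, Integrable fun z => om D j i z * sdz Φ j z := fun j => (L.iom j i).mul_bdd (c := M3 j) (sΦ.sdz j).continuous.aestronglyMeasurable (ae_of_all _ (b3 j))
  rw [integral_add i1 (integrable_finsetSum _ fun j _ => i3 j), integral_finsetSum _ fun j _ => i3 j] at h0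
  have e : ∫ z, v z i * g z = (∫ z, v z i * (lapz Φ z + g z)) + ∑ j, ∫ z, om D j i z * sdz Φ j z := by
    simp only [mul_add]; rw [integral_add i1 i2]; linarith
  rw [e]
  refine (enorm_add_le _ _).trans (add_le_add ((enorm_integral_le_lintegral_enorm _).trans ?_) (enorm_sum_le _ _))
  have mP : Measurable fun t => ∫⁻ x, ‖g (x, t)‖ₑ := sl_meas hg.continuous.measurable.enorm
  have mvn : Measurable fun z => ‖v z‖ₑ := L.mv.enorm
  calc _ ≤ ∫⁻ z, C * (‖v z‖ₑ * ∫⁻ x, ‖g (x, z.2)‖ₑ) := lintegral_mono fun z => by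
        rw [enorm_mul, mul_left_comm]
        refine mul_le_mul' ?_ (hE' z)
        rw [← ofReal_norm, ← ofReal_norm]; exact ENNReal.ofReal_le_ofReal (PiLp.norm_apply_le _ _)
    _ = C * ∫⁻ t, (∫⁻ x, ‖v (x, t)‖ₑ) * ∫⁻ x, ‖g (x, t)‖ₑ := by
        rw [lintegral_const_mul' _ _ hC, st_prod (f := fun z => ‖v z‖ₑ * ∫⁻ x, ‖g (x, z.2)‖ₑ) (mvn.mul (mP.comp measurable_snd))]
        congr 1
        refine lintegral_congr fun t => ?_
        dsimp only; rw [lintegral_mul_const _ (sl1_meas mvn t)]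
    _ ≤ C * ∫⁻ t, M * ∫⁻ x, ‖g (x, t)‖ₑ := mul_le_mul_right (lintegral_mono_ae (hv.mono fun t ht => mul_le_mul_left ht _)) _
    _ = _ := by rw [lintegral_const_mul' _ _ hM, ← st_prod hg.continuous.measurable.enorm, mul_assoc]

end

section
lemma hbd {x0 : E3} {r : ℝ} {χ : E3 → ℝ} (h1 : Sm χ) (h2 : HasCompactSupport χ) (h3 : tsupport χ ⊆ Metric.closedBall x0 (3*r/4)) :
    ∃ C : ℝ≥0∞, C ≠ ∞ ∧ ∀ g : E3 × ℝ → ℝ, Sm g → HasCompactSupport g → ∀ j z,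
      ‖sdz (fun z => χ z.1 * pot 0 1 g z) j z‖ₑ ≤ C * ∫⁻ w, kap w * ‖g (z.1 - w, z.2)‖ₑ := by
  obtain ⟨K, hK, k0, k1, k2⟩ := cutb h1 h2
  obtain ⟨A, hA, pb⟩ := pot_bound (l := 0) one_pos
  refine ⟨2 * ENNReal.ofReal K * (ENNReal.ofReal A * c0), by have := c0_top; finiteness, fun g hg hc j z => ?_⟩
  have H : IsP (gM 0 1) (pot 0 1 g) := ⟨g, hg, hc, rfl⟩
  obtain ⟨p1, p2⟩ := pb hg hc z
  rw [kp0] at p1 p2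
  rw [sdz_mul (f := fun z => χ z.1) (h1.comp contDiff_fst) H.sm]
  have en : ∀ {a : ℝ}, |a| ≤ K → ‖a‖ₑ ≤ ENNReal.ofReal K := fun h => by
    rw [← ofReal_norm]; exact ENNReal.ofReal_le_ofReal h
  refine (enorm_add_le _ _).trans ?_
  rw [enorm_mul, enorm_mul]
  refine (add_le_add (mul_le_mul' (en (k1 j z)) p1) (mul_le_mul' (en (k0 z.1)) (p2 j))).trans (le_of_eq ?_)
  ring
lemma near {x0 : E3} {r R s : ℝ} (hR : r ≤ R) {y w : E3} (hy : dist y x0 < r) (hs : s < r) {c : ℝ≥0∞} (h : dist (y - w) x0 ≤ s ∨ c = 0) :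
    kap w * c ≤ kR (2*R) w * c := by
  rcases h with h | h
  · refine mul_le_mul_left (le_of_eq ?_) _
    rw [kR, indicator_of_mem]
    rw [mem_ball_zero_iff]
    have := dist_triangle_right y (y - w) x0
    rw [dist_self_sub_right] at this; linarith
  · simp [h]
lemma kpNN {x0 : E3} {r R : ℝ} (hr : 0 < r) (hR : r ≤ R) {G H : E3 × ℝ → ℝ≥0∞} (mG : Measurable G) {C : ℝ≥0∞} (hC : C ≠ ∞)
    (g0 : ∀ z : E3 × ℝ, z.1 ∉ Metric.ball x0 (r/2) → G z = 0) (h0 : ∀ z : E3 × ℝ, z.1 ∉ Metric.closedBall x0 (3*r/4) → H z = 0)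
    (hH : ∀ z, H z ≤ C * ∫⁻ w, kap w * G (z.1 - w, z.2)) (z : E3 × ℝ) (hz : z.1 ∈ Metric.ball x0 r) :
    KP 1 (R^2) H z ≤ C * ∫⁻ q, G (z - q) ∂NN R := by
  have hR0 : 0 < R := hr.trans_le hR
  rw [NN_int hR0 (F := fun q => G (z - q)) (mG.comp (measurable_const.sub measurable_id)), mS,
    lintegral_withDensity_eq_lintegral_mul_non_measurable _ (by fun_prop) (ae_of_all _ fun _ => ENNReal.ofReal_lt_top), KP, ← lintegral_const_mul' _ _ hC]
  refine lintegral_mono fun s => ?_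
  simp only [Pi.mul_apply]
  rw [mul_left_comm, ← lintegral_const_mul' _ _ hC]
  refine mul_le_mul_right (lintegral_mono fun w => ?_) _
  dsimp only
  refine (near (s := 3*r/4) hR hz (by linarith) ?_).trans ?_
  · by_cases hw : z.1 - w ∈ Metric.closedBall x0 (3*r/4)
    · exact Or.inl hw
    · exact Or.inr (h0 (z.1 - w, z.2 + 1 * s) hw)
  rw [mul_left_comm]
  by_cases hw : z.1 - w ∈ Metric.closedBall x0 (3*r/4)
  swap
  · rw [h0 (z.1 - w, z.2 + 1 * s) hw]; simp
  refine mul_le_mul_right ((hH (z.1 - w, z.2 + 1 * s)).trans (mul_le_mul_right (lintegral_mono fun w' => ?_) _)) _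
  dsimp only
  refine (near (x0 := x0) (s := r/2) hR (lt_of_le_of_lt hw (by linarith)) (by linarith) ?_).trans (le_of_eq ?_)
  · by_cases hw : z.1 - w - w' ∈ Metric.ball x0 (r/2)
    · exact Or.inl (le_of_lt hw)
    · exact Or.inr (g0 (z.1 - w - w', z.2 + 1 * s) hw)
  · congr 2
    simp [Prod.ext_iff, sub_sub]
def FF (v : E3 × ℝ → E3) (D : E3 × ℝ → Fin 3 → Fin 3 → ℝ) (z : E3 × ℝ) : ℝ≥0∞ := ‖D z‖ₑ * (1 + ‖v z‖ₑ)
lemma Loc.mF {x0 t0 r v D} (L : Loc x0 t0 r v D) : Measurable (FF v D) := L.mD.enorm.mul (measurable_const.add L.mv.enorm)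
lemma errI_le {χ χ1 : E3 → ℝ} {v : E3 × ℝ → E3} {D : E3 × ℝ → Fin 3 → Fin 3 → ℝ} {τ K : ℝ} (a : ∀ x, |χ x| ≤ K) (b : ∀ x, |χ1 x| ≤ K) {j k : Fin 3} {Ψ : E3 × ℝ → ℝ}
    {z : E3 × ℝ} {X : ℝ≥0∞} (p1 : ‖Ψ z‖ₑ ≤ X) (p2 : ∀ i, ‖sdz Ψ i z‖ₑ ≤ X) :
    errI χ χ1 v D τ j k Ψ z ≤ (2 * ENNReal.ofReal τ⁻¹ * ENNReal.ofReal K + 4 + 4 * ENNReal.ofReal K ^ 2) * (FF v D z * X) := by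
  have en : ∀ {a : ℝ}, |a| ≤ K → ‖a‖ₑ ≤ ENNReal.ofReal K := fun h => by
    rw [← ofReal_norm]; exact ENNReal.ofReal_le_ofReal h
  have s3 : ∑ i, ‖sdz Ψ i z‖ₑ ≤ 3 * X := (Finset.sum_le_sum fun i _ => p2 i).trans (by simp)
  have d1 : ‖D z‖ₑ ≤ FF v D z := le_mul_of_one_le_right zero_le le_self_add
  have d2 : ‖v z‖ₑ * ‖D z‖ₑ ≤ FF v D z := by rw [mul_comm]; exact mul_le_mul_right le_add_self _
  have o : ‖om D j k z‖ₑ ≤ 2 * FF v D z := by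
    refine le_trans ?_ (mul_le_mul_right d1 _)
    have := ENNReal.ofReal_le_ofReal (om_le D j k z)
    rw [ENNReal.ofReal_mul (by norm_num), ofReal_norm, ← Real.norm_eq_abs, ofReal_norm] at this
    simpa using this
  set κ := ENNReal.ofReal K
  set F := FF v D z
  have t1 : ENNReal.ofReal τ⁻¹ * ‖χ z.1 * om D j k z‖ₑ * ‖Ψ z‖ₑ ≤ ENNReal.ofReal τ⁻¹ * (κ * (2 * F)) * X := by
    rw [enorm_mul]
    exact mul_le_mul' (mul_le_mul_right (mul_le_mul' (en (a _)) o) _) p1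
  have t2 : ‖D z‖ₑ * (‖Ψ z‖ₑ + ∑ i, ‖sdz Ψ i z‖ₑ) ≤ F * (X + 3 * X) := mul_le_mul' d1 (add_le_add p1 s3)
  have t3 : (‖χ z.1‖ₑ * ‖v z‖ₑ) * ‖D z‖ₑ * (‖χ1 z.1‖ₑ * ∑ i, ‖sdz Ψ i z‖ₑ) ≤ κ * F * (κ * (3 * X)) := by
    rw [mul_assoc ‖χ z.1‖ₑ]
    exact mul_le_mul' (mul_le_mul' (en (a _)) d2) (mul_le_mul' (en (b _)) s3)
  have t4 : (‖χ1 z.1‖ₑ * ‖v z‖ₑ) * ‖D z‖ₑ * (‖χ1 z.1‖ₑ * ‖Ψ z‖ₑ) ≤ κ * F * (κ * X) := by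
    rw [mul_assoc ‖χ1 z.1‖ₑ]
    exact mul_le_mul' (mul_le_mul' (en (b _)) d2) (mul_le_mul' (en (b _)) p1)
  refine (add_le_add (add_le_add (add_le_add t1 t2) t3) t4).trans (le_of_eq ?_)
  ring
lemma Loc.otest {x0 t0 r v D} (L : Loc x0 t0 r v D) {R : ℝ} (hR : r ≤ R) {χ : E3 → ℝ} (h1 : Sm χ) (h2 : HasCompactSupport χ) (h3 : tsupport χ ⊆ Metric.closedBall x0 (3*r/4)) :
    ∃ K : ℝ≥0∞, K ≠ ∞ ∧ ∀ g : E3 × ℝ → ℝ, Sm g → HasCompactSupport g → tsupport g ⊆ pcyl (x0, t0) (r/2) → ∀ i j,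
      ‖∫ z, om D j i z * sdz (fun z => χ z.1 * pot 0 1 g z) j z‖ₑ ≤ K * ∫⁻ z, TT R (FF v D) z * ‖g z‖ₑ := by
  have hr := L.hr
  have hR0 : 0 < R := hr.trans_le hR
  obtain ⟨χ2, a1, a2, a3, a4⟩ := bump x0 (a := 3*r/4) (b := 7*r/8) (by linarith) (by linarith)
  obtain ⟨χ3, b1, b2, b3, b4⟩ := bump x0 (a := 7*r/8) (b := r) (by linarith) (by linarith)
  obtain ⟨K2, _, k2, _, _⟩ := cutb a1 a2
  obtain ⟨K3, _, k3, _, _⟩ := cutb b1 b2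
  obtain ⟨C, hC, hh⟩ := hbd h1 h2 h3
  obtain ⟨A, hA, pb⟩ := pot_bound (l := 1) (S := R^2) (by positivity)
  obtain ⟨K, hK, T⟩ := L.tst a1 a2 (a3.trans (Metric.closedBall_subset_ball (by linarith))) (fun x hx => b4 x (a3 hx))
  set Z : ℝ≥0∞ := 2 * ENNReal.ofReal (r^2)⁻¹ * ENNReal.ofReal (max K2 K3) + 4 + 4 * ENNReal.ofReal (max K2 K3) ^ 2 with hZ
  have hZt : Z ≠ ∞ := by finiteness
  refine ⟨ENNReal.ofReal K * (Z * (ENNReal.ofReal A * C)), by finiteness, fun g hg hc hs i j => ?_⟩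
  obtain ⟨a, b, ha, hb, g1, g2⟩ := win hc hs
  obtain ⟨ts, cΦ⟩ := ts_cut h2 hg hc g1 g2
  have H : IsP (gM 0 1) (pot 0 1 g) := ⟨g, hg, hc, rfl⟩
  have hh' := hh g hg hc j
  set Φ : E3 × ℝ → ℝ := fun z => χ z.1 * pot 0 1 g z with hΦ
  have sΦ : Sm Φ := (h1.comp contDiff_fst).mul H.sm
  have hz0 : ∀ z : E3 × ℝ, z.1 ∉ Metric.closedBall x0 (3*r/4) → sdz Φ j z = 0 := fun z hz => out_s (fun h => hz (h3 (ts h).1)) j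
  have e : ∫ z, om D j i z * sdz Φ j z = ∫ z, χ2 z.1 * om D j i z * sdz Φ j z := by
    congr 1; funext z
    by_cases hz : z.1 ∈ Metric.closedBall x0 (3*r/4)
    · rw [a4 _ hz, one_mul]
    · simp [hz0 z hz]
  rw [e]
  have hr2 : 0 < r^2 := by positivity
  refine (T t0 (r^2) (R^2) ((b+t0)/2) (sdz Φ j) hr2 (by gcongr) le_rfl le_rfl (by linarith) (sΦ.sdz j) (cs_sdz cΦ j)
    (fun z hz => out_s (fun h => ?_) j) (fun z hz => out_s (fun h => ?_) j) j i).trans ?_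
  · linarith [(ts h).2.2]
  · nlinarith [(ts h).2.1]
  rw [mul_assoc]
  refine mul_le_mul_right ?_ _
  have mg : Measurable fun z => ‖g z‖ₑ := hg.continuous.measurable.enorm
  have mNg : Measurable fun z => ∫⁻ q, ‖g (z - q)‖ₑ ∂NN R := by
    have := NN_fin hR0
    exact Measurable.lintegral_prod_right' (f := fun q : (E3 × ℝ) × (E3 × ℝ) => ‖g (q.1 - q.2)‖ₑ) (mg.comp (measurable_fst.sub measurable_snd))
  calc _ ≤ ∫⁻ t in Ioo (t0 - r^2) t0, ∫⁻ x, Z * (ENNReal.ofReal A * C) * (FF v D (x, t) * ∫⁻ q, ‖g ((x, t) - q)‖ₑ ∂NN R) := by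
        refine lintegral_mono fun t => lintegral_mono fun x => ?_
        obtain ⟨p1, p2⟩ := pb (sΦ.sdz j) (cs_sdz cΦ j) (x, t)
        refine (errI_le (fun x => (k2 x).trans (le_max_left _ _)) (fun x => (k3 x).trans (le_max_right _ _)) p1 p2).trans ?_
        rw [mul_assoc Z]
        refine mul_le_mul_right ?_ _
        by_cases hx : x ∈ Metric.ball x0 r
        · have hk := kpNN hr hR mg hC (x0 := x0) (H := fun z => ‖sdz Φ j z‖ₑ) (fun w hw => by
            rw [image_eq_zero_of_notMem_tsupport (f := g) fun h => hw (hs h).1, enorm_zero]) (fun w hw => by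
            rw [hz0 w hw, enorm_zero]) (fun z => hh' z) (x, t) hx
          refine (mul_le_mul_right (mul_le_mul_right hk _) _).trans (le_of_eq ?_)
          ring
        · have : D (x, t) = 0 := L.D0 (x, t) fun h => hx h.1
          simp [FF, this]
    _ ≤ ∫⁻ t, ∫⁻ x, Z * (ENNReal.ofReal A * C) * (FF v D (x, t) * ∫⁻ q, ‖g ((x, t) - q)‖ₑ ∂NN R) := setLIntegral_le_lintegral _ _
    _ = Z * (ENNReal.ofReal A * C) * ∫⁻ z, FF v D z * ∫⁻ q, ‖g (z - q)‖ₑ ∂NN R := by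
        rw [st_prod (f := fun z => FF v D z * ∫⁻ q, ‖g (z - q)‖ₑ ∂NN R) (L.mF.mul mNg), ← lintegral_const_mul' _ _ (by finiteness)]
        refine lintegral_congr fun t => ?_
        rw [lintegral_const_mul' _ _ (by finiteness)]
    _ = _ := by rw [TT_dual hR0 L.mF mg]
lemma Loc.pass {x0 t0 r v D} (L : Loc x0 t0 r v D) {R : ℝ} (hR : r ≤ R) :
    ∃ C : ℝ≥0∞, C ≠ ∞ ∧ ∀ᵐ z, z ∈ pcyl (x0, t0) (r/2) → ‖v z‖ₑ ≤ C * (1 + TT R (FF v D) z) := by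
  have hr := L.hr
  have hR0 : 0 < R := hr.trans_le hR
  obtain ⟨χ, h1, h2, h3, h4⟩ := bump x0 (a := 5*r/8) (b := 3*r/4) (by linarith) (by linarith)
  obtain ⟨K, hK, hv⟩ := L.vtest h1 h2 h3 h4
  obtain ⟨K', hK', ho⟩ := L.otest hR h1 h2 h3
  have mT : Measurable (TT R (FF v D)) := TT_meas hR0 L.mF
  have iF : ∫⁻ z, FF v D z < ∞ := by
    have : ∀ z, FF v D z = ‖D z‖ₑ + ‖‖v z‖ * ‖D z‖‖ₑ := fun z => by
      rw [FF, mul_add, mul_one, enorm_mul, enorm_norm, enorm_norm, mul_comm ‖D z‖ₑ ‖v z‖ₑ]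
    simp only [this]
    rw [lintegral_add_left L.mD.enorm]
    exact ENNReal.add_lt_top.2 ⟨L.iD.2, L.ivD.2⟩
  have iT := TT_L1 hR0 L.mF iF
  have key : ∀ i, ∀ᵐ z, z ∈ pcyl (x0, t0) (r/2) → ‖v z i‖ₑ ≤ K + 3 * K' * TT R (FF v D) z := fun i => by
    refine ae_bound (V := fun z => v z i) (U := fun z => K + 3 * K' * TT R (FF v D) z) ((EuclideanSpace.proj (𝕜 := ℝ) i).integrable_comp L.iv) (measurable_const.add (measurable_const.mul mT)) (pcyl_open _ _) ?_ fun g hg hc hs => ?_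
    · rw [lintegral_add_left measurable_const, lintegral_const_mul' _ _ (by finiteness), setLIntegral_const]
      have a1 := (pcyl_fin (x0, t0) (r/2)).ne
      have a2 := ((setLIntegral_le_lintegral (pcyl (x0, t0) (r/2)) (TT R (FF v D))).trans_lt iT).ne
      exact lt_top_iff_ne_top.2 (by finiteness)
    · refine (hv g hg hc hs i).trans ((add_le_add_right (Finset.sum_le_sum fun j _ => ho g hg hc hs i j) _).trans (le_of_eq ?_))
      have mg : Measurable fun z => ‖g z‖ₑ := hg.continuous.measurable.enorm
      simp only [add_mul, Finset.sum_const, Finset.card_univ, Fintype.card_fin, mul_assoc]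
      rw [lintegral_add_left (f := fun z => K * ‖g z‖ₑ) (measurable_const.mul mg), lintegral_const_mul' _ _ hK, lintegral_const_mul' _ _ (by finiteness), lintegral_const_mul' _ _ hK']
      simp
  refine ⟨3 * (K + 3 * K'), by finiteness, ?_⟩
  filter_upwards [key 0, key 1, key 2] with z q0 q1 q2 hz
  refine (v_le_sum _).trans ((add_le_add (add_le_add (q0 hz) (q1 hz)) (q2 hz)).trans ?_)
  calc _ = 3 * K + 3 * (3 * K') * TT R (FF v D) z := by ring
    _ ≤ 3 * K + 3 * (3 * K') * TT R (FF v D) z + (3 * (3 * K') + 3 * K * TT R (FF v D) z) := le_self_add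
    _ = _ := by ring

end

section
lemma TT_ae {ρ : ℝ} (h : 0 < ρ) {F G : E3 × ℝ → ℝ≥0∞} (hF : Measurable F) (hG : Measurable G) (hFG : ∀ᵐ z, F z ≤ G z) : ∀ᵐ z, TT ρ F z ≤ TT ρ G z := by
  have mN : MeasurableSet {z | ¬ F z ≤ G z} := (measurableSet_le hF hG).compl
  set N := {z | ¬ F z ≤ G z}
  have m1 : Measurable (N.indicator (1 : E3 × ℝ → ℝ≥0∞)) := measurable_one.indicator mN
  have h0 : ∫⁻ z, TT ρ (N.indicator 1) z = 0 := by
    have := TT_dual h m1 (G := fun _ => 1) measurable_const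
    simp only [mul_one] at this
    rw [← this, lintegral_mul_const _ m1, lintegral_indicator_one mN, show volume N = 0 from hFG, zero_mul]
  rw [lintegral_eq_zero_iff (TT_meas h m1)] at h0
  filter_upwards [h0] with z hz
  have hz' : ∫⁻ q, N.indicator 1 (z + q) ∂NN ρ = 0 := hz
  rw [lintegral_eq_zero_iff (f := fun q => N.indicator 1 (z + q)) (m1.comp (measurable_const.add measurable_id))] at hz'
  refine lintegral_mono_ae (hz'.mono fun q hq => ?_)
  by_contra hh
  have : z + q ∈ N := hh
  simp [indicator_of_mem this] at hq
lemma frob_le (M : Fin 3 → Fin 3 → ℝ) : ‖M‖ ≤ ‖frob M‖ := by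
  refine (pi_norm_le_iff_of_nonneg (norm_nonneg _)).2 fun i => (pi_norm_le_iff_of_nonneg (norm_nonneg _)).2 fun j => ?_
  exact PiLp.norm_apply_le (frob M) (i, j)
lemma frob_meas {D : E3 × ℝ → Fin 3 → Fin 3 → ℝ} (h : Measurable D) : Measurable fun z => frob (D z) := by
  unfold frob
  refine (PiLp.continuous_toLp 2 (fun _ : Fin 3 × Fin 3 => ℝ)).measurable.comp (measurable_pi_lambda _ fun q => ?_)
  exact (measurable_pi_apply q.2).comp ((measurable_pi_apply q.1).comp h)
lemma serrin_Exf {D : E3 × ℝ → Fin 3 → Fin 3 → ℝ} (mD : Measurable D) {z₀ : E3 × ℝ} {r : ℝ} (hr : 0 < r) {γ α : ℝ≥0∞} (hα₁ : 2 ≤ α) (hα₂ : α ≠ ∞)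
    (hexp : 3 / γ + 2 / α ≤ 2) (hf : MemMixed (fun z => frob (D z)) (Metric.ball z₀.1 r) (z₀.2 - r ^ 2) z₀.2 γ α) :
    ∃ l : ℝ, 0 ≤ l ∧ l < 1 ∧ ∫⁻ t, Exf l (fun z => ‖(pcyl z₀ r).indicator D z‖ₑ) t < ∞ := by
  set a := α.toReal with ha
  have ha2 : 2 ≤ a := by simpa using ENNReal.toReal_mono hα₂ hα₁
  have ha0 : 0 < a := by linarith
  have hαe : α = ENNReal.ofReal a := (ENNReal.ofReal_toReal hα₂).symm
  have ha1 : 2 / a ≤ 1 := by rw [div_le_one ha0]; exact ha2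
  have ha3 : 0 < 2 / a := by positivity
  set q : ℝ := 3 / (1 + (1 - 2/a)) with hq
  have hq0 : 0 < q := by apply div_pos <;> linarith
  have hqγ : ENNReal.ofReal q ≤ γ := by
    rcases eq_or_ne γ ∞ with rfl | hγ
    · exact le_top
    have hγ0 : γ ≠ 0 := by
      rintro rfl
      rw [ENNReal.div_zero (by norm_num), top_add] at hexp
      exact absurd hexp (by simp)
    have hg : 0 < γ.toReal := ENNReal.toReal_pos hγ0 hγ
    have : 3 / γ.toReal + 2 / a ≤ 2 := by
      have h := ENNReal.toReal_mono (by simp) hexp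
      rw [ENNReal.toReal_add (ENNReal.div_ne_top (by simp) hγ0) (ENNReal.div_ne_top (by simp) (by rintro rfl; simp at hα₁)), ENNReal.toReal_div, ENNReal.toReal_div] at h
      simpa using h
    rw [← ENNReal.ofReal_toReal hγ]
    refine ENNReal.ofReal_le_ofReal ?_
    rw [hq, div_le_iff₀ (by linarith)]
    have h3 : 3 / γ.toReal ≤ 1 + (1 - 2/a) := by linarith
    rw [div_le_iff₀ hg] at h3; linarith
  refine ⟨1 - 2/a, by linarith, by linarith, ?_⟩
  set B := Metric.ball z₀.1 r
  have hB : volume B < ∞ := measure_ball_lt_top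
  have hB0 : 0 < volume B := Metric.measure_ball_pos _ _ hr
  set c : ℝ≥0∞ := volume B ^ (1 / q - 1 / γ.toReal) with hc
  have hct : c ≠ ∞ := by
    rw [hc]; exact ENNReal.rpow_ne_top_of_ne_zero hB0.ne' hB.ne
  have hfin : ∫⁻ t in Ioo (z₀.2 - r ^ 2) z₀.2, (eLpNorm (fun x => frob (D (x, t))) γ (volume.restrict B)) ^ a < ∞ := by
    rw [MemMixed, mixedNorm, if_neg hα₂] at hf
    exact (ENNReal.rpow_lt_top_iff_of_pos (by positivity)).1 hf
  have key : ∀ t, Exf (1 - 2/a) (fun z => ‖(pcyl z₀ r).indicator D z‖ₑ) t ≤ (Ioo (z₀.2 - r ^ 2) z₀.2).indicator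
      (fun t => c ^ a * (eLpNorm (fun x => frob (D (x, t))) γ (volume.restrict B)) ^ a) t := by
    intro t
    have hpos : 0 < 2*(1+(1-2/a))/(3*(1-(1-2/a))) := by apply div_pos <;> linarith
    by_cases ht : t ∈ Ioo (z₀.2 - r ^ 2) z₀.2
    · rw [indicator_of_mem ht, ← ENNReal.mul_rpow_of_nonneg _ _ ha0.le]
      have mf : AEStronglyMeasurable (fun x => frob (D (x, t))) (volume.restrict B) :=
        ((frob_meas mD).comp (measurable_id.prodMk measurable_const)).aestronglyMeasurable
      have h1 := eLpNorm_le_eLpNorm_mul_rpow_measure_univ hqγ mf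
      rw [Measure.restrict_apply_univ, ENNReal.toReal_ofReal hq0.le] at h1
      rw [mul_comm c]
      refine le_trans ?_ (ENNReal.rpow_le_rpow h1 ha0.le)
      rw [eLpNorm_eq_lintegral_rpow_enorm_toReal (by simpa using hq0) ENNReal.ofReal_ne_top, ENNReal.toReal_ofReal hq0.le, ← ENNReal.rpow_mul, Exf,
        show 2*(1+(1-2/a))/(3*(1-(1-2/a))) = 1 / q * a by rw [hq]; field_simp; ring]
      refine ENNReal.rpow_le_rpow ?_ (by positivity)
      rw [← lintegral_indicator Metric.isOpen_ball.measurableSet]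
      refine lintegral_mono fun x => ?_
      by_cases hx : x ∈ B
      · rw [indicator_of_mem hx, indicator_of_mem (show (x, t) ∈ pcyl z₀ r from ⟨hx, ht⟩)]
        refine ENNReal.rpow_le_rpow ?_ hq0.le
        rw [← ofReal_norm, ← ofReal_norm]; exact ENNReal.ofReal_le_ofReal (frob_le _)
      · rw [indicator_of_notMem (show (x, t) ∉ pcyl z₀ r from fun h => hx h.1), enorm_zero, ENNReal.zero_rpow_of_pos hq0]; exact zero_le
    · have : ∀ x, (pcyl z₀ r).indicator D (x, t) = 0 := fun x => indicator_of_notMem (fun h => ht h.2) _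
      rw [Exf]
      simp only [this, enorm_zero]
      rw [← hq, ENNReal.zero_rpow_of_pos hq0, lintegral_zero, ENNReal.zero_rpow_of_pos hpos]; exact zero_le
  refine (lintegral_mono key).trans_lt ?_
  rw [lintegral_indicator measurableSet_Ioo, lintegral_const_mul' _ _ (ENNReal.rpow_ne_top_of_nonneg ha0.le hct)]
  exact ENNReal.mul_lt_top (ENNReal.rpow_lt_top_of_nonneg ha0.le hct) hfin

end

/-- **Corollary 2.1, second part**: if `(v,p)` is a suitable weak solution of
the Navier–Stokes equations in `Q_T = Ω × (0,T)`, `z₀ ∈ Q_T`, the closure of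
`Q_{z₀,r}` is contained in `Q_T`, and the weak spatial gradient satisfies
`∇v ∈ L^{γ,α}_{x,t}(Q_{z₀,r})` for some `γ ∈ (3/2,∞]`, `α ∈ [2,∞)` with
`3/γ + 2/α ≤ 2`, then `z₀` is a regular point of `v`. -/
theorem gradient_serrin_implies_regular
    (Ω : Set E3) (T : ℝ) (v : E3 × ℝ → E3) (Dv : E3 × ℝ → Fin 3 → Fin 3 → ℝ)
    (p : E3 × ℝ → ℝ) (v₀ : E3 → E3) (z₀ : E3 × ℝ) (r : ℝ)
    (hΩ : IsOpen Ω) (hT : 0 < T)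
    (hsol : IsSuitableWeakSolution Ω T v Dv p v₀)
    (hz₀ : z₀ ∈ Ω ×ˢ Ioo 0 T) (hr : 0 < r)
    (hQ : closure (pcyl z₀ r) ⊆ Ω ×ˢ Ioo 0 T)
    (γ α : ℝ≥0∞) (hγ : (3 / 2 : ℝ≥0∞) < γ) (hα₁ : 2 ≤ α) (hα₂ : α ≠ ∞)
    (hexp : 3 / γ + 2 / α ≤ 2)
    (hf : MemMixed (fun z => frob (Dv z))
      (Metric.ball z₀.1 r) (z₀.2 - r ^ 2) z₀.2 γ α) :
    RegularPoint Ω T v z₀ := by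
  obtain ⟨x0, t0⟩ := z₀
  have hQ' : pcyl (x0, t0) r ⊆ Ω ×ˢ Ioo 0 T := subset_closure.trans hQ
  have L := mkLoc hΩ hsol hr hQ'
  obtain ⟨l, hl0, hl1, hE⟩ := serrin_Exf hsol.meas_Dv hr hα₁ hα₂ hexp hf
  obtain ⟨B, hB, hM⟩ := L.morrey hl0 hl1 hE
  have L1 := L.mono (r' := r/2) (by linarith) (by linarith)
  have L2 := L1.mono (r' := r/2/2) (by linarith) (by linarith)
  have hρ : 0 < r/2 := by linarith
  obtain ⟨C1, hC1, P1⟩ := L1.pass le_rfl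
  obtain ⟨C2, hC2, P2⟩ := L2.pass (show r/2/2 ≤ r/2 by linarith)
  set v1 := (pcyl (x0, t0) (r/2)).indicator ((pcyl (x0, t0) r).indicator v) with hv1
  set D1 := (pcyl (x0, t0) (r/2)).indicator ((pcyl (x0, t0) r).indicator Dv) with hD1
  set v2 := (pcyl (x0, t0) (r/2/2)).indicator v1 with hv2
  set D2 := (pcyl (x0, t0) (r/2/2)).indicator D1 with hD2
  have md : Measurable fun z => ‖D1 z‖ₑ := L1.mD.enorm
  obtain ⟨C, hC, tb⟩ := two_bound (r := r/2) (x0 := x0) hρ md (L1.mv.enorm) (fun z hz => by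
    rw [L1.D0 z fun h => hz h.1, enorm_zero]) hB hM
  set G : E3 × ℝ → ℝ≥0∞ := fun z => ‖D1 z‖ₑ * (1 + TT (r/2) (FF v1 D1) z) with hG
  have mG : Measurable G := md.mul (measurable_const.add (TT_meas hρ L1.mF))
  have hFG : ∀ᵐ z, FF v2 D2 z ≤ (1 + C1) * G z := by
    filter_upwards [P1] with z hz
    by_cases hm : z ∈ pcyl (x0, t0) (r/2/2)
    · rw [FF, hv2, hD2, indicator_of_mem hm, indicator_of_mem hm, hG, mul_left_comm]
      refine mul_le_mul_right ?_ _
      calc 1 + ‖v1 z‖ₑ ≤ (1 + TT (r/2) (FF v1 D1) z) + C1 * (1 + TT (r/2) (FF v1 D1) z) := add_le_add le_self_add (hz hm)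
        _ = _ := by ring
    · rw [FF, L2.D0 z hm, enorm_zero, zero_mul]; exact zero_le
  have hT2 := TT_ae hρ L2.mF (mG.const_mul _) hFG
  have hs : ∀ {a b : ℝ}, 0 < a → a ≤ b → pcyl (x0, t0) a ⊆ pcyl (x0, t0) b := fun {a b} h0 hab =>
    prod_mono (Metric.ball_subset_ball hab) (Ioo_subset_Ioo_left (by simp only; nlinarith))
  refine ⟨r/2/2/2, by linarith, (hs (by linarith) (by linarith)).trans hQ', (C2 * (1 + (1 + C1) * C)).toReal, ?_⟩
  rw [ae_restrict_iff' (pcyl_meas _ _)]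
  filter_upwards [P2, hT2] with z h1 h2 hz
  have h3 : TT (r/2) (fun z => (1 + C1) * G z) z ≤ (1 + C1) * C := by
    have : TT (r/2) (fun z => (1 + C1) * G z) z = (1 + C1) * TT (r/2) G z := lintegral_const_mul' _ _ (by finiteness)
    rw [this]
    exact mul_le_mul_right (tb z) _
  have h4 := (h1 hz).trans (mul_le_mul_right (add_le_add_right (h2.trans h3) 1) _)
  have e : v2 z = v z := by
    rw [hv2, hv1, indicator_of_mem (hs (by linarith) (by linarith) hz), indicator_of_mem (hs (by linarith) (by linarith) hz), indicator_of_mem (hs (by linarith) (by linarith) hz)]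
  rw [e] at h4
  have := ENNReal.toReal_mono (by finiteness) h4
  rwa [toReal_enorm] at this

end
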